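/- Assume hypotheses (H1') and (H2') hold. Then there exists φ ∈ C²(cl ω) such that φ > 0 in ω, φ = 0 on ∂ω, −Δφ = f(φ) in ω, I(φ) = 0, and φ is minimal: every ψ ∈ C²(cl ω) with ψ > 0 in ω, ψ = 0 on ∂ω, −Δψ = f(ψ) in ω and I(ψ) = 0 satisfies φ(x') ≤ ψ(x') for all x' ∈ ω. -/

import Mathlib

open MeasureTheory

/-- Partial derivative of `g : ℝ^m → ℝ` in the `i`-th coordinate direction. -/
noncomputable def pd {m : ℕ} (g : (Fin m → ℝ) → ℝ) (i : Fin m) (x : Fin m → ℝ) : ℝ :=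
  fderiv ℝ g x (Pi.single i 1)

/-- Laplacian of `g : ℝ^m → ℝ`. -/
noncomputable def lap {m : ℕ} (g : (Fin m → ℝ) → ℝ) (x : Fin m → ℝ) : ℝ :=
  ∑ i, fderiv ℝ (pd g i) x (Pi.single i 1)

/-- Partial derivative of `u : ℝ^m × ℝ → ℝ` in the `i`-th horizontal direction. -/
noncomputable def pdX {m : ℕ} (u : (Fin m → ℝ) × ℝ → ℝ) (i : Fin m)
    (p : (Fin m → ℝ) × ℝ) : ℝ :=
  fderiv ℝ u p (Pi.single i 1, 0)

/-- Partial derivative of `u : ℝ^m × ℝ → ℝ` in the last (vertical) direction. -/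
noncomputable def pdT {m : ℕ} (u : (Fin m → ℝ) × ℝ → ℝ) (p : (Fin m → ℝ) × ℝ) : ℝ :=
  fderiv ℝ u p (0, 1)

/-- Laplacian of `u : ℝ^m × ℝ → ℝ`. -/
noncomputable def lapC {m : ℕ} (u : (Fin m → ℝ) × ℝ → ℝ) (p : (Fin m → ℝ) × ℝ) : ℝ :=
  (∑ i, fderiv ℝ (pdX u i) p (Pi.single i 1, 0)) + fderiv ℝ (pdT u) p (0, 1)

/-- Primitive `F(t) = ∫₀ᵗ f(s) ds`. -/
noncomputable def primF (f : ℝ → ℝ) (t : ℝ) : ℝ := ∫ s in (0:ℝ)..t, f s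

/-- The action functional `I(v) = ∫_ω (½|∇v|² − F(v))`. -/
noncomputable def action {m : ℕ} (f : ℝ → ℝ) (ω : Set (Fin m → ℝ))
    (v : (Fin m → ℝ) → ℝ) : ℝ :=
  ∫ x in ω, ((1/2) * (∑ i, (pd v i x)^2) - primF f (v x))

/-- A set has smooth boundary if it is the strict sublevel set of a smooth defining function
whose gradient does not vanish on the boundary. -/
def HasSmoothBoundary {m : ℕ} (ω : Set (Fin m → ℝ)) : Prop :=
  ∃ ρ : (Fin m → ℝ) → ℝ, ContDiff ℝ (⊤ : ℕ∞) ρ ∧ ω = {x | ρ x < 0} ∧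
    frontier ω = {x | ρ x = 0} ∧ ∀ x ∈ frontier ω, fderiv ℝ ρ x ≠ 0

/-- Hypothesis (H1'): `f(0) = 0`, the action is nonnegative on Lipschitz functions vanishing
outside `ω`, and `0` is an isolated minimizer. -/
def H1' {m : ℕ} (f : ℝ → ℝ) (ω : Set (Fin m → ℝ)) : Prop :=
  f 0 = 0 ∧
  (∀ v : (Fin m → ℝ) → ℝ, (∃ K, LipschitzWith K v) → (∀ x ∉ ω, v x = 0) →
    0 ≤ action f ω v) ∧
  (∃ ε > (0:ℝ), ∀ v : (Fin m → ℝ) → ℝ, (∃ K, LipschitzWith K v) → (∀ x ∉ ω, v x = 0) →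
    0 < (∫ x in ω, ((∑ i, (pd v i x)^2) + (v x)^2)) →
    (∫ x in ω, ((∑ i, (pd v i x)^2) + (v x)^2)) ≤ ε → 0 < action f ω v)

/-- Hypothesis (H2'): there is a positive `C²` solution of `-Δψ = f(ψ)`, vanishing on `∂ω`,
with zero action. -/
def H2' {m : ℕ} (f : ℝ → ℝ) (ω : Set (Fin m → ℝ)) : Prop :=
  ∃ ψ : (Fin m → ℝ) → ℝ, ContDiffOn ℝ 2 ψ (closure ω) ∧ (∀ x ∈ ω, 0 < ψ x) ∧
    (∀ x ∈ frontier ω, ψ x = 0) ∧ (∀ x ∈ ω, -lap ψ x = f (ψ x)) ∧ action f ω ψ = 0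

/-- The Hamiltonian `H(t)` associated to `u` on the cylinder over `ω`. -/
noncomputable def Ham {m : ℕ} (f : ℝ → ℝ) (ω : Set (Fin m → ℝ))
    (u : (Fin m → ℝ) × ℝ → ℝ) (t : ℝ) : ℝ :=
  ∫ x' in ω, ((1/2) * ((∑ i, (pdX u i (x', t))^2) - (pdT u (x', t))^2) - primF f (u (x', t)))

open Filter Topology

/-! ### Calculus of partial derivatives and the Laplacian -/

section Calculus

variable {m : ℕ}

theorem pd_congr {u v : (Fin m → ℝ) → ℝ} {x : Fin m → ℝ} (h : u =ᶠ[𝓝 x] v) (i : Fin m) :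
    pd u i x = pd v i x := by
  simp only [pd, h.fderiv_eq]

theorem pd_eventuallyEq {u v : (Fin m → ℝ) → ℝ} {x : Fin m → ℝ} (h : u =ᶠ[𝓝 x] v) (i : Fin m) :
    pd u i =ᶠ[𝓝 x] pd v i := by
  filter_upwards [h.eventuallyEq_nhds] with y hy using pd_congr hy i

theorem lap_congr {u v : (Fin m → ℝ) → ℝ} {x : Fin m → ℝ} (h : u =ᶠ[𝓝 x] v) :
    lap u x = lap v x := by
  simp only [lap]
  exact Finset.sum_congr rfl fun i _ => by rw [(pd_eventuallyEq h i).fderiv_eq]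

theorem lap_eq_sum_pd (u : (Fin m → ℝ) → ℝ) (x : Fin m → ℝ) :
    lap u x = ∑ i, pd (pd u i) i x := rfl

theorem pd_add {u v : (Fin m → ℝ) → ℝ} {x : Fin m → ℝ} (hu : DifferentiableAt ℝ u x)
    (hv : DifferentiableAt ℝ v x) (i : Fin m) :
    pd (fun y => u y + v y) i x = pd u i x + pd v i x := by
  simp only [pd, fderiv_fun_add hu hv, add_apply]

theorem pd_sub {u v : (Fin m → ℝ) → ℝ} {x : Fin m → ℝ} (hu : DifferentiableAt ℝ u x)
    (hv : DifferentiableAt ℝ v x) (i : Fin m) :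
    pd (fun y => u y - v y) i x = pd u i x - pd v i x := by
  simp only [pd, fderiv_fun_sub hu hv, sub_apply]

theorem pd_neg (u : (Fin m → ℝ) → ℝ) (x : Fin m → ℝ) (i : Fin m) :
    pd (fun y => - u y) i x = - pd u i x := by
  simp only [pd, fderiv_fun_neg, neg_apply]

theorem pd_mul {u v : (Fin m → ℝ) → ℝ} {x : Fin m → ℝ} (hu : DifferentiableAt ℝ u x)
    (hv : DifferentiableAt ℝ v x) (i : Fin m) :
    pd (fun y => u y * v y) i x = pd u i x * v x + u x * pd v i x := by
  simp only [pd, fderiv_fun_mul hu hv, add_apply,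
    smul_apply, smul_eq_mul]
  ring

theorem pd_const_mul {u : (Fin m → ℝ) → ℝ} {x : Fin m → ℝ} (hu : DifferentiableAt ℝ u x)
    (c : ℝ) (i : Fin m) :
    pd (fun y => c * u y) i x = c * pd u i x := by
  simp only [pd, fderiv_const_mul hu, smul_apply, smul_eq_mul]

theorem pd_comp {f : ℝ → ℝ} {u : (Fin m → ℝ) → ℝ} {x : Fin m → ℝ}
    (hf : DifferentiableAt ℝ f (u x)) (hu : DifferentiableAt ℝ u x) (i : Fin m) :
    pd (fun y => f (u y)) i x = deriv f (u x) * pd u i x := by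
  have := (hf.hasDerivAt.comp_hasFDerivAt x hu.hasFDerivAt).fderiv
  simp only [pd]
  change fderiv ℝ (f ∘ u) x _ = _
  rw [this]
  simp

theorem pd_comp_add_right (u : (Fin m → ℝ) → ℝ) (a : Fin m → ℝ) (i : Fin m) :
    pd (fun y => u (y + a)) i = fun x => pd u i (x + a) := by
  ext x
  simp only [pd, fderiv_comp_add_right]

theorem lap_comp_add_right (u : (Fin m → ℝ) → ℝ) (a : Fin m → ℝ) (x : Fin m → ℝ) :
    lap (fun y => u (y + a)) x = lap u (x + a) := by
  simp only [lap_eq_sum_pd, pd_comp_add_right]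

theorem ContDiffAt.eventually_differentiableAt {u : (Fin m → ℝ) → ℝ} {x : Fin m → ℝ}
    (hu : ContDiffAt ℝ 2 u x) : ∀ᶠ y in 𝓝 x, DifferentiableAt ℝ u y := by
  filter_upwards [hu.eventually (by simp)] with y hy using hy.differentiableAt (by simp)

theorem ContDiffAt.pd {u : (Fin m → ℝ) → ℝ} {x : Fin m → ℝ}
    (hu : ContDiffAt ℝ 2 u x) (i : Fin m) : ContDiffAt ℝ 1 (pd u i) x :=
  (hu.fderiv_right (m := 1) (by norm_num)).clm_apply contDiffAt_const

theorem ContDiffAt.differentiableAt_pd {u : (Fin m → ℝ) → ℝ} {x : Fin m → ℝ}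
    (hu : ContDiffAt ℝ 2 u x) (i : Fin m) : DifferentiableAt ℝ (_root_.pd u i) x :=
  (hu.pd i).differentiableAt (by simp)

theorem pd_pd_add {u v : (Fin m → ℝ) → ℝ} {x : Fin m → ℝ} (hu : ContDiffAt ℝ 2 u x)
    (hv : ContDiffAt ℝ 2 v x) (i j : Fin m) :
    pd (pd (fun y => u y + v y) i) j x = pd (pd u i) j x + pd (pd v i) j x := by
  rw [← pd_add (hu.differentiableAt_pd i) (hv.differentiableAt_pd i)]
  refine pd_congr ?_ j
  filter_upwards [hu.eventually_differentiableAt, hv.eventually_differentiableAt] with y h1 h2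
    using pd_add h1 h2 i

theorem pd_pd_sub {u v : (Fin m → ℝ) → ℝ} {x : Fin m → ℝ} (hu : ContDiffAt ℝ 2 u x)
    (hv : ContDiffAt ℝ 2 v x) (i j : Fin m) :
    pd (pd (fun y => u y - v y) i) j x = pd (pd u i) j x - pd (pd v i) j x := by
  rw [← pd_sub (hu.differentiableAt_pd i) (hv.differentiableAt_pd i)]
  refine pd_congr ?_ j
  filter_upwards [hu.eventually_differentiableAt, hv.eventually_differentiableAt] with y h1 h2
    using pd_sub h1 h2 i

theorem pd_pd_const_mul {u : (Fin m → ℝ) → ℝ} {x : Fin m → ℝ} (hu : ContDiffAt ℝ 2 u x)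
    (c : ℝ) (i j : Fin m) :
    pd (pd (fun y => c * u y) i) j x = c * pd (pd u i) j x := by
  rw [← pd_const_mul (hu.differentiableAt_pd i)]
  refine pd_congr ?_ j
  filter_upwards [hu.eventually_differentiableAt] with y h1 using pd_const_mul h1 c i

theorem pd_pd_mul {u v : (Fin m → ℝ) → ℝ} {x : Fin m → ℝ} (hu : ContDiffAt ℝ 2 u x)
    (hv : ContDiffAt ℝ 2 v x) (i j : Fin m) :
    pd (pd (fun y => u y * v y) i) j x = pd (pd u i) j x * v x + pd u i x * pd v j x
      + (pd u j x * pd v i x + u x * pd (pd v i) j x) := by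
  have hu' := hu.differentiableAt (by simp)
  have hv' := hv.differentiableAt (by simp)
  rw [← pd_mul (hu.differentiableAt_pd i) hv', ← pd_mul hu' (hv.differentiableAt_pd i),
    ← pd_add ((hu.differentiableAt_pd i).fun_mul hv') (hu'.fun_mul (hv.differentiableAt_pd i))]
  refine pd_congr ?_ j
  filter_upwards [hu.eventually_differentiableAt, hv.eventually_differentiableAt] with y h1 h2
    using pd_mul h1 h2 i

theorem lap_add {u v : (Fin m → ℝ) → ℝ} {x : Fin m → ℝ} (hu : ContDiffAt ℝ 2 u x)
    (hv : ContDiffAt ℝ 2 v x) : lap (fun y => u y + v y) x = lap u x + lap v x := by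
  simp only [lap_eq_sum_pd, pd_pd_add hu hv, Finset.sum_add_distrib]

theorem lap_sub {u v : (Fin m → ℝ) → ℝ} {x : Fin m → ℝ} (hu : ContDiffAt ℝ 2 u x)
    (hv : ContDiffAt ℝ 2 v x) : lap (fun y => u y - v y) x = lap u x - lap v x := by
  simp only [lap_eq_sum_pd, pd_pd_sub hu hv, Finset.sum_sub_distrib]

theorem lap_const_mul {u : (Fin m → ℝ) → ℝ} {x : Fin m → ℝ} (hu : ContDiffAt ℝ 2 u x)
    (c : ℝ) : lap (fun y => c * u y) x = c * lap u x := by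
  simp only [lap_eq_sum_pd, pd_pd_const_mul hu, Finset.mul_sum]

theorem lap_neg {u : (Fin m → ℝ) → ℝ} {x : Fin m → ℝ} (hu : ContDiffAt ℝ 2 u x) :
    lap (fun y => - u y) x = - lap u x := by
  simpa using lap_const_mul hu (-1)

theorem lap_mul {u v : (Fin m → ℝ) → ℝ} {x : Fin m → ℝ} (hu : ContDiffAt ℝ 2 u x)
    (hv : ContDiffAt ℝ 2 v x) : lap (fun y => u y * v y) x =
      lap u x * v x + 2 * (∑ i, pd u i x * pd v i x) + u x * lap v x := by
  simp only [lap_eq_sum_pd, pd_pd_mul hu hv, Finset.sum_add_distrib, Finset.mul_sum,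
    Finset.sum_mul, two_mul]
  ring

theorem lap_const (c : ℝ) (x : Fin m → ℝ) : lap (fun _ => c) x = 0 := by
  have : ∀ i, pd (fun _ : Fin m → ℝ => c) i = fun _ => 0 := fun i => by ext y; simp [pd]
  simp [lap, this]

theorem pd_pd_comm {u : (Fin m → ℝ) → ℝ} {x : Fin m → ℝ} (hu : ContDiffAt ℝ 2 u x)
    (i j : Fin m) : pd (pd u i) j x = pd (pd u j) i x := by
  have hd : DifferentiableAt ℝ (fderiv ℝ u) x :=
    (hu.fderiv_right (m := 1) (by norm_num)).differentiableAt (by simp)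
  have key : ∀ i j, pd (pd u i) j x
      = fderiv ℝ (fderiv ℝ u) x (Pi.single j 1) (Pi.single i 1) := by
    intro i j
    have := hd.hasFDerivAt.clm_apply (hasFDerivAt_const (Pi.single i (1:ℝ) : Fin m → ℝ) x)
    change fderiv ℝ (fun y => fderiv ℝ u y (Pi.single i 1)) x _ = _
    rw [this.fderiv]
    simp
  rw [key, key]
  exact (hu.isSymmSndFDerivAt (by simp)).eq _ _

theorem hasDerivAt_along {u : (Fin m → ℝ) → ℝ} {x : Fin m → ℝ} {i : Fin m} {t : ℝ}
    (hu : DifferentiableAt ℝ u (x + t • Pi.single i 1)) :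
    HasDerivAt (fun s : ℝ => u (x + s • Pi.single i 1)) (pd u i (x + t • Pi.single i 1)) t := by
  have h1 : HasDerivAt (fun s : ℝ => x + s • (Pi.single i 1 : Fin m → ℝ)) (Pi.single i 1) t := by
    simpa using ((hasDerivAt_id t).smul_const (Pi.single i (1:ℝ) : Fin m → ℝ)).const_add x
  exact hu.hasFDerivAt.comp_hasDerivAt t h1

/-- The pure second derivatives are nonpositive at a local maximum. -/
theorem IsLocalMax.pd_pd_nonpos {u : (Fin m → ℝ) → ℝ} {x : Fin m → ℝ} (h : IsLocalMax u x)
    (hu : ContDiffAt ℝ 2 u x) (i : Fin m) : pd (pd u i) i x ≤ 0 := by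
  by_contra! hpos
  set e : Fin m → ℝ := Pi.single i 1
  have hline : Continuous (fun s : ℝ => x + s • e) := by fun_prop
  have h0 : Tendsto (fun s : ℝ => x + s • e) (𝓝 0) (𝓝 x) := by
    have := hline.tendsto 0
    simpa using this
  have hd : deriv (fun s : ℝ => u (x + s • e)) =ᶠ[𝓝 0] fun s => pd u i (x + s • e) := by
    filter_upwards [h0.eventually hu.eventually_differentiableAt] with s hs
      using (hasDerivAt_along hs).deriv
  have hdd : deriv (deriv (fun s : ℝ => u (x + s • e))) 0 = pd (pd u i) i x := by
    rw [hd.deriv_eq]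
    have : DifferentiableAt ℝ (pd u i) (x + (0:ℝ) • e) := by
      simpa using hu.differentiableAt_pd i
    simpa using (hasDerivAt_along this).deriv
  have hmax : IsLocalMax (fun s : ℝ => u (x + s • e)) 0 := by
    have := h0.eventually h
    simpa [IsLocalMax, IsMaxFilter] using this
  have hmin : IsLocalMin (fun s : ℝ => u (x + s • e)) 0 := by
    refine isLocalMin_of_deriv_deriv_pos (by rw [hdd]; exact hpos) hmax.deriv_eq_zero ?_
    have : ContinuousAt u (x + (0:ℝ) • e) := by simpa using hu.continuousAt
    exact this.comp (f := fun s : ℝ => x + s • e) hline.continuousAt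
  have hc : (fun s : ℝ => u (x + s • e)) =ᶠ[𝓝 0] fun _ => u (x + (0:ℝ) • e) := by
    filter_upwards [hmax, hmin] with s h1 h2 using le_antisymm h1 h2
  have hc2 : deriv (fun s : ℝ => u (x + s • e)) =ᶠ[𝓝 0] fun _ => 0 := by
    filter_upwards [hc.eventuallyEq_nhds] with s hs
    rw [hs.deriv_eq, deriv_const]
  rw [hc2.deriv_eq, deriv_const] at hdd
  exact hpos.ne hdd

/-- Maximum principle for strictly subharmonic functions. -/
theorem nonpos_of_lap_pos {U : Set (Fin m → ℝ)} (hU : IsOpen U) (hUb : Bornology.IsBounded U)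
    {u : (Fin m → ℝ) → ℝ} (hc : ContinuousOn u (closure U)) (hu : ContDiffOn ℝ 2 u U)
    (hlap : ∀ x ∈ U, 0 < lap u x) (hfr : ∀ x ∈ frontier U, u x ≤ 0) : ∀ x ∈ U, u x ≤ 0 := by
  intro x hx
  obtain ⟨z, hz, hmax⟩ := hUb.isCompact_closure.exists_isMaxOn ⟨x, subset_closure hx⟩ hc
  refine (hmax (subset_closure hx)).trans ?_
  by_cases hzU : z ∈ U
  · exfalso
    have hloc : IsLocalMax u z :=
      (hmax.on_subset subset_closure).isLocalMax (hU.mem_nhds hzU)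
    have := hlap z hzU
    have h2 : lap u z ≤ 0 := by
      rw [lap_eq_sum_pd]
      exact Finset.sum_nonpos fun i _ =>
        hloc.pd_pd_nonpos (hu.contDiffAt (hU.mem_nhds hzU)) i
    linarith
  · exact hfr z ⟨hz, by rwa [hU.interior_eq]⟩

/-- Comparison with a strict supersolution. -/
theorem abs_le_of_lap_lt {U : Set (Fin m → ℝ)} (hU : IsOpen U) (hUb : Bornology.IsBounded U)
    {u B : (Fin m → ℝ) → ℝ} {K : ℝ} (hc : ContinuousOn u (closure U)) (hu : ContDiffOn ℝ 2 u U)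
    (hBc : ContinuousOn B (closure U)) (hB : ContDiffOn ℝ 2 B U)
    (hlap : ∀ x ∈ U, |lap u x| ≤ K) (hBlap : ∀ x ∈ U, lap B x < -K)
    (hfr : ∀ x ∈ frontier U, |u x| ≤ B x) : ∀ x ∈ U, |u x| ≤ B x := by
  have hu' : ∀ x ∈ U, ContDiffAt ℝ 2 u x := fun x hx => hu.contDiffAt (hU.mem_nhds hx)
  have hB' : ∀ x ∈ U, ContDiffAt ℝ 2 B x := fun x hx => hB.contDiffAt (hU.mem_nhds hx)
  have h1 := nonpos_of_lap_pos hU hUb (u := fun x => u x - B x) (hc.sub hBc) (hu.sub hB)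
    (fun x hx => by
      rw [lap_sub (hu' x hx) (hB' x hx)]
      linarith [(abs_le.1 (hlap x hx)).1, hBlap x hx])
    (fun x hx => by linarith [(abs_le.1 (hfr x hx)).2])
  have h2 := nonpos_of_lap_pos hU hUb (u := fun x => - u x - B x) (hc.neg.sub hBc) (hu.neg.sub hB)
    (fun x hx => by
      rw [lap_sub (hu' x hx).neg (hB' x hx), lap_neg (hu' x hx)]
      linarith [(abs_le.1 (hlap x hx)).2, hBlap x hx])
    (fun x hx => by linarith [(abs_le.1 (hfr x hx)).1])
  intro x hx
  rw [abs_le]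
  constructor
  · linarith [h2 x hx]
  · linarith [h1 x hx]

end Calculus

section Interior

variable {m : ℕ}

theorem norm_single_one (i : Fin m) : ‖(Pi.single i (1:ℝ) : Fin m → ℝ)‖ = 1 := by
  rw [Pi.norm_single, norm_one]

theorem pd_coord (j k : Fin m) (c : ℝ) :
    pd (fun x : Fin m → ℝ => x j - c) k = fun _ => if j = k then 1 else 0 := by
  ext x
  have : HasFDerivAt (fun x : Fin m → ℝ => x j - c)
      (ContinuousLinearMap.proj (R := ℝ) (φ := fun _ : Fin m => ℝ) j) x :=
    (hasFDerivAt_apply j x).sub_const c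
  simp [pd, this.fderiv, Pi.single_apply]

theorem lap_coord (j : Fin m) (c : ℝ) (x : Fin m → ℝ) :
    lap (fun x : Fin m → ℝ => x j - c) x = 0 := by
  simp only [lap, pd_coord]
  simp

theorem contDiff_coord (j : Fin m) (c : ℝ) {n : WithTop ℕ∞} :
    ContDiff ℝ n (fun x : Fin m → ℝ => x j - c) := by fun_prop

theorem lap_sum {ι : Type*} (s : Finset ι) (u : ι → (Fin m → ℝ) → ℝ) {x : Fin m → ℝ}
    (hu : ∀ k ∈ s, ContDiffAt ℝ 2 (u k) x) :
    lap (fun y => ∑ k ∈ s, u k y) x = ∑ k ∈ s, lap (u k) x := by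
  classical
  induction s using Finset.induction_on with
  | empty => simp [lap_const]
  | insert a s ha ih =>
    simp only [Finset.sum_insert ha]
    rw [lap_add (hu a (by simp)) (ContDiffAt.sum fun k hk => hu k (by simp [hk])),
      ih fun k hk => hu k (by simp [hk])]

theorem lap_coord_sq (j : Fin m) (c : ℝ) (x : Fin m → ℝ) :
    lap (fun x : Fin m → ℝ => (x j - c) ^ 2) x = 2 := by
  simp only [pow_two]
  rw [lap_mul (contDiff_coord j c).contDiffAt (contDiff_coord j c).contDiffAt]
  simp [lap_coord, pd_coord]

/-- `|x - y|²` for the Euclidean norm. -/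
noncomputable def distSq (y x : Fin m → ℝ) : ℝ := ∑ j, (x j - y j) ^ 2

theorem contDiff_distSq (y : Fin m → ℝ) {n : WithTop ℕ∞} : ContDiff ℝ n (distSq y) := by
  unfold distSq; fun_prop

theorem lap_distSq (y x : Fin m → ℝ) : lap (distSq y) x = 2 * m := by
  unfold distSq
  rw [lap_sum _ _ (fun k _ => ((contDiff_coord k _).pow 2).contDiffAt)]
  simp [lap_coord_sq, mul_comm]

theorem distSq_nonneg (y x : Fin m → ℝ) : 0 ≤ distSq y x :=
  Finset.sum_nonneg fun _ _ => sq_nonneg _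

/-- Reflection across the hyperplane through `y` orthogonal to the `i`-th axis. -/
noncomputable def reflect (y : Fin m → ℝ) (i : Fin m) (x : Fin m → ℝ) : Fin m → ℝ :=
  x - (2 * (x i - y i)) • Pi.single i 1

theorem contDiff_reflect (y : Fin m → ℝ) (i : Fin m) {n : WithTop ℕ∞} :
    ContDiff ℝ n (reflect y i) := by
  unfold reflect; fun_prop

theorem pd_reflect {u : (Fin m → ℝ) → ℝ} {y x : Fin m → ℝ} {i : Fin m}
    (hu : DifferentiableAt ℝ u (reflect y i x)) (j : Fin m) :
    pd (fun z => u (reflect y i z)) j x = (if j = i then -1 else 1) * pd u j (reflect y i x) := by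
  have h1 : HasFDerivAt (reflect y i) (ContinuousLinearMap.id ℝ (Fin m → ℝ) -
      (((2:ℝ) • ContinuousLinearMap.proj (R := ℝ) (φ := fun _ : Fin m => ℝ) i)).smulRight
        (Pi.single i (1:ℝ))) x := by
    have h0 : HasFDerivAt (fun z : Fin m → ℝ => z i - y i)
        (ContinuousLinearMap.proj (R := ℝ) (φ := fun _ : Fin m => ℝ) i) x :=
      (hasFDerivAt_apply i x).sub_const (y i)
    have := (h0.const_mul 2).smul_const (Pi.single i (1:ℝ) : Fin m → ℝ)
    exact (hasFDerivAt_id x).sub this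
  have h2 := (hu.hasFDerivAt.comp x h1).fderiv
  change fderiv ℝ (u ∘ reflect y i) x _ = _
  rw [h2]
  simp only [pd, ContinuousLinearMap.comp_apply, sub_apply, ContinuousLinearMap.id_apply,
    ContinuousLinearMap.smulRight_apply, smul_apply, ContinuousLinearMap.proj_apply, smul_eq_mul,
    Pi.single_apply]
  split_ifs with h h' h'
  · subst h
    have h3 : (Pi.single i 1 : Fin m → ℝ) - ((2:ℝ) * (1:ℝ)) • Pi.single i 1
        = (-1 : ℝ) • Pi.single i 1 := by
      module
    rw [h3, map_smul, smul_eq_mul]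
  · exact absurd h.symm h'
  · exact absurd h'.symm h
  · simp

theorem lap_reflect {u : (Fin m → ℝ) → ℝ} {y x : Fin m → ℝ} {i : Fin m}
    (hu : ContDiffAt ℝ 2 u (reflect y i x)) :
    lap (fun z => u (reflect y i z)) x = lap u (reflect y i x) := by
  simp only [lap_eq_sum_pd]
  refine Finset.sum_congr rfl fun j _ => ?_
  have hcont : ContinuousAt (reflect y i) x := (contDiff_reflect y i (n := 0)).continuous.continuousAt
  have h1 : pd (fun z => u (reflect y i z)) j =ᶠ[𝓝 x]
      fun z => (if j = i then -1 else 1) * pd u j (reflect y i z) := by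
    filter_upwards [hcont.eventually hu.eventually_differentiableAt] with z hz using pd_reflect hz j
  have hd := hu.differentiableAt_pd j
  rw [pd_congr h1, pd_const_mul (u := fun z => pd u j (reflect y i z)), pd_reflect hd]
  · split_ifs <;> ring
  · exact hd.comp x ((contDiff_reflect y i (n := 1)).differentiable (by simp) x)

theorem reflect_dist (y x : Fin m → ℝ) (i j : Fin m) :
    |reflect y i x j - y j| = |x j - y j| := by
  simp only [reflect, Pi.sub_apply, Pi.smul_apply, Pi.single_apply, smul_eq_mul]
  split_ifs with h
  · subst h
    rw [← abs_neg]
    congr 1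
    ring
  · simp

theorem odd_part_le {u : (Fin m → ℝ) → ℝ} {V : Set (Fin m → ℝ)} {y : Fin m → ℝ} {d K U : ℝ}
    (hV : IsOpen V) (hd : 0 < d) (hK : 0 < K) (hyV : Metric.closedBall y d ⊆ V)
    (hu : ContDiffOn ℝ 2 u V) (hlap : ∀ x ∈ V, |lap u x| ≤ K)
    (hU : ∀ x ∈ Metric.closedBall y d, |u x| ≤ U) (i : Fin m) {s : ℝ} (hs : 0 < s) (hsd : s < d) :
    |u (y + s • Pi.single i 1) - u (y - s • Pi.single i 1)| / 2
      ≤ U / d ^ 2 * s ^ 2 + (m * U / d ^ 2 + K) * (s * (d - s)) := by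
  have hU0 : 0 ≤ U := (abs_nonneg _).trans (hU y (Metric.mem_closedBall_self hd.le))
  have hmem : ∀ x, x ∈ Metric.closedBall y d ↔ ∀ j, |x j - y j| ≤ d := by
    intro x
    rw [Metric.mem_closedBall, dist_pi_le_iff hd.le]
    simp [Real.dist_eq]
  have hrefl : ∀ x ∈ Metric.closedBall y d, reflect y i x ∈ Metric.closedBall y d := by
    intro x hx
    rw [hmem] at hx ⊢
    intro j
    rw [reflect_dist]
    exact hx j
  have huat : ∀ x ∈ Metric.closedBall y d, ContDiffAt ℝ 2 u x :=
    fun x hx => hu.contDiffAt (hV.mem_nhds (hyV hx))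
  have huat' : ∀ x ∈ Metric.closedBall y d, ContDiffAt ℝ 2 (fun z => u (reflect y i z)) x :=
    fun x hx => (huat _ (hrefl x hx)).comp x (contDiff_reflect y i).contDiffAt
  set Q : Set (Fin m → ℝ) := Metric.ball y d ∩ {x | y i < x i} with hQ
  have hQo : IsOpen Q := Metric.isOpen_ball.inter (isOpen_lt continuous_const (continuous_apply i))
  have hQc : closure Q ⊆ Metric.closedBall y d ∩ {x | y i ≤ x i} :=
    closure_minimal (Set.inter_subset_inter Metric.ball_subset_closedBall
      fun x (hx : y i < x i) => hx.le)
      (Metric.isClosed_closedBall.inter (isClosed_le continuous_const (continuous_apply i)))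
  set β : ℝ := m * U / d ^ 2 + K with hβ
  set B : (Fin m → ℝ) → ℝ := fun x =>
    U / d ^ 2 * distSq y x + β * ((x i - y i) * d - (x i - y i) ^ 2) with hB
  have hBs : ContDiff ℝ 2 B :=
    (contDiff_const.mul (contDiff_distSq y)).add
      (contDiff_const.mul (((contDiff_coord i _).mul contDiff_const).sub
        ((contDiff_coord i _).pow 2)))
  have hBlap : ∀ x, lap B x < -K := by
    intro x
    have c1 : ContDiffAt ℝ 2 (fun x : Fin m → ℝ => x i - y i) x := (contDiff_coord i _).contDiffAt
    have c2 : ContDiffAt ℝ 2 (fun x : Fin m → ℝ => (x i - y i) * d) x := c1.mul contDiffAt_const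
    rw [hB, lap_add (contDiff_const.mul (contDiff_distSq y)).contDiffAt
      (contDiffAt_const.mul (c2.sub (c1.pow 2))), lap_const_mul (contDiff_distSq y).contDiffAt,
      lap_const_mul (c2.sub (c1.pow 2)), lap_sub c2 (c1.pow 2), lap_coord_sq, lap_distSq]
    have : lap (fun x : Fin m → ℝ => (x i - y i) * d) x = 0 := by
      simp_rw [mul_comm _ d]
      rw [lap_const_mul c1, lap_coord, mul_zero]
    rw [this, hβ]
    have : U / d ^ 2 * (2 * m) + (m * U / d ^ 2 + K) * (0 - 2) = -(2 * K) := by ring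
    linarith
  set φ : (Fin m → ℝ) → ℝ := fun x => (1/2) * (u x - u (reflect y i x)) with hφ
  have hφs : ∀ x ∈ Metric.closedBall y d, ContDiffAt ℝ 2 φ x := fun x hx =>
    contDiffAt_const.mul ((huat x hx).sub (huat' x hx))
  have hQb : Q ⊆ Metric.closedBall y d := fun x hx => Metric.ball_subset_closedBall hx.1
  have key := abs_le_of_lap_lt (u := φ) (B := B) (K := K) hQo
    (Metric.isBounded_ball.subset Set.inter_subset_left)
    (fun x hx => (hφs x (hQc hx).1).continuousAt.continuousWithinAt)
    (fun x hx => (hφs x (hQb hx)).contDiffWithinAt) hBs.continuous.continuousOn hBs.contDiffOn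
    (fun x hx => by
      have hx := hQb hx
      rw [hφ, lap_const_mul ((huat x hx).sub (huat' x hx)), lap_sub (huat x hx) (huat' x hx),
        lap_reflect (huat _ (hrefl x hx))]
      have h1 := abs_le.1 (hlap x (hyV hx))
      have h2 := abs_le.1 (hlap _ (hyV (hrefl x hx)))
      rw [abs_le]; constructor <;> linarith)
    (fun x _ => hBlap x)
    (fun x hx => by
      obtain ⟨hx1, hx2⟩ := hQc hx.1
      have hx2 : y i ≤ x i := hx2
      have hβ0 : 0 ≤ β := by positivity
      have hxi : x i - y i ≤ d := (le_abs_self _).trans ((hmem x).1 hx1 i)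
      have h3 : 0 ≤ β * ((x i - y i) * d - (x i - y i) ^ 2) := by
        apply mul_nonneg hβ0
        have : (x i - y i) * d - (x i - y i) ^ 2 = (x i - y i) * (d - (x i - y i)) := by ring
        rw [this]
        exact mul_nonneg (by linarith) (by linarith)
      have h4 : 0 ≤ U / d ^ 2 * distSq y x := mul_nonneg (by positivity) (distSq_nonneg y x)
      have hxQ : x ∉ Q := by simpa [hQo.interior_eq] using hx.2
      by_cases hxy : x i = y i
      · have : reflect y i x = x := by simp [reflect, hxy]
        have h5 : φ x = 0 := by simp [hφ, this]
        rw [h5, abs_zero]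
        exact add_nonneg h4 h3
      · have hlt : y i < x i := lt_of_le_of_ne hx2 (Ne.symm hxy)
        have hnb : x ∉ Metric.ball y d := fun h => hxQ ⟨h, hlt⟩
        have : ∃ j, d ≤ |x j - y j| := by
          by_contra! hcon
          apply hnb
          rw [Metric.mem_ball, dist_pi_lt_iff hd]
          simpa [Real.dist_eq] using hcon
        obtain ⟨j, hj⟩ := this
        have h6 : d ^ 2 ≤ distSq y x := by
          calc d ^ 2 ≤ |x j - y j| ^ 2 := by gcongr
            _ = (x j - y j) ^ 2 := sq_abs _
            _ ≤ distSq y x := Finset.single_le_sum (f := fun j => (x j - y j) ^ 2)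
              (fun _ _ => sq_nonneg _) (Finset.mem_univ j)
        have h7 : U ≤ U / d ^ 2 * distSq y x := by
          calc U = U / d ^ 2 * d ^ 2 := by field_simp
            _ ≤ _ := by gcongr
        have h8 : |φ x| ≤ U := by
          have h1 := abs_le.1 (hU x hx1)
          have h2 := abs_le.1 (hU _ (hrefl x hx1))
          rw [hφ, abs_le]; constructor <;> simp only <;> linarith
        exact h8.trans (h7.trans (le_add_of_nonneg_right h3)))
  have hmemQ : y + s • Pi.single i 1 ∈ Q := by
    refine ⟨?_, by simp [hs]⟩
    rw [Metric.mem_ball, dist_eq_norm]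
    simp [norm_smul, abs_of_pos hs, hsd, norm_single_one]
  have := key _ hmemQ
  have hr : reflect y i (y + s • Pi.single i 1) = y - s • Pi.single i 1 := by
    simp only [reflect, Pi.add_apply, Pi.smul_apply, Pi.single_eq_same, smul_eq_mul]
    module
  have hq : distSq y (y + s • Pi.single i 1) = s ^ 2 := by
    simp [distSq, Pi.single_apply]
  simp only [hφ, hB, hr, hq, abs_mul] at this
  simp only [Pi.add_apply, Pi.smul_apply, Pi.single_eq_same, smul_eq_mul, mul_one,
    add_sub_cancel_left] at this
  have h12 : |(1:ℝ)/2| = 1/2 := by norm_num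
  rw [h12] at this
  calc _ = 1 / 2 * |u (y + s • Pi.single i 1) - u (y - s • Pi.single i 1)| := by ring
    _ ≤ _ := this
    _ = _ := by ring

/-- `u` is, on compact subsets of `O`, a uniform limit of `C²` functions whose Laplacian is
bounded by `K`. -/
def WeakLapBound (u : (Fin m → ℝ) → ℝ) (K : ℝ) (O : Set (Fin m → ℝ)) : Prop :=
  ∀ Q ⊆ O, IsCompact Q → ∀ ε > 0, ∃ v : (Fin m → ℝ) → ℝ, ∃ V : Set (Fin m → ℝ), IsOpen V ∧ Q ⊆ V ∧
    ContDiffOn ℝ 2 v V ∧ (∀ x ∈ V, |lap v x| ≤ K) ∧ ∀ x ∈ Q, |v x - u x| ≤ ε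

theorem WeakLapBound.of_contDiffOn {u : (Fin m → ℝ) → ℝ} {K : ℝ} {O : Set (Fin m → ℝ)}
    (hO : IsOpen O) (hu : ContDiffOn ℝ 2 u O) (hlap : ∀ x ∈ O, |lap u x| ≤ K) :
    WeakLapBound u K O :=
  fun _ hQ _ ε hε => ⟨u, O, hO, hQ, hu, hlap, fun _ _ => by simpa using hε.le⟩

/-- Interior gradient estimate. -/
theorem WeakLapBound.abs_pd_le {u : (Fin m → ℝ) → ℝ} {O : Set (Fin m → ℝ)} {y : Fin m → ℝ}
    {d K U : ℝ} (hu : WeakLapBound u K O) (hd : 0 < d) (hK : 0 < K)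
    (hyO : Metric.closedBall y d ⊆ O) (hdiff : DifferentiableAt ℝ u y)
    (hU : ∀ x ∈ Metric.closedBall y d, |u x| ≤ U) (i : Fin m) :
    |pd u i y| ≤ m * U / d + K * d := by
  set e : Fin m → ℝ := Pi.single i 1 with he
  have hball : ∀ s : ℝ, |s| ≤ d → y + s • e ∈ Metric.closedBall y d := by
    intro s hs
    rw [Metric.mem_closedBall, dist_eq_norm]
    simpa [he, norm_smul, norm_single_one] using hs
  have key : ∀ s, 0 < s → s < d →
      |u (y + s • e) - u (y - s • e)| / 2 ≤ U / d ^ 2 * s ^ 2 + (m * U / d ^ 2 + K) * (s * (d - s)) := by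
    intro s hs hsd
    have hpos : ∀ ε > 0, |u (y + s • e) - u (y - s • e)| / 2 ≤
        (U + ε) / d ^ 2 * s ^ 2 + (m * (U + ε) / d ^ 2 + K) * (s * (d - s)) + ε := by
      intro ε hε
      obtain ⟨v, V, hV, hQV, hv, hvl, hvu⟩ := hu _ hyO (isCompact_closedBall y d) ε hε
      have h1 := odd_part_le hV hd hK hQV hv hvl (U := U + ε) (fun x hx => by
        have h1 := abs_le.1 (hvu x hx)
        have h2 := abs_le.1 (hU x hx)
        rw [abs_le]; constructor <;> linarith) i hs hsd
      have h2 := abs_le.1 (hvu _ (hball s (by rw [abs_of_pos hs]; exact hsd.le)))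
      have h3 := abs_le.1 (hvu _ (hball (-s) (by rw [abs_neg, abs_of_pos hs]; exact hsd.le)))
      rw [neg_smul, ← sub_eq_add_neg] at h3
      have h4 : |u (y + s • e) - u (y - s • e)| ≤ |v (y + s • e) - v (y - s • e)| + 2 * ε := by
        have h5 := neg_abs_le (v (y + s • e) - v (y - s • e))
        have h6 := le_abs_self (v (y + s • e) - v (y - s • e))
        rw [abs_le]; constructor <;> linarith
      linarith
    have hcont : Continuous fun ε : ℝ =>
        (U + ε) / d ^ 2 * s ^ 2 + (m * (U + ε) / d ^ 2 + K) * (s * (d - s)) + ε := by fun_prop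
    have hlim : Tendsto (fun ε : ℝ =>
        (U + ε) / d ^ 2 * s ^ 2 + (m * (U + ε) / d ^ 2 + K) * (s * (d - s)) + ε) (𝓝[>] 0)
        (𝓝 (U / d ^ 2 * s ^ 2 + (m * U / d ^ 2 + K) * (s * (d - s)))) := by
      have := hcont.tendsto 0
      simp only [add_zero] at this
      exact this.mono_left nhdsWithin_le_nhds
    exact ge_of_tendsto hlim (eventually_mem_nhdsWithin.mono fun ε hε => hpos ε hε)
  -- differentiate the odd part at zero
  have hder : HasDerivAt (fun s : ℝ => u (y + s • e) - u (y - s • e)) (2 * pd u i y) 0 := by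
    have h1 : HasDerivAt (fun s : ℝ => u (y + s • e)) (pd u i y) 0 := by
      have : DifferentiableAt ℝ u (y + (0:ℝ) • e) := by simpa using hdiff
      simpa using hasDerivAt_along this
    have h2 : HasDerivAt (fun s : ℝ => u (y + (-s) • e)) (pd u i y * (-1)) 0 := by
      have h3 : HasDerivAt (fun s : ℝ => u (y + s • e)) (pd u i y) (-0) := by simpa using h1
      exact h3.comp (0:ℝ) (hasDerivAt_neg 0)
    have h3 := h1.sub h2
    have : (fun s : ℝ => u (y + s • e)) - (fun s : ℝ => u (y + (-s) • e))
        = fun s : ℝ => u (y + s • e) - u (y - s • e) := by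
      ext s; simp [sub_eq_add_neg]
    rw [this] at h3
    exact h3.congr_deriv (by ring)
  have hslope := hder.tendsto_slope_zero_right
  simp only [zero_add, zero_smul, add_zero, sub_zero, sub_self] at hslope
  have hslope2 := (hslope.abs).div_const 2
  have hright : Tendsto (fun s : ℝ => U / d ^ 2 * s + (m * U / d ^ 2 + K) * (d - s)) (𝓝[>] 0)
      (𝓝 (m * U / d + K * d)) := by
    have hc : Continuous (fun s : ℝ => U / d ^ 2 * s + (m * U / d ^ 2 + K) * (d - s)) := by fun_prop
    have := hc.tendsto 0
    have h0 : U / d ^ 2 * 0 + (m * U / d ^ 2 + K) * (d - 0) = m * U / d + K * d := by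
      field_simp; ring
    rw [h0] at this
    exact this.mono_left nhdsWithin_le_nhds
  have hfin := le_of_tendsto_of_tendsto hslope2 hright (by
    filter_upwards [Ioo_mem_nhdsGT hd] with s hs
    have h := key s hs.1 hs.2
    rw [abs_smul, abs_inv, abs_of_pos hs.1, smul_eq_mul]
    have hs1 := hs.1
    calc s⁻¹ * |u (y + s • e) - u (y - s • e)| / 2
        = s⁻¹ * (|u (y + s • e) - u (y - s • e)| / 2) := by ring
      _ ≤ s⁻¹ * (U / d ^ 2 * s ^ 2 + (m * U / d ^ 2 + K) * (s * (d - s))) := by gcongr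
      _ = _ := by field_simp)
  rw [abs_mul] at hfin
  simp only [Nat.abs_ofNat] at hfin
  linarith

end Interior

section Barrier

variable {m : ℕ}

/-- Quantitative form of the smoothness of the boundary of a bounded set `ω = {ρ < 0}`. -/
structure Collar (ω : Set (Fin m → ℝ)) (ρ : (Fin m → ℝ) → ℝ) (c C Λ R : ℝ) : Prop where
  smooth : ContDiff ℝ (⊤ : ℕ∞) ρ
  bounded : Bornology.IsBounded ω
  eq_sublevel : ω = {x | ρ x < 0}
  frontier_eq : frontier ω = {x | ρ x = 0}
  c_pos : 0 < c
  C_pos : 0 < C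
  one_le : 1 ≤ Λ
  R_pos : 0 < R
  R_le : 4 * R * C ≤ c
  gradient : ∀ x ∈ closure ω, -R < ρ x → c ≤ ∑ i, (pd ρ i x) ^ 2
  abs_pd : ∀ x ∈ closure ω, ∀ i, |pd ρ i x| ≤ C
  abs_pd_pd : ∀ x ∈ closure ω, ∀ i j, |pd (pd ρ i) j x| ≤ C
  abs_lap : ∀ x ∈ closure ω, |lap ρ x| ≤ C
  abs_lap_pd : ∀ x ∈ closure ω, ∀ i, |lap (pd ρ i) x| ≤ C
  lipschitz : ∀ x ∈ closure ω, ∀ y, dist x y ≤ 1 → |ρ x - ρ y| ≤ Λ * dist x y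
  neg_le : ∀ x ∈ closure ω, -ρ x ≤ Λ
  taylor : ∀ x ∈ closure ω, ∀ y, dist x y ≤ 1 →
    |ρ y - ρ x - fderiv ℝ ρ x (y - x)| ≤ Λ * dist x y ^ 2

theorem ContDiff.pd_smooth {g : (Fin m → ℝ) → ℝ} (hg : ContDiff ℝ (⊤ : ℕ∞) g) (i : Fin m) :
    ContDiff ℝ (⊤ : ℕ∞) (pd g i) :=
  (hg.fderiv_right (m := (⊤ : ℕ∞)) (by simp)).clm_apply contDiff_const

theorem ContDiff.continuous_lap {g : (Fin m → ℝ) → ℝ} (hg : ContDiff ℝ (⊤ : ℕ∞) g) :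
    Continuous (lap g) := by
  have : lap g = fun x => ∑ i, pd (pd g i) i x := rfl
  rw [this]
  exact continuous_finsetSum _ fun i _ => ((hg.pd_smooth i).pd_smooth i).continuous

theorem exists_collar {ω : Set (Fin m → ℝ)} (hωb : Bornology.IsBounded ω)
    (hωs : HasSmoothBoundary ω) : ∃ ρ c C Λ R, Collar ω ρ c C Λ R := by
  obtain ⟨ρ, hρ, hω, hfr, hgrad⟩ := hωs
  have hK : IsCompact (closure ω) := hωb.isCompact_closure
  have bound : ∀ g : (Fin m → ℝ) → ℝ, Continuous g → ∃ A, ∀ x ∈ closure ω, |g x| ≤ A := by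
    intro g hg
    obtain ⟨A, hA⟩ := hK.exists_bound_of_continuousOn hg.continuousOn
    exact ⟨A, fun x hx => by simpa using hA x hx⟩
  choose A1 hA1 using fun i => bound _ (hρ.pd_smooth i).continuous
  choose A2 hA2 using fun i j => bound _ ((hρ.pd_smooth i).pd_smooth j).continuous
  obtain ⟨A3, hA3⟩ := bound _ hρ.continuous_lap
  choose A4 hA4 using fun i => bound _ (hρ.pd_smooth i).continuous_lap
  obtain ⟨A5, hA5⟩ := bound _ hρ.continuous
  set C := 1 + ∑ i, |A1 i| + ∑ i, ∑ j, |A2 i j| + |A3| + ∑ i, |A4 i| with hC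
  have hs1 : 0 ≤ ∑ i, |A1 i| := by positivity
  have hs2 : 0 ≤ ∑ i, ∑ j, |A2 i j| := by positivity
  have hs3 : 0 ≤ ∑ i, |A4 i| := by positivity
  have hs4 := abs_nonneg A3
  have hCpos : 0 < C := by linarith
  have hG : Continuous fun x => ∑ i, (pd ρ i x) ^ 2 :=
    continuous_finsetSum _ fun i _ => (hρ.pd_smooth i).continuous.pow 2
  have hcollar : ∃ c > 0, ∀ x ∈ closure ω, c ≤ ∑ i, (pd ρ i x) ^ 2 + |ρ x| := by
    rcases (closure ω).eq_empty_or_nonempty with he | hne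
    · exact ⟨1, one_pos, by simp [he]⟩
    · obtain ⟨z, hz, hmin⟩ := hK.exists_isMinOn hne (hG.add hρ.continuous.abs).continuousOn
      refine ⟨_, ?_, fun x hx => hmin hx⟩
      have h1 : 0 ≤ ∑ i, (pd ρ i z) ^ 2 := by positivity
      by_cases hz0 : ρ z = 0
      · have hz1 : z ∈ frontier ω := by rw [hfr]; exact hz0
        have h2 : ∃ i, pd ρ i z ≠ 0 := by
          by_contra! hcon
          apply hgrad z hz1
          refine ContinuousLinearMap.coe_injective (LinearMap.pi_ext' fun i => ?_)
          ext
          simpa [pd] using hcon i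
        obtain ⟨i, hi⟩ := h2
        have h3 : (pd ρ i z) ^ 2 ≤ ∑ i, (pd ρ i z) ^ 2 :=
          Finset.single_le_sum (f := fun i => (pd ρ i z) ^ 2) (fun _ _ => sq_nonneg _)
            (Finset.mem_univ i)
        have : 0 < (pd ρ i z) ^ 2 := by positivity
        have := abs_nonneg (ρ z)
        exact add_pos_of_pos_of_nonneg (by linarith) this
      · have : 0 < |ρ z| := abs_pos.2 hz0
        exact add_pos_of_nonneg_of_pos h1 this
  obtain ⟨c, hc, hcmin⟩ := hcollar
  have hlip : ∃ L : ℝ, ∀ x ∈ closure ω, ∀ y, dist x y ≤ 1 → |ρ x - ρ y| ≤ L * dist x y := by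
    have hK1 : IsCompact (Metric.cthickening 1 (closure ω)) := hK.cthickening
    obtain ⟨L, hL⟩ := hK1.exists_bound_of_continuousOn
      (hρ.continuous_fderiv (by simp)).continuousOn
    refine ⟨L, fun x hx y hxy => ?_⟩
    have hball : Metric.closedBall x 1 ⊆ Metric.cthickening 1 (closure ω) :=
      Metric.closedBall_subset_cthickening hx 1
    have := (convex_closedBall x 1).norm_image_sub_le_of_norm_fderiv_le (𝕜 := ℝ) (f := ρ) (C := L)
      (fun z _ => hρ.contDiffAt.differentiableAt (by simp)) (fun z hz => hL z (hball hz))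
      (x := y) (y := x) (by rw [Metric.mem_closedBall, dist_comm]; exact hxy)
      (Metric.mem_closedBall_self zero_le_one)
    rwa [← dist_eq_norm, ← dist_eq_norm, Real.dist_eq] at this
  obtain ⟨L, hL⟩ := hlip
  have htay : ∃ L : ℝ, ∀ x ∈ closure ω, ∀ y, dist x y ≤ 1 →
      |ρ y - ρ x - fderiv ℝ ρ x (y - x)| ≤ L * dist x y ^ 2 := by
    have hK1 : IsCompact (Metric.cthickening 1 (closure ω)) := hK.cthickening
    have hρ' : ContDiff ℝ (⊤ : ℕ∞) (fderiv ℝ ρ) := hρ.fderiv_right (m := (⊤ : ℕ∞)) (by simp)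
    obtain ⟨L, hL⟩ := hK1.exists_bound_of_continuousOn
      (hρ'.continuous_fderiv (by simp)).continuousOn
    refine ⟨L, fun x hx y hxy => ?_⟩
    have hball : Metric.closedBall x (dist x y) ⊆ Metric.cthickening 1 (closure ω) :=
      (Metric.closedBall_subset_closedBall hxy).trans (Metric.closedBall_subset_cthickening hx 1)
    have hL0 : 0 ≤ L := (norm_nonneg _).trans (hL x (hball (Metric.mem_closedBall_self dist_nonneg)))
    have hx' : x ∈ Metric.closedBall x (dist x y) := Metric.mem_closedBall_self dist_nonneg
    have h1 : ∀ z ∈ Metric.closedBall x (dist x y),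
        ‖fderiv ℝ ρ z - fderiv ℝ ρ x‖ ≤ L * dist x y := by
      intro z hz
      refine ((convex_closedBall x (dist x y)).norm_image_sub_le_of_norm_fderiv_le (𝕜 := ℝ)
        (fun z _ => hρ'.contDiffAt.differentiableAt (by simp)) (fun z hz => hL z (hball hz))
        hx' hz).trans ?_
      rw [← dist_eq_norm]
      exact mul_le_mul_of_nonneg_left hz hL0
    have := (convex_closedBall x (dist x y)).norm_image_sub_le_of_norm_fderiv_le' (𝕜 := ℝ) (f := ρ)
      (fun z _ => hρ.contDiffAt.differentiableAt (by simp)) h1 hx'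
      (by rw [Metric.mem_closedBall, dist_comm] : y ∈ Metric.closedBall x (dist x y))
    rwa [← dist_eq_norm y x, dist_comm y x, mul_assoc, ← pow_two, Real.norm_eq_abs] at this
  obtain ⟨L2, hL2⟩ := htay
  have hc2 : 0 < c / 2 := by positivity
  refine ⟨ρ, c / 2, C, 1 + |L| + |A5| + |L2|, min (c / 2) (c / 2 / (4 * C)), hρ, hωb, hω, hfr, hc2, hCpos,
    ?_, lt_min hc2 (by positivity), ?_, ?_, ?_, ?_, ?_, ?_, ?_, ?_, ?_⟩
  · have := abs_nonneg L; have := abs_nonneg A5; have := abs_nonneg L2; linarith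
  · calc 4 * min (c / 2) (c / 2 / (4 * C)) * C ≤ 4 * (c / 2 / (4 * C)) * C := by
          gcongr; exact min_le_right _ _
      _ = c / 2 := by field_simp
  · intro x hx hxR
    have h1 := hcmin x hx
    have h2 : ρ x ≤ 0 := by
      have : closure ω ⊆ {x | ρ x ≤ 0} :=
        closure_minimal (fun x hx => by rw [hω] at hx; exact (show ρ x < 0 from hx).le)
          (isClosed_le hρ.continuous continuous_const)
      exact this hx
    rw [abs_of_nonpos h2] at h1
    have h3 := min_le_left (c / 2) (c / 2 / (4 * C))
    linarith
  · intro x hx i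
    have h1 : |A1 i| ≤ ∑ i, |A1 i| :=
      Finset.single_le_sum (f := fun i => |A1 i|) (fun _ _ => abs_nonneg _) (Finset.mem_univ i)
    have := hA1 i x hx
    have := le_abs_self (A1 i)
    linarith
  · intro x hx i j
    have h1 : |A2 i j| ≤ ∑ j, |A2 i j| :=
      Finset.single_le_sum (f := fun j => |A2 i j|) (fun _ _ => abs_nonneg _) (Finset.mem_univ j)
    have h2 : ∑ j, |A2 i j| ≤ ∑ i, ∑ j, |A2 i j| :=
      Finset.single_le_sum (f := fun i => ∑ j, |A2 i j|)
        (fun _ _ => Finset.sum_nonneg fun _ _ => abs_nonneg _) (Finset.mem_univ i)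
    have := hA2 i j x hx
    have := le_abs_self (A2 i j)
    linarith
  · intro x hx
    have := hA3 x hx
    have := le_abs_self A3
    linarith
  · intro x hx i
    have h1 : |A4 i| ≤ ∑ i, |A4 i| :=
      Finset.single_le_sum (f := fun i => |A4 i|) (fun _ _ => abs_nonneg _) (Finset.mem_univ i)
    have := hA4 i x hx
    have := le_abs_self (A4 i)
    linarith
  · intro x hx y hxy
    refine (hL x hx y hxy).trans (mul_le_mul_of_nonneg_right ?_ dist_nonneg)
    have := le_abs_self L; have := abs_nonneg A5; have := abs_nonneg L2; linarith
  · intro x hx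
    have := (abs_le.1 (hA5 x hx)).1
    have := le_abs_self A5; have := abs_nonneg L; have := abs_nonneg L2; linarith
  · intro x hx y hxy
    refine (hL2 x hx y hxy).trans (mul_le_mul_of_nonneg_right ?_ (by positivity))
    have := le_abs_self L2; have := abs_nonneg A5; have := abs_nonneg L; linarith

namespace Collar

variable {ω : Set (Fin m → ℝ)} {ρ : (Fin m → ℝ) → ℝ} {c C Λ R : ℝ}

theorem mem_iff (D : Collar ω ρ c C Λ R) {x : Fin m → ℝ} : x ∈ ω ↔ ρ x < 0 := by
  rw [D.eq_sublevel]; rfl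

theorem isOpen (D : Collar ω ρ c C Λ R) : IsOpen ω := by
  rw [D.eq_sublevel]
  exact isOpen_lt D.smooth.continuous continuous_const

theorem mem_closure_iff (D : Collar ω ρ c C Λ R) {x : Fin m → ℝ} : x ∈ closure ω ↔ ρ x ≤ 0 := by
  rw [closure_eq_self_union_frontier, D.frontier_eq, Set.mem_union, D.mem_iff, Set.mem_ofPred_eq,
    le_iff_lt_or_eq]

/-- Boundary barrier estimate. -/
theorem abs_le (D : Collar ω ρ c C Λ R) {u : (Fin m → ℝ) → ℝ} {K U r : ℝ}
    (hu : WeakLapBound u K ω) (hK : 0 < K) (hr : 0 < r) (hrR : r ≤ R)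
    (hU : ∀ x ∈ ω, |u x| ≤ U)
    (hbd : ∀ τ > 0, ∃ δ > 0, ∀ x ∈ ω, -δ < ρ x → |u x| ≤ τ) {x : Fin m → ℝ} (hx : x ∈ ω) :
    |u x| ≤ (16 * r * K / c + 2 * U / r) * (-ρ x) := by
  have hc := D.c_pos
  have hC := D.C_pos
  have hU0 : 0 ≤ U := (abs_nonneg _).trans (hU x hx)
  set A : ℝ := 16 * r * K / c + 2 * U / r with hA
  have hA0 : 0 < A := by positivity
  have hAU : U ≤ A * (3 / 4 * r) := by
    have h1 : U ≤ (2 * U / r) * (3 / 4 * r) := by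
      have : (2 * U / r) * (3 / 4 * r) = 3 / 2 * U := by field_simp; ring
      linarith
    have h2 : (2 * U / r) * (3 / 4 * r) ≤ A * (3 / 4 * r) := by
      gcongr
      rw [hA]
      have : 0 ≤ 16 * r * K / c := by positivity
      linarith
    exact h1.trans h2
  have hρx : ρ x < 0 := D.mem_iff.1 hx
  rcases le_or_gt (ρ x) (-r) with hfar | hnear
  · calc |u x| ≤ U := hU x hx
      _ ≤ A * (3 / 4 * r) := hAU
      _ ≤ A * (-ρ x) := by gcongr; linarith
  refine le_of_forall_pos_le_add fun τ' hτ' => ?_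
  set τ := τ' / 3 with hτdef
  have hτ : 0 < τ := by positivity
  obtain ⟨δ₀, hδ₀, hδu⟩ := hbd τ hτ
  obtain ⟨δ, hδ, hδlt⟩ := exists_between (lt_min hδ₀ (neg_pos.2 hρx))
  have hδ1 : δ < δ₀ := hδlt.trans_le (min_le_left _ _)
  have hδ2 : δ < -ρ x := hδlt.trans_le (min_le_right _ _)
  set G : Set (Fin m → ℝ) := {y | -r < ρ y} ∩ {y | ρ y < -δ} with hG
  set Q : Set (Fin m → ℝ) := {y | -r ≤ ρ y} ∩ {y | ρ y ≤ -δ} with hQ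
  have hρc := D.smooth.continuous
  have hGo : IsOpen G := (isOpen_lt continuous_const hρc).inter (isOpen_lt hρc continuous_const)
  have hQcl : IsClosed Q :=
    (isClosed_le continuous_const hρc).inter (isClosed_le hρc continuous_const)
  have hGQ : G ⊆ Q := Set.inter_subset_inter (fun y (hy : -r < ρ y) => hy.le)
    (fun y (hy : ρ y < -δ) => hy.le)
  have hQω : Q ⊆ ω := fun y hy => D.mem_iff.2 (lt_of_le_of_lt hy.2 (by linarith))
  have hclG : closure G ⊆ Q := closure_minimal hGQ hQcl
  have hQcomp : IsCompact Q := Metric.isCompact_of_isClosed_isBounded hQcl (D.bounded.subset hQω)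
  obtain ⟨v, V, hV, hQV, hv, hvl, hvu⟩ := hu Q hQω hQcomp τ hτ
  set B : (Fin m → ℝ) → ℝ := fun y => A * (-ρ y - 1 / (4 * r) * (ρ y * ρ y)) + 2 * τ with hB
  have hρ2 : ContDiff ℝ 2 ρ := D.smooth.of_le (WithTop.coe_le_coe.2 le_top)
  have hBs : ContDiff ℝ 2 B :=
    (contDiff_const.mul (hρ2.neg.sub (contDiff_const.mul (hρ2.mul hρ2)))).add contDiff_const
  have hBge : ∀ y ∈ Q, A * (3 / 4 * (-ρ y)) + 2 * τ ≤ B y := by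
    intro y hy
    have h1 : -r ≤ ρ y := hy.1
    have h2 : ρ y ≤ -δ := hy.2
    have h3 : 1 / (4 * r) * (ρ y * ρ y) ≤ 1 / 4 * (-ρ y) := by
      have : ρ y * ρ y ≤ r * (-ρ y) := by nlinarith
      calc 1 / (4 * r) * (ρ y * ρ y) ≤ 1 / (4 * r) * (r * (-ρ y)) := by gcongr
        _ = 1 / 4 * (-ρ y) := by field_simp
    have h4 : A * (3 / 4 * (-ρ y)) ≤ A * (-ρ y - 1 / (4 * r) * (ρ y * ρ y)) := by
      apply mul_le_mul_of_nonneg_left _ hA0.le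
      linarith
    simp only [hB]; linarith
  have hlapB : ∀ y ∈ G, lap B y < -K := by
    intro y hy
    have h1 : -r < ρ y := hy.1
    have h2 : ρ y < -δ := hy.2
    have hyK : y ∈ closure ω := subset_closure (hQω (hGQ hy))
    have cρ := hρ2.contDiffAt (x := y)
    have hl : lap B y = A * (-lap ρ y - 1 / (4 * r) *
        (lap ρ y * ρ y + 2 * (∑ i, pd ρ i y * pd ρ i y) + ρ y * lap ρ y)) := by
      rw [hB, lap_add (contDiffAt_const.mul (cρ.neg.sub (contDiffAt_const.mul (cρ.mul cρ))))
        contDiffAt_const, lap_const_mul (cρ.neg.sub (contDiffAt_const.mul (cρ.mul cρ))),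
        lap_sub cρ.neg (contDiffAt_const.mul (cρ.mul cρ)), lap_neg cρ,
        lap_const_mul (cρ.mul cρ), lap_mul cρ cρ, lap_const, add_zero]
    have hg : c ≤ ∑ i, pd ρ i y * pd ρ i y := by
      have := D.gradient y hyK (by linarith)
      simpa only [pow_two] using this
    have hl1 := _root_.abs_le.1 (D.abs_lap y hyK)
    have hrc : 4 * r * C ≤ c := le_trans (by gcongr) D.R_le
    have h5 : -(2 * r * C) ≤ lap ρ y * ρ y + ρ y * lap ρ y := by
      have : |lap ρ y * ρ y| ≤ C * r := by
        rw [abs_mul]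
        have : |ρ y| ≤ r := by rw [_root_.abs_le]; constructor <;> linarith
        exact mul_le_mul (D.abs_lap y hyK) this (abs_nonneg _) hC.le
      have := (_root_.abs_le.1 this).1
      nlinarith
    have h6 : 3 / 2 * c ≤ lap ρ y * ρ y + 2 * (∑ i, pd ρ i y * pd ρ i y) + ρ y * lap ρ y := by
      linarith
    have h7 : 1 / (4 * r) * (3 / 2 * c) ≤ 1 / (4 * r) *
        (lap ρ y * ρ y + 2 * (∑ i, pd ρ i y * pd ρ i y) + ρ y * lap ρ y) := by gcongr
    have h8 : C ≤ c / (4 * r) := by rw [le_div_iff₀ (by positivity)]; linarith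
    have h9 : 1 / (4 * r) * (3 / 2 * c) = c / (4 * r) + c / (8 * r) := by field_simp; norm_num
    have h10 : lap B y ≤ A * (-(c / (8 * r))) := by
      rw [hl]
      apply mul_le_mul_of_nonneg_left _ hA0.le
      linarith
    have h11 : 2 * K ≤ A * (c / (8 * r)) := by
      have : 2 * K = (16 * r * K / c) * (c / (8 * r)) := by field_simp; norm_num
      rw [this]
      gcongr
      rw [hA]
      have : 0 ≤ 2 * U / r := by positivity
      linarith
    linarith
  have key := abs_le_of_lap_lt (u := v) (B := B) (K := K) hGo (D.bounded.subset (hGQ.trans hQω))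
    (hv.continuousOn.mono (hclG.trans hQV)) (hv.mono (hGQ.trans hQV)) hBs.continuous.continuousOn
    hBs.contDiffOn (fun y hy => hvl y (hQV (hGQ hy))) hlapB (fun y hy => by
      have hyQ := hclG hy.1
      have hyω := hQω hyQ
      have hyG : y ∉ G := by simpa [hGo.interior_eq] using hy.2
      have h1 : -r ≤ ρ y := hyQ.1
      have h2 : ρ y ≤ -δ := hyQ.2
      have hvy : |v y| ≤ |u y| + τ := by
        have := abs_sub_abs_le_abs_sub (v y) (u y)
        linarith [hvu y hyQ]
      refine le_trans hvy (le_trans ?_ (hBge y hyQ))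
      rcases h2.lt_or_eq with h3 | h3
      · have h4 : ρ y = -r := by
          by_contra hne
          exact hyG ⟨lt_of_le_of_ne h1 (Ne.symm hne), h3⟩
        rw [h4, neg_neg]
        linarith [hU y hyω]
      · have h5 := hδu y hyω (by linarith)
        have : 0 ≤ A * (3 / 4 * (-ρ y)) := mul_nonneg hA0.le (by linarith)
        linarith) x ⟨hnear, by show ρ x < -δ; linarith⟩
  have hxQ : x ∈ Q := hGQ ⟨hnear, by show ρ x < -δ; linarith⟩
  have h1 : |u x| ≤ |v x| + τ := by
    have h2 := abs_sub_abs_le_abs_sub (u x) (v x)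
    rw [abs_sub_comm] at h2
    linarith [hvu x hxQ]
  have h2 : B x ≤ A * (-ρ x) + 2 * τ := by
    have : 0 ≤ A * (1 / (4 * r) * (ρ x * ρ x)) := by
      have := mul_self_nonneg (ρ x)
      positivity
    simp only [hB]; linarith
  linarith

end Collar

end Barrier

section Gradient

variable {m : ℕ}

namespace Collar

variable {ω : Set (Fin m → ℝ)} {ρ : (Fin m → ℝ) → ℝ} {c C Λ R : ℝ}

theorem neg_mem_Icc (D : Collar ω ρ c C Λ R) {x y : Fin m → ℝ} {r : ℝ} (hy : y ∈ ω)
    (hr : r ≤ -ρ y) (hx : x ∈ Metric.closedBall y (r / (2 * Λ))) :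
    -ρ y - r / 2 ≤ -ρ x ∧ -ρ x ≤ -ρ y + r / 2 := by
  have hΛ := D.one_le
  have hcl := subset_closure (s := ω) hy
  have h1 : dist y x ≤ r / (2 * Λ) := by rw [dist_comm]; exact hx
  have h2 : r / (2 * Λ) ≤ 1 := by
    rw [div_le_one (by linarith)]
    linarith [D.neg_le y hcl]
  have h3 := _root_.abs_le.1 (D.lipschitz y hcl x (h1.trans h2))
  have h4 : Λ * dist y x ≤ r / 2 := by
    calc Λ * dist y x ≤ Λ * (r / (2 * Λ)) := by gcongr
      _ = r / 2 := by field_simp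
  constructor <;> linarith

theorem closedBall_subset (D : Collar ω ρ c C Λ R) {y : Fin m → ℝ} {r : ℝ} (hy : y ∈ ω)
    (hr : r ≤ -ρ y) : Metric.closedBall y (r / (2 * Λ)) ⊆ ω := fun x hx => by
  have h := D.neg_mem_Icc hy hr hx
  have := D.mem_iff.1 hy
  exact D.mem_iff.2 (by linarith)

theorem abs_pd_le_of_far (D : Collar ω ρ c C Λ R) {u : (Fin m → ℝ) → ℝ} {K U r : ℝ}
    (hu : WeakLapBound u K ω) (hK : 0 < K) (hr : 0 < r) (hU : ∀ x ∈ ω, |u x| ≤ U)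
    {y : Fin m → ℝ} (hy : y ∈ ω) (hry : r ≤ -ρ y) (hd : DifferentiableAt ℝ u y) (i : Fin m) :
    |pd u i y| ≤ r * K + 2 * m * Λ * U / r := by
  have hΛ := D.one_le
  have hsub := D.closedBall_subset hy hry
  have h1 := hu.abs_pd_le (d := r / (2 * Λ)) (by positivity) hK hsub hd (fun x hx => hU x (hsub hx)) i
  have h2 : K * (r / (2 * Λ)) ≤ r * K := by
    have : r / (2 * Λ) ≤ r := div_le_self hr.le (by linarith)
    nlinarith
  have h3 : m * U / (r / (2 * Λ)) = 2 * m * Λ * U / r := by field_simp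
  linarith

theorem abs_pd_le (D : Collar ω ρ c C Λ R) {u : (Fin m → ℝ) → ℝ} {K U r : ℝ}
    (hu : WeakLapBound u K ω) (hK : 0 < K) (hr : 0 < r) (hrR : r ≤ R)
    (hU : ∀ x ∈ ω, |u x| ≤ U)
    (hbd : ∀ τ > 0, ∃ δ > 0, ∀ x ∈ ω, -δ < ρ x → |u x| ≤ τ)
    {y : Fin m → ℝ} (hy : y ∈ ω) (hd : DifferentiableAt ℝ u y) (i : Fin m) :
    |pd u i y| ≤ (48 * m * Λ / c + 1) * r * K + 6 * m * Λ * U / r := by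
  have hΛ := D.one_le
  have hc := D.c_pos
  have hU0 : 0 ≤ U := (abs_nonneg _).trans (hU y hy)
  rcases le_or_gt r (-ρ y) with h | h
  · have h1 := D.abs_pd_le_of_far hu hK hr hU hy h hd i
    have h2 : 0 ≤ 4 * m * Λ * U / r := by positivity
    have h3 : 0 ≤ 48 * m * Λ / c * r * K := by positivity
    have h4 : 6 * m * Λ * U / r = 4 * m * Λ * U / r + 2 * m * Λ * U / r := by ring
    linarith
  · set b := -ρ y with hb
    have hb0 : 0 < b := by have := D.mem_iff.1 hy; linarith
    set A := 16 * r * K / c + 2 * U / r with hA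
    have hA0 : 0 ≤ A := by positivity
    have hsub := D.closedBall_subset hy le_rfl
    have h1 := hu.abs_pd_le (d := b / (2 * Λ)) (U := A * (3 / 2 * b)) (by positivity) hK hsub hd
      (fun x hx => by
        refine (D.abs_le hu hK hr hrR hU hbd (hsub hx)).trans ?_
        have := (D.neg_mem_Icc hy le_rfl hx).2
        gcongr
        linarith) i
    have h2 : K * (b / (2 * Λ)) ≤ r * K := by
      have : b / (2 * Λ) ≤ b := div_le_self hb0.le (by linarith)
      nlinarith
    have h3 : m * (A * (3 / 2 * b)) / (b / (2 * Λ)) = 3 * m * Λ * A := by field_simp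
    have h4 : 3 * m * Λ * A = 48 * m * Λ / c * r * K + 6 * m * Λ * U / r := by
      rw [hA]; field_simp; ring
    linarith

theorem decay_of_continuousOn (D : Collar ω ρ c C Λ R) {u : (Fin m → ℝ) → ℝ}
    (hu : ContinuousOn u (closure ω)) (hu0 : ∀ x ∈ frontier ω, u x = 0) :
    ∀ τ > 0, ∃ δ > 0, ∀ x ∈ ω, -δ < ρ x → |u x| ≤ τ := by
  intro τ hτ
  have hcl : IsClosed (closure ω ∩ {x | τ ≤ |u x|}) :=
    hu.abs.preimage_isClosed_of_isClosed isClosed_closure isClosed_Ici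
  have hK : IsCompact (closure ω ∩ {x | τ ≤ |u x|}) :=
    D.bounded.isCompact_closure.of_isClosed_subset hcl Set.inter_subset_left
  rcases (closure ω ∩ {x | τ ≤ |u x|}).eq_empty_or_nonempty with he | hne
  · refine ⟨1, one_pos, fun x hx _ => ?_⟩
    by_contra! hcon
    have : x ∈ closure ω ∩ {x | τ ≤ |u x|} := ⟨subset_closure hx, hcon.le⟩
    rw [he] at this
    exact this
  · obtain ⟨z, hz, hmax⟩ := hK.exists_isMaxOn hne D.smooth.continuous.continuousOn
    have hz1 : τ ≤ |u z| := hz.2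
    have hz2 : ρ z ≤ 0 := D.mem_closure_iff.1 hz.1
    have hz3 : ρ z ≠ 0 := fun h => by
      have : u z = 0 := hu0 z (by rw [D.frontier_eq]; exact h)
      rw [this, abs_zero] at hz1
      linarith
    refine ⟨-ρ z, by have := lt_of_le_of_ne hz2 hz3; linarith, fun x hx hxz => ?_⟩
    by_contra! hcon
    have : ρ x ≤ ρ z := hmax ⟨subset_closure hx, hcon.le⟩
    linarith

/-- Global gradient estimate for functions with bounded Laplacian vanishing on the boundary. -/
theorem exists_gradient_bound (D : Collar ω ρ c C Λ R) :
    ∃ A > 0, ∀ (w : (Fin m → ℝ) → ℝ) (W K : ℝ), 0 < K → ContinuousOn w (closure ω) →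
      (∀ x ∈ frontier ω, w x = 0) → ContDiffOn ℝ 2 w ω → (∀ x ∈ ω, |w x| ≤ W) →
      (∀ x ∈ ω, |lap w x| ≤ K) → ∀ x ∈ ω,
      |w x| ≤ A * (W + K) * (-ρ x) ∧ ∀ i, |pd w i x| ≤ A * (W + K) := by
  have hΛ := D.one_le
  have hc := D.c_pos
  have hR := D.R_pos
  refine ⟨(48 * m * Λ / c + 1) * R + 6 * m * Λ / R + 16 * R / c + 2 / R, by positivity, ?_⟩
  intro w W K hK hw hw0 hw2 hW hl x hx
  have hwl := WeakLapBound.of_contDiffOn D.isOpen hw2 hl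
  have hdec := D.decay_of_continuousOn hw hw0
  have hW0 : 0 ≤ W := (abs_nonneg _).trans (hW x hx)
  have hx0 := D.mem_iff.1 hx
  constructor
  · refine (D.abs_le hwl hK hR le_rfl hW hdec hx).trans ?_
    have h0 : 0 ≤ (48 * m * Λ / c + 1) * R * (W + K) + 6 * m * Λ / R * (W + K)
      + 16 * R / c * W + 2 / R * K := by positivity
    gcongr
    · linarith
    · have : 16 * R * K / c + 2 * W / R = 16 * R / c * K + 2 / R * W := by ring
      linarith
  · intro i
    refine (D.abs_pd_le hwl hK hR le_rfl hW hdec hx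
      ((hw2.contDiffAt (D.isOpen.mem_nhds hx)).differentiableAt (by simp)) i).trans ?_
    have h0 : 0 ≤ (48 * m * Λ / c + 1) * R * W + 6 * m * Λ / R * K
      + 16 * R / c * (W + K) + 2 / R * (W + K) := by positivity
    have : 6 * m * Λ * W / R = 6 * m * Λ / R * W := by ring
    linarith

end Collar

end Gradient

section Tangential

variable {m : ℕ}

theorem exists_sub_eq_mul_pd {u : (Fin m → ℝ) → ℝ} {x : Fin m → ℝ} {i : Fin m} {h : ℝ}
    (hh : 0 < h) (hu : ∀ s ∈ Set.Icc 0 h, DifferentiableAt ℝ u (x + s • Pi.single i 1)) :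
    ∃ θ ∈ Set.Ioo 0 h, u (x + h • Pi.single i 1) - u x = h * pd u i (x + θ • Pi.single i 1) := by
  obtain ⟨θ, hθ, h1⟩ := exists_hasDerivAt_eq_slope (fun s : ℝ => u (x + s • Pi.single i 1))
    (fun s => pd u i (x + s • Pi.single i 1)) hh
    (fun s hs => (hasDerivAt_along (hu s hs)).continuousAt.continuousWithinAt)
    (fun s hs => hasDerivAt_along (hu s ⟨hs.1.le, hs.2.le⟩))
  refine ⟨θ, hθ, ?_⟩
  simp only [zero_smul, add_zero, sub_zero] at h1
  rw [h1]
  field_simp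

theorem exists_diffQuot_approx {O : Set (Fin m → ℝ)} (hO : IsOpen O) {w : (Fin m → ℝ) → ℝ}
    {G M L : ℝ} (hw : ContDiffOn ℝ 2 w O) (hG : ∀ x ∈ O, ∀ i, |pd w i x| ≤ G)
    (hM : ∀ x ∈ O, ∀ i j, |pd (pd w i) j x| ≤ M) (hg : ∀ x ∈ O, DifferentiableAt ℝ (lap w) x)
    (hL : ∀ x ∈ O, ∀ j, |pd (lap w) j x| ≤ L) {Q : Set (Fin m → ℝ)} (hQ : IsCompact Q)
    (hQO : Q ⊆ O) {ε : ℝ} (hε : 0 < ε) :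
    ∃ (p : Fin m → (Fin m → ℝ) → ℝ) (V : Set (Fin m → ℝ)), IsOpen V ∧ Q ⊆ V ∧ V ⊆ O ∧
      ∀ j, ContDiffOn ℝ 2 (p j) V ∧ ∀ x ∈ V, |p j x| ≤ G ∧ (∀ k, |pd (p j) k x| ≤ M) ∧
        |lap (p j) x| ≤ L ∧ |p j x - pd w j x| ≤ ε := by
  obtain ⟨δ, hδ, hδO⟩ := hQ.exists_cthickening_subset_open hO hQO
  set h := min (δ / 2) (ε / (|M| + 1)) with hh
  have hMp : 0 < |M| + 1 := by positivity
  have hh0 : 0 < h := lt_min (by positivity) (by positivity)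
  have hseg : ∀ x ∈ Metric.thickening (δ / 2) Q, ∀ j, ∀ s ∈ Set.Icc 0 h,
      x + s • (Pi.single j 1 : Fin m → ℝ) ∈ O := by
    intro x hx j s hs
    obtain ⟨z, hz, hxz⟩ := Metric.mem_thickening_iff.1 hx
    refine hδO (Metric.mem_cthickening_of_dist_le _ z _ _ hz ?_)
    have h1 : dist (x + s • (Pi.single j 1 : Fin m → ℝ)) x ≤ δ / 2 := by
      rw [dist_eq_norm, add_sub_cancel_left, norm_smul, norm_single_one, mul_one, Real.norm_eq_abs,
        abs_of_nonneg hs.1]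
      exact hs.2.trans (min_le_left _ _)
    linarith [dist_triangle (x + s • (Pi.single j 1 : Fin m → ℝ)) x z]
  have h0 : (0:ℝ) ∈ Set.Icc 0 h := ⟨le_rfl, hh0.le⟩
  have h1 : h ∈ Set.Icc 0 h := ⟨hh0.le, le_rfl⟩
  have hVO : Metric.thickening (δ / 2) Q ⊆ O := fun x hx => by
    by_contra hcon
    rcases isEmpty_or_nonempty (Fin m) with hm | ⟨⟨j⟩⟩
    · obtain ⟨z, hz, -⟩ := Metric.mem_thickening_iff.1 hx
      exact hcon (Subsingleton.elim z x ▸ hQO hz)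
    · simpa using hcon (by simpa using hseg x hx j 0 h0)
  have cd : ∀ x ∈ O, ContDiffAt ℝ 2 w x := fun x hx => hw.contDiffAt (hO.mem_nhds hx)
  refine ⟨fun j x => h⁻¹ * (w (x + h • Pi.single j 1) - w x), Metric.thickening (δ / 2) Q,
    Metric.isOpen_thickening, Metric.self_subset_thickening (by positivity) Q, hVO, fun j => ?_⟩
  set e : Fin m → ℝ := Pi.single j 1 with he
  have cd1 : ∀ x ∈ Metric.thickening (δ / 2) Q, ContDiffAt ℝ 2 (fun y => w (y + h • e)) x :=
    fun x hx => (cd _ (hseg x hx j h h1)).comp x (contDiffAt_id.add contDiffAt_const)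
  have cd0 : ∀ x ∈ Metric.thickening (δ / 2) Q, ContDiffAt ℝ 2 w x := fun x hx => cd x (hVO hx)
  have bnd : ∀ x ∈ Metric.thickening (δ / 2) Q, ∀ u : (Fin m → ℝ) → ℝ, ∀ B : ℝ,
      (∀ z ∈ O, DifferentiableAt ℝ u z) → (∀ z ∈ O, |pd u j z| ≤ B) →
      |h⁻¹ * (u (x + h • e) - u x)| ≤ B := by
    intro x hx u B hu hB
    obtain ⟨θ, hθ, h2⟩ := exists_sub_eq_mul_pd hh0 (fun s hs => hu _ (hseg x hx j s hs))
    rw [h2, inv_mul_cancel_left₀ hh0.ne']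
    exact hB _ (hseg x hx j θ ⟨hθ.1.le, hθ.2.le⟩)
  refine ⟨fun x hx => (contDiffAt_const.mul ((cd1 x hx).sub (cd0 x hx))).contDiffWithinAt,
    fun x hx => ⟨?_, fun k => ?_, ?_, ?_⟩⟩
  · exact bnd x hx w G (fun z hz => (cd z hz).differentiableAt (by simp)) (fun z hz => hG z hz j)
  · have d1 := (cd1 x hx).differentiableAt (by simp)
    have d0 := (cd0 x hx).differentiableAt (by simp)
    change |pd (fun y => h⁻¹ * (w (y + h • e) - w y)) k x| ≤ M
    rw [pd_const_mul (u := fun y => w (y + h • e) - w y) (d1.sub d0), pd_sub d1 d0,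
      pd_comp_add_right]
    exact bnd x hx (pd w k) M (fun z hz => (cd z hz).differentiableAt_pd k) (fun z hz => hM z hz k j)
  · rw [lap_const_mul ((cd1 x hx).sub (cd0 x hx)), lap_sub (cd1 x hx) (cd0 x hx),
      lap_comp_add_right]
    exact bnd x hx (lap w) L hg (fun z hz => hL z hz j)
  · obtain ⟨θ, hθ, h2⟩ := exists_sub_eq_mul_pd hh0
      (fun s hs => (cd _ (hseg x hx j s hs)).differentiableAt (by simp))
    obtain ⟨θ', hθ', h3⟩ := exists_sub_eq_mul_pd (u := pd w j) (x := x) (i := j) hθ.1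
      (fun s hs => (cd _ (hseg x hx j s ⟨hs.1, hs.2.trans hθ.2.le⟩)).differentiableAt_pd j)
    simp only
    rw [h2, inv_mul_cancel_left₀ hh0.ne', h3, abs_mul, abs_of_pos hθ.1]
    have h4 := hM _ (hseg x hx j θ' ⟨hθ'.1.le, (hθ'.2.trans hθ.2).le⟩) j j
    calc θ * |pd (pd w j) j (x + θ' • e)| ≤ (ε / (|M| + 1)) * (|M| + 1) := by
          apply mul_le_mul (hθ.2.le.trans (min_le_right _ _)) _ (abs_nonneg _) (by positivity)
          linarith [le_abs_self M]
      _ = ε := by field_simp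

theorem weakLapBound_pd {O : Set (Fin m → ℝ)} (hO : IsOpen O) {w : (Fin m → ℝ) → ℝ}
    {G M L : ℝ} (hw : ContDiffOn ℝ 2 w O) (hG : ∀ x ∈ O, ∀ i, |pd w i x| ≤ G)
    (hM : ∀ x ∈ O, ∀ i j, |pd (pd w i) j x| ≤ M) (hg : ∀ x ∈ O, DifferentiableAt ℝ (lap w) x)
    (hL : ∀ x ∈ O, ∀ j, |pd (lap w) j x| ≤ L) (j : Fin m) : WeakLapBound (pd w j) L O := by
  intro Q hQO hQ ε hε
  obtain ⟨p, V, hV, hQV, -, hp⟩ := exists_diffQuot_approx hO hw hG hM hg hL hQ hQO hε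
  exact ⟨p j, V, hV, hQV, (hp j).1, fun x hx => ((hp j).2 x hx).2.2.1,
    fun x hx => ((hp j).2 x (hQV hx)).2.2.2⟩

theorem abs_lap_mul_le {a p : (Fin m → ℝ) → ℝ} {x : Fin m → ℝ} {C G M L : ℝ}
    (ha : ContDiffAt ℝ 2 a x) (hp : ContDiffAt ℝ 2 p x) (ha0 : |a x| ≤ C)
    (ha1 : ∀ k, |pd a k x| ≤ C) (ha2 : |lap a x| ≤ C) (hp0 : |p x| ≤ G)
    (hp1 : ∀ k, |pd p k x| ≤ M) (hp2 : |lap p x| ≤ L) :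
    |lap (fun y => a y * p y) x| ≤ C * L + 2 * m * C * M + C * G := by
  have hC : 0 ≤ C := (abs_nonneg _).trans ha0
  rw [lap_mul ha hp]
  have h1 : |lap a x * p x| ≤ C * G := by
    rw [abs_mul]; exact mul_le_mul ha2 hp0 (abs_nonneg _) hC
  have h2 : |a x * lap p x| ≤ C * L := by
    rw [abs_mul]; exact mul_le_mul ha0 hp2 (abs_nonneg _) hC
  have h3 : |∑ k, pd a k x * pd p k x| ≤ m * (C * M) := by
    refine (Finset.abs_sum_le_sum_abs _ _).trans ?_
    refine (Finset.sum_le_card_nsmul _ _ (C * M) fun k _ => ?_).trans (by simp)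
    rw [abs_mul]; exact mul_le_mul (ha1 k) (hp1 k) (abs_nonneg _) hC
  have h4 := abs_add_three (lap a x * p x) (2 * ∑ k, pd a k x * pd p k x) (a x * lap p x)
  rw [abs_mul 2, abs_two] at h4
  linarith

theorem weakLapBound_combination {O : Set (Fin m → ℝ)} (hO : IsOpen O)
    {w a b : (Fin m → ℝ) → ℝ} {C G M L : ℝ} (hw : ContDiffOn ℝ 2 w O)
    (hG : ∀ x ∈ O, ∀ i, |pd w i x| ≤ G) (hM : ∀ x ∈ O, ∀ i j, |pd (pd w i) j x| ≤ M)
    (hg : ∀ x ∈ O, DifferentiableAt ℝ (lap w) x) (hL : ∀ x ∈ O, ∀ j, |pd (lap w) j x| ≤ L)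
    (ha : ContDiff ℝ 2 a) (hb : ContDiff ℝ 2 b) (hC : 0 < C)
    (ha0 : ∀ x ∈ O, |a x| ≤ C) (ha1 : ∀ x ∈ O, ∀ k, |pd a k x| ≤ C) (ha2 : ∀ x ∈ O, |lap a x| ≤ C)
    (hb0 : ∀ x ∈ O, |b x| ≤ C) (hb1 : ∀ x ∈ O, ∀ k, |pd b k x| ≤ C) (hb2 : ∀ x ∈ O, |lap b x| ≤ C)
    (i j : Fin m) :
    WeakLapBound (fun x => a x * pd w j x - b x * pd w i x)
      (2 * (C * L + 2 * m * C * M + C * G)) O := by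
  intro Q hQO hQ ε hε
  obtain ⟨p, V, hV, hQV, hVO, hp⟩ := exists_diffQuot_approx hO hw hG hM hg hL hQ hQO
    (show 0 < ε / (2 * C) by positivity)
  have cd : ∀ k, ∀ x ∈ V, ContDiffAt ℝ 2 (p k) x := fun k x hx => (hp k).1.contDiffAt (hV.mem_nhds hx)
  refine ⟨fun x => a x * p j x - b x * p i x, V, hV, hQV,
    (ha.contDiffOn.mul (hp j).1).sub (hb.contDiffOn.mul (hp i).1), fun x hx => ?_, fun x hx => ?_⟩
  · rw [lap_sub (ha.contDiffAt.mul (cd j x hx)) (hb.contDiffAt.mul (cd i x hx))]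
    have h1 := abs_lap_mul_le ha.contDiffAt (cd j x hx) (ha0 x (hVO hx)) (ha1 x (hVO hx))
      (ha2 x (hVO hx)) ((hp j).2 x hx).1 ((hp j).2 x hx).2.1 ((hp j).2 x hx).2.2.1
    have h2 := abs_lap_mul_le hb.contDiffAt (cd i x hx) (hb0 x (hVO hx)) (hb1 x (hVO hx))
      (hb2 x (hVO hx)) ((hp i).2 x hx).1 ((hp i).2 x hx).2.1 ((hp i).2 x hx).2.2.1
    have h3 := abs_sub (lap (fun y => a y * p j y) x) (lap (fun y => b y * p i y) x)
    linarith
  · have hxO := hQO hx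
    have e1 : |a x * (p j x - pd w j x)| ≤ C * (ε / (2 * C)) := by
      rw [abs_mul]
      exact mul_le_mul (ha0 x hxO) ((hp j).2 x (hQV hx)).2.2.2 (abs_nonneg _) hC.le
    have e2 : |b x * (p i x - pd w i x)| ≤ C * (ε / (2 * C)) := by
      rw [abs_mul]
      exact mul_le_mul (hb0 x hxO) ((hp i).2 x (hQV hx)).2.2.2 (abs_nonneg _) hC.le
    have e3 : C * (ε / (2 * C)) = ε / 2 := by field_simp
    have e4 := abs_sub (a x * (p j x - pd w j x)) (b x * (p i x - pd w i x))
    have e5 : a x * p j x - b x * p i x - (a x * pd w j x - b x * pd w i x)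
        = a x * (p j x - pd w j x) - b x * (p i x - pd w i x) := by ring
    rw [e5]
    linarith

theorem hasDerivAt_comp_line {u : (Fin m → ℝ) → ℝ} {x t : Fin m → ℝ} {s : ℝ}
    (hu : DifferentiableAt ℝ u (x + s • t)) :
    HasDerivAt (fun s : ℝ => u (x + s • t)) (fderiv ℝ u (x + s • t) t) s := by
  have h1 : HasDerivAt (fun s : ℝ => x + s • t) t s := by
    simpa using ((hasDerivAt_id s).smul_const t).const_add x
  exact hu.hasFDerivAt.comp_hasDerivAt s h1

namespace Collar

variable {ω : Set (Fin m → ℝ)} {ρ : (Fin m → ℝ) → ℝ} {c C Λ R : ℝ}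

/-- Tangential derivatives of a function vanishing on the boundary vanish on the boundary. -/
theorem abs_tangential_le (D : Collar ω ρ c C Λ R) {w : (Fin m → ℝ) → ℝ} {A M : ℝ}
    (hw : ContDiffOn ℝ 2 w ω) (hA : ∀ x ∈ ω, |w x| ≤ A * (-ρ x))
    (hM : ∀ x ∈ ω, ∀ i j, |pd (pd w i) j x| ≤ M) (i j : Fin m) {x : Fin m → ℝ} (hx : x ∈ ω) :
    |pd ρ i x * pd w j x - pd ρ j x * pd w i x|
      ≤ (5 * Λ * C ^ 2 * A + 4 * C ^ 2 * M) * Real.sqrt (-ρ x / (2 * Λ * C ^ 2)) := by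
  have hΛ := D.one_le
  have hC := D.C_pos
  have hxc := subset_closure hx
  have hx0 := D.mem_iff.1 hx
  set δ := -ρ x with hδ
  have hδ0 : 0 < δ := by linarith
  set h := Real.sqrt (δ / (2 * Λ * C ^ 2)) with hh
  have hh0 : 0 < h := Real.sqrt_pos.2 (by positivity)
  have hh2 : h ^ 2 = δ / (2 * Λ * C ^ 2) := Real.sq_sqrt (by positivity)
  have hh3 : Λ * (h * C) ^ 2 = δ / 2 := by rw [mul_pow, hh2]; field_simp
  set α := pd ρ i x with hα
  set β := pd ρ j x with hβ
  set t : Fin m → ℝ := α • Pi.single j 1 - β • Pi.single i 1 with ht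
  have hαC : |α| ≤ C := D.abs_pd x hxc i
  have hβC : |β| ≤ C := D.abs_pd x hxc j
  have app : ∀ (u : (Fin m → ℝ) → ℝ) z, fderiv ℝ u z t = α * pd u j z - β * pd u i z := by
    intro u z; simp [ht, pd]
  have hρt : fderiv ℝ ρ x t = 0 := by rw [app]; ring
  have hts : ‖t‖ ≤ 2 * C := by
    refine (norm_sub_le _ _).trans ?_
    rw [norm_smul, norm_smul, norm_single_one, norm_single_one, Real.norm_eq_abs, Real.norm_eq_abs]
    linarith
  have htC : ‖t‖ ≤ C := by
    by_cases hij : i = j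
    · subst hij
      have : t = 0 := by rw [ht, hα, hβ, sub_self]
      rw [this, norm_zero]; exact hC.le
    · refine (pi_norm_le_iff_of_nonneg hC.le).2 fun k => ?_
      simp only [ht, Pi.sub_apply, Pi.smul_apply, Pi.single_apply, smul_eq_mul, Real.norm_eq_abs]
      split_ifs with h1 h2 h2
      · exact absurd (h2.symm.trans h1) hij
      · simpa using hαC
      · simpa using hβC
      · simpa using hC.le
  have hseg : ∀ s ∈ Set.Icc 0 h, |ρ (x + s • t) - ρ x| ≤ δ / 2 := by
    intro s hs
    have hd : dist x (x + s • t) ≤ h * C := by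
      rw [dist_eq_norm, sub_add_cancel_left, norm_neg, norm_smul, Real.norm_eq_abs,
        abs_of_nonneg hs.1]
      exact mul_le_mul hs.2 htC (norm_nonneg _) hh0.le
    have hhC : h * C ≤ 1 := by
      have h1 : (h * C) ^ 2 ≤ 1 := by
        have := D.neg_le x hxc
        nlinarith
      exact (sq_le_one_iff₀ (by positivity)).1 h1
    have h2 := D.taylor x hxc _ (hd.trans hhC)
    rw [add_sub_cancel_left, map_smul, hρt, smul_zero, sub_zero] at h2
    refine h2.trans ?_
    rw [← hh3]
    gcongr
  have hsegω : ∀ s ∈ Set.Icc 0 h, x + s • t ∈ ω := fun s hs => D.mem_iff.2 (by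
    have := (_root_.abs_le.1 (hseg s hs)).2
    linarith)
  have cd : ∀ z ∈ ω, ContDiffAt ℝ 2 w z := fun z hz => hw.contDiffAt (D.isOpen.mem_nhds hz)
  obtain ⟨θ, hθ, h1⟩ := exists_hasDerivAt_eq_slope (fun s : ℝ => w (x + s • t))
    (fun s => fderiv ℝ w (x + s • t) t) hh0
    (fun s hs => (hasDerivAt_comp_line ((cd _ (hsegω s hs)).differentiableAt
      (by simp))).continuousAt.continuousWithinAt)
    (fun s hs => hasDerivAt_comp_line ((cd _ (hsegω s ⟨hs.1.le, hs.2.le⟩)).differentiableAt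
      (by simp)))
  set T : (Fin m → ℝ) → ℝ := fun z => α * pd w j z - β * pd w i z with hT
  have dT : ∀ z ∈ ω, DifferentiableAt ℝ T z := fun z hz =>
    (((cd z hz).differentiableAt_pd j).const_mul α).sub (((cd z hz).differentiableAt_pd i).const_mul β)
  have hM0 : 0 ≤ M := (abs_nonneg _).trans (hM x hx i j)
  have hTt : ∀ z ∈ ω, |fderiv ℝ T z t| ≤ 4 * C ^ 2 * M := by
    intro z hz
    have dj := (cd z hz).differentiableAt_pd j
    have di := (cd z hz).differentiableAt_pd i
    have hk : ∀ k, |pd T k z| ≤ 2 * C * M := by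
      intro k
      rw [hT, pd_sub (dj.const_mul α) (di.const_mul β), pd_const_mul dj, pd_const_mul di]
      have e1 : |α * pd (pd w j) k z| ≤ C * M := by
        rw [abs_mul]; exact mul_le_mul hαC (hM z hz j k) (abs_nonneg _) hC.le
      have e2 : |β * pd (pd w i) k z| ≤ C * M := by
        rw [abs_mul]; exact mul_le_mul hβC (hM z hz i k) (abs_nonneg _) hC.le
      have := abs_sub (α * pd (pd w j) k z) (β * pd (pd w i) k z)
      linarith
    rw [app]
    have e1 : |α * pd T j z| ≤ C * (2 * C * M) := by
      rw [abs_mul]; exact mul_le_mul hαC (hk j) (abs_nonneg _) hC.le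
    have e2 : |β * pd T i z| ≤ C * (2 * C * M) := by
      rw [abs_mul]; exact mul_le_mul hβC (hk i) (abs_nonneg _) hC.le
    have := abs_sub (α * pd T j z) (β * pd T i z)
    linarith
  obtain ⟨θ', hθ', h2⟩ := exists_hasDerivAt_eq_slope (fun s : ℝ => T (x + s • t))
    (fun s => fderiv ℝ T (x + s • t) t) hθ.1
    (fun s hs => (hasDerivAt_comp_line (dT _ (hsegω s
      ⟨hs.1, hs.2.trans hθ.2.le⟩))).continuousAt.continuousWithinAt)
    (fun s hs => hasDerivAt_comp_line (dT _ (hsegω s ⟨hs.1.le, (hs.2.trans hθ.2).le⟩)))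
  simp only [zero_smul, add_zero, sub_zero] at h1 h2
  rw [app] at h1
  change T (x + θ • t) = _ at h1
  have h3 : |T (x + θ • t) - T x| ≤ 4 * C ^ 2 * M * h := by
    have h4 : T (x + θ • t) - T x = fderiv ℝ T (x + θ' • t) t * θ := by
      rw [h2]; field_simp [hθ.1.ne']
    rw [h4, abs_mul, abs_of_pos hθ.1]
    exact mul_le_mul (hTt _ (hsegω θ' ⟨hθ'.1.le, (hθ'.2.trans hθ.2).le⟩)) hθ.2.le hθ.1.le
      (by positivity)
  have hA0 : 0 ≤ A := by
    have := (abs_nonneg _).trans (hA x hx)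
    exact (mul_nonneg_iff_of_pos_right hδ0).1 this
  have h5 : |T (x + θ • t)| ≤ 5 * Λ * C ^ 2 * A * h := by
    rw [h1, abs_div, abs_of_pos hh0, div_le_iff₀ hh0]
    have hhm : h ∈ Set.Icc 0 h := ⟨hh0.le, le_rfl⟩
    have e1 := hA _ (hsegω h hhm)
    have e2 := hA x hx
    have e3 : -ρ (x + h • t) ≤ 3 / 2 * δ := by
      have := (_root_.abs_le.1 (hseg h hhm)).1
      linarith
    have e4 : A * (-ρ (x + h • t)) ≤ A * (3 / 2 * δ) := mul_le_mul_of_nonneg_left e3 hA0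
    have e5 := abs_sub (w (x + h • t)) (w x)
    have e6 : 5 * Λ * C ^ 2 * A * h * h = A * (5 / 2 * δ) := by
      have : h * h = δ / (2 * Λ * C ^ 2) := by rw [← pow_two, hh2]
      rw [mul_assoc _ h h, this]; field_simp
    rw [e6]
    linarith
  have h6 : |T x| ≤ |T (x + θ • t)| + |T (x + θ • t) - T x| := by
    have := abs_sub (T (x + θ • t)) (T (x + θ • t) - T x)
    rwa [sub_sub_cancel] at this
  calc |T x| ≤ _ := h6
    _ ≤ _ := by linarith

theorem decay_tangential (D : Collar ω ρ c C Λ R) {w : (Fin m → ℝ) → ℝ} {A M : ℝ}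
    (hw : ContDiffOn ℝ 2 w ω) (hA : ∀ x ∈ ω, |w x| ≤ A * (-ρ x))
    (hM : ∀ x ∈ ω, ∀ i j, |pd (pd w i) j x| ≤ M) (i j : Fin m) :
    ∀ τ > 0, ∃ δ > 0, ∀ x ∈ ω, -δ < ρ x →
      |pd ρ i x * pd w j x - pd ρ j x * pd w i x| ≤ τ := by
  intro τ hτ
  have hcont : Tendsto (fun s : ℝ => (5 * Λ * C ^ 2 * A + 4 * C ^ 2 * M) *
      Real.sqrt (s / (2 * Λ * C ^ 2))) (𝓝 0) (𝓝 0) := by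
    have : Continuous fun s : ℝ => (5 * Λ * C ^ 2 * A + 4 * C ^ 2 * M) *
      Real.sqrt (s / (2 * Λ * C ^ 2)) := by fun_prop
    simpa using this.tendsto 0
  obtain ⟨δ, hδ, h⟩ := Metric.eventually_nhds_iff.1 (hcont.eventually (gt_mem_nhds hτ))
  refine ⟨δ, hδ, fun x hx hxδ => (D.abs_tangential_le hw hA hM i j hx).trans (h ?_).le⟩
  have := D.mem_iff.1 hx
  rw [Real.dist_eq, sub_zero, abs_of_pos (by linarith)]
  linarith

end Collar

end Tangential

section Hessian

variable {m : ℕ}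

theorem abs_sum_le_mul {ι : Type*} [Fintype ι] {a : ι → ℝ} {B : ℝ} (h : ∀ i, |a i| ≤ B) :
    |∑ i, a i| ≤ Fintype.card ι * B :=
  (Finset.abs_sum_le_sum_abs _ _).trans
    ((Finset.sum_le_card_nsmul _ _ B fun i _ => h i).trans (by simp))

theorem abs_le_of_tangential {n : Fin m → ℝ} {H : Fin m → Fin m → ℝ} {c C Y G : ℝ} (hc : 0 < c)
    (hC : 0 ≤ C) (hsymm : ∀ i j, H i j = H j i) (hn : ∀ i, |n i| ≤ C) (hnc : c ≤ ∑ i, n i ^ 2)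
    (hY : ∀ i j l, |n i * H j l - n j * H i l| ≤ Y) (hG : |∑ i, H i i| ≤ G) (j l : Fin m) :
    |H j l| ≤ (2 * m * C * Y + C ^ 2 * G) / c := by
  have h1 : ∑ i, n i * H i l = n l * ∑ i, H i i - ∑ i, (n l * H i i - n i * H l i) := by
    rw [Finset.sum_sub_distrib, Finset.mul_sum, sub_sub_cancel]
    exact Finset.sum_congr rfl fun i _ => by rw [hsymm]
  have h2 : |∑ i, n i * H i l| ≤ C * G + m * Y := by
    rw [h1]
    refine (abs_sub _ _).trans (add_le_add ?_ ?_)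
    · rw [abs_mul]; exact mul_le_mul (hn l) hG (abs_nonneg _) hC
    · simpa using abs_sum_le_mul fun i => hY l i i
  have h3 : (∑ i, n i ^ 2) * H j l
      = ∑ i, n i * (n i * H j l - n j * H i l) + n j * ∑ i, n i * H i l := by
    rw [Finset.sum_mul, Finset.mul_sum, ← Finset.sum_add_distrib]
    exact Finset.sum_congr rfl fun i _ => by ring
  have h4 : |(∑ i, n i ^ 2) * H j l| ≤ m * (C * Y) + C * (C * G + m * Y) := by
    rw [h3]
    refine (abs_add_le _ _).trans (add_le_add ?_ ?_)
    · refine (abs_sum_le_mul (B := C * Y) fun i => ?_).trans (by simp)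
      rw [abs_mul]; exact mul_le_mul (hn i) (hY i j l) (abs_nonneg _) hC
    · rw [abs_mul]; exact mul_le_mul (hn j) h2 (abs_nonneg _) hC
  rw [abs_mul, abs_of_pos (hc.trans_le hnc)] at h4
  rw [le_div_iff₀ hc]
  have := mul_le_mul_of_nonneg_right hnc (abs_nonneg (H j l))
  linarith

namespace Collar

variable {ω : Set (Fin m → ℝ)} {ρ : (Fin m → ℝ) → ℝ} {c C Λ R : ℝ}

theorem hessian_improve (D : Collar ω ρ c C Λ R) {w : (Fin m → ℝ) → ℝ} {G G' L M r A : ℝ}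
    (hr : 0 < r) (hrR : r ≤ R) (hL0 : 0 < L) (hA : ∀ x ∈ ω, |w x| ≤ A * (-ρ x))
    (hw : ContDiffOn ℝ 2 w ω) (hG : ∀ x ∈ ω, ∀ i, |pd w i x| ≤ G) (hG' : ∀ x ∈ ω, |lap w x| ≤ G')
    (hg : ∀ x ∈ ω, DifferentiableAt ℝ (lap w) x) (hL : ∀ x ∈ ω, ∀ j, |pd (lap w) j x| ≤ L)
    (hM : ∀ x ∈ ω, ∀ i j, |pd (pd w i) j x| ≤ M) :
    ∀ x ∈ ω, ∀ i j, |pd (pd w i) j x| ≤ 8 * m ^ 2 * C ^ 2 * (48 * m * Λ / c + 1) / c * r * M +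
      ((2 * m * C / c) * (2 * (48 * m * Λ / c + 1) * r * C + 12 * m * Λ * C / r + 2 * C)
        + C ^ 2 / c + r + 2 * m * Λ / r) * (G + G' + L) := by
  intro x hx i j
  have hΛ := D.one_le
  have hc := D.c_pos
  have hC := D.C_pos
  have hxc := subset_closure hx
  have hG0 : 0 ≤ G := (abs_nonneg _).trans (hG x hx i)
  have hG'0 : 0 ≤ G' := (abs_nonneg _).trans (hG' x hx)
  have hM0 : 0 ≤ M := (abs_nonneg _).trans (hM x hx i j)
  have cd : ∀ z ∈ ω, ContDiffAt ℝ 2 w z := fun z hz => hw.contDiffAt (D.isOpen.mem_nhds hz)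
  set P := 48 * m * Λ / c + 1 with hP
  have hP0 : 0 < P := by positivity
  rcases le_or_gt r (-ρ x) with h | h
  · have h1 := D.abs_pd_le_of_far (weakLapBound_pd D.isOpen hw hG hM hg hL i) hL0 hr
      (fun z hz => hG z hz i) hx h ((cd x hx).differentiableAt_pd i) j
    refine h1.trans ?_
    have e1 : 0 ≤ 8 * m ^ 2 * C ^ 2 * P / c * r * M := by positivity
    have e2 : 0 ≤ ((2 * m * C / c) * (2 * P * r * C + 12 * m * Λ * C / r + 2 * C)
        + C ^ 2 / c) * (G + G' + L) := by positivity
    have e3 : 0 ≤ r * (G + G') + 2 * m * Λ / r * (G' + L) := by positivity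
    have e4 : 2 * m * Λ * G / r = 2 * m * Λ / r * G := by ring
    rw [e4]
    linarith
  · have hρ2 : ContDiff ℝ 2 ρ := D.smooth.of_le (WithTop.coe_le_coe.2 le_top)
    have hpd2 : ∀ k, ContDiff ℝ 2 (pd ρ k) := fun k =>
      (D.smooth.pd_smooth k).of_le (WithTop.coe_le_coe.2 le_top)
    have hT : ∀ i j l, |pd ρ i x * pd (pd w j) l x - pd ρ j x * pd (pd w i) l x| ≤
        P * r * (2 * (C * L + 2 * m * C * M + C * G)) + 6 * m * Λ * (2 * C * G) / r
          + 2 * C * G := by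
      intro i j l
      have dj := (cd x hx).differentiableAt_pd j
      have di := (cd x hx).differentiableAt_pd i
      have ei : DifferentiableAt ℝ (pd ρ i) x := (hpd2 i).contDiffAt.differentiableAt (by simp)
      have ej : DifferentiableAt ℝ (pd ρ j) x := (hpd2 j).contDiffAt.differentiableAt (by simp)
      have h1 := D.abs_pd_le (U := 2 * C * G) (weakLapBound_combination D.isOpen hw hG hM hg hL
        (hpd2 i) (hpd2 j)
        hC (fun z hz => D.abs_pd z (subset_closure hz) i)
        (fun z hz => D.abs_pd_pd z (subset_closure hz) i)
        (fun z hz => D.abs_lap_pd z (subset_closure hz) i)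
        (fun z hz => D.abs_pd z (subset_closure hz) j)
        (fun z hz => D.abs_pd_pd z (subset_closure hz) j)
        (fun z hz => D.abs_lap_pd z (subset_closure hz) j) i j) (by positivity) hr hrR
        (fun z hz => by
          have e1 : |pd ρ i z * pd w j z| ≤ C * G := by
            rw [abs_mul]
            exact mul_le_mul (D.abs_pd z (subset_closure hz) i) (hG z hz j) (abs_nonneg _) hC.le
          have e2 : |pd ρ j z * pd w i z| ≤ C * G := by
            rw [abs_mul]
            exact mul_le_mul (D.abs_pd z (subset_closure hz) j) (hG z hz i) (abs_nonneg _) hC.le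
          have := abs_sub (pd ρ i z * pd w j z) (pd ρ j z * pd w i z)
          linarith)
        (D.decay_tangential hw hA hM i j) hx ((ei.fun_mul dj).sub (ej.fun_mul di)) l
      rw [pd_sub (ei.fun_mul dj) (ej.fun_mul di), pd_mul ei dj, pd_mul ej di] at h1
      have e1 : |pd (pd ρ i) l x * pd w j x| ≤ C * G := by
        rw [abs_mul]; exact mul_le_mul (D.abs_pd_pd x hxc i l) (hG x hx j) (abs_nonneg _) hC.le
      have e2 : |pd (pd ρ j) l x * pd w i x| ≤ C * G := by
        rw [abs_mul]; exact mul_le_mul (D.abs_pd_pd x hxc j l) (hG x hx i) (abs_nonneg _) hC.le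
      rw [_root_.abs_le] at h1 e1 e2 ⊢
      constructor <;> linarith [h1.1, h1.2, e1.1, e1.2, e2.1, e2.2]
    have h2 := abs_le_of_tangential (n := fun i => pd ρ i x) (H := fun i j => pd (pd w i) j x)
      hc hC.le (fun i j => pd_pd_comm (cd x hx) i j) (D.abs_pd x hxc)
      (D.gradient x hxc (by linarith)) hT (hG' x hx) i j
    refine h2.trans ?_
    have e0 : (2 * m * C * (P * r * (2 * (C * L + 2 * m * C * M + C * G))
          + 6 * m * Λ * (2 * C * G) / r + 2 * C * G) + C ^ 2 * G') / c
        = 8 * m ^ 2 * C ^ 2 * P / c * r * M + (2 * m * C / c) * (2 * P * r * C * (G + L) +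
          12 * m * Λ * C / r * G + 2 * C * G) + C ^ 2 / c * G' := by
      field_simp; ring
    rw [e0]
    have e1 : 0 ≤ (2 * m * C / c) * (2 * P * r * C * G' + 12 * m * Λ * C / r * (G' + L)
      + 2 * C * (G' + L)) + C ^ 2 / c * (G + L) := by positivity
    have e2 : 0 ≤ (r + 2 * m * Λ / r) * (G + G' + L) := by positivity
    linarith

/-- Global bound for the second derivatives of a function vanishing on the boundary. -/
theorem exists_hessian_bound (D : Collar ω ρ c C Λ R) :
    ∃ B > 0, ∀ (w : (Fin m → ℝ) → ℝ) (G G' L M : ℝ), 0 < L → ContinuousOn w (closure ω) →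
      (∀ x ∈ frontier ω, w x = 0) → ContDiffOn ℝ 2 w ω → (∀ x ∈ ω, ∀ i, |pd w i x| ≤ G) →
      (∀ x ∈ ω, |lap w x| ≤ G') → (∀ x ∈ ω, DifferentiableAt ℝ (lap w) x) →
      (∀ x ∈ ω, ∀ j, |pd (lap w) j x| ≤ L) → (∀ x ∈ ω, ∀ i j, |pd (pd w i) j x| ≤ M) →
      ∀ x ∈ ω, ∀ i j, |pd (pd w i) j x| ≤ B * (G + G' + L) := by
  have hΛ := D.one_le
  have hc := D.c_pos
  have hC := D.C_pos
  have hR := D.R_pos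
  set c₃ := 8 * m ^ 2 * C ^ 2 * (48 * m * Λ / c + 1) / c with hc₃
  have hc₃0 : 0 ≤ c₃ := by positivity
  set r := R / (1 + 2 * c₃ * R) with hr
  have hr0 : 0 < r := by positivity
  have hrR : r ≤ R := div_le_self hR.le (by have : 0 ≤ 2 * c₃ * R := by positivity
                                            linarith)
  have hcr : c₃ * r ≤ 1 / 2 := by
    rw [hr, ← mul_div_assoc, div_le_iff₀ (by positivity)]
    linarith
  set B := (2 * m * C / c) * (2 * (48 * m * Λ / c + 1) * r * C + 12 * m * Λ * C / r + 2 * C)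
        + C ^ 2 / c + r + 2 * m * Λ / r with hB
  have hB0 : 0 < B := by positivity
  refine ⟨2 * B, by positivity, ?_⟩
  intro w G G' L M hL0 hwc hw0 hw hG hG' hg hL hM x hx i j
  obtain ⟨A₀, -, hA₀⟩ := D.exists_gradient_bound
  obtain ⟨W, hW⟩ := D.bounded.isCompact_closure.exists_bound_of_continuousOn hwc
  have hA := fun x hx => (hA₀ w W (|G'| + 1) (by positivity) hwc hw0 hw
    (fun x hx => hW x (subset_closure hx))
    (fun x hx => (hG' x hx).trans (by linarith [le_abs_self G'])) x hx).1
  have hM0 : 0 ≤ M := (abs_nonneg _).trans (hM x hx i j)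
  have key : ∀ n : ℕ, ∀ x ∈ ω, ∀ i j, |pd (pd w i) j x| ≤ M * (1 / 2) ^ n + 2 * B * (G + G' + L) := by
    intro n
    have hs : 0 ≤ G + G' + L := by
      have h1 := (abs_nonneg _).trans (hG x hx i)
      have h2 := (abs_nonneg _).trans (hG' x hx)
      linarith
    induction n with
    | zero =>
      intro x hx i j
      have := hM x hx i j
      have : 0 ≤ 2 * B * (G + G' + L) := by positivity
      linarith
    | succ n ih =>
      intro x hx i j
      refine (D.hessian_improve hr0 hrR hL0 hA hw hG hG' hg hL ih x hx i j).trans ?_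
      have : c₃ * r * (M * (1 / 2) ^ n + 2 * B * (G + G' + L))
          ≤ 1 / 2 * (M * (1 / 2) ^ n + 2 * B * (G + G' + L)) := by gcongr
      rw [pow_succ (1 / 2 : ℝ) n, ← hc₃, ← hB]
      linarith
  have hlim : Tendsto (fun n : ℕ => M * (1 / 2 : ℝ) ^ n + 2 * B * (G + G' + L)) atTop
      (𝓝 (M * 0 + 2 * B * (G + G' + L))) :=
    ((tendsto_pow_atTop_nhds_zero_of_lt_one (by norm_num) (by norm_num)).const_mul M).add_const _
  rw [mul_zero, zero_add] at hlim
  exact ge_of_tendsto' hlim fun n => key n x hx i j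

end Collar

end Hessian

section Geometry

variable {m : ℕ}

theorem norm_fderiv_le_sum {F : Type*} [NormedAddCommGroup F] [NormedSpace ℝ F]
    (T : (Fin m → ℝ) →L[ℝ] F) : ‖T‖ ≤ ∑ i, ‖T (Pi.single i 1)‖ := by
  refine T.opNorm_le_bound (Finset.sum_nonneg fun _ _ => norm_nonneg _) fun x => ?_
  have h : T x = ∑ i, x i • T (Pi.single i 1) := by
    conv_lhs => rw [← Finset.univ_sum_single x, map_sum]
    refine Finset.sum_congr rfl fun i _ => ?_
    rw [← map_smul, ← Pi.single_smul, smul_eq_mul, mul_one]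
  rw [h, Finset.sum_mul]
  refine (norm_sum_le _ _).trans (Finset.sum_le_sum fun i _ => ?_)
  rw [norm_smul, mul_comm]
  exact mul_le_mul_of_nonneg_left (norm_le_pi_norm x i) (norm_nonneg _)

theorem norm_image_sub_le_of_segment {E F : Type*} [NormedAddCommGroup E] [NormedSpace ℝ E]
    [NormedAddCommGroup F] [NormedSpace ℝ F] {g : E → F} {x y : E} {ε : ℝ}
    (hd : ∀ z ∈ segment ℝ x y, DifferentiableAt ℝ g z)
    (hε : ∀ z ∈ segment ℝ x y, ‖fderiv ℝ g z‖ ≤ ε) : ‖g x - g y‖ ≤ ε * ‖x - y‖ :=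
  (convex_segment x y).norm_image_sub_le_of_norm_fderiv_le (𝕜 := ℝ) hd hε
    (right_mem_segment ℝ x y) (left_mem_segment ℝ x y)

namespace Collar

variable {ω : Set (Fin m → ℝ)} {ρ : (Fin m → ℝ) → ℝ} {c C Λ R : ℝ}

/-- A local mean value inequality up to the boundary, using detours inside `ω`. -/
theorem exists_mvt (D : Collar ω ρ c C Λ R) {x₀ : Fin m → ℝ} (hx₀ : x₀ ∈ closure ω) :
    ∃ A ≥ (1:ℝ), ∃ r₀ > (0:ℝ), ∀ r, 0 < r → r ≤ r₀ → ∀ (F : Type) [NormedAddCommGroup F]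
      [NormedSpace ℝ F] (g : (Fin m → ℝ) → F) (ε : ℝ),
      (∀ z ∈ ω, z ∈ Metric.ball x₀ r → DifferentiableAt ℝ g z ∧ ‖fderiv ℝ g z‖ ≤ ε) →
      ∀ x ∈ ω, x ∈ Metric.ball x₀ (r / A) → ∀ y ∈ ω, y ∈ Metric.ball x₀ (r / A) →
        ‖g x - g y‖ ≤ A * ε * ‖x - y‖ := by
  by_cases hin : x₀ ∈ ω
  · obtain ⟨r₀, hr₀, hball⟩ := Metric.isOpen_iff.1 D.isOpen x₀ hin
    refine ⟨1, le_rfl, r₀, hr₀, fun r hr hrr F _ _ g ε hg x _ hx y _ hy => ?_⟩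
    rw [div_one] at hx hy
    rw [one_mul]
    have hs := (convex_ball x₀ r).segment_subset hx hy
    have hs' := fun z hz => hg z (hball (Metric.ball_subset_ball hrr (hs hz))) (hs hz)
    exact norm_image_sub_le_of_segment (fun z hz => (hs' z hz).1) fun z hz => (hs' z hz).2
  have hρ0 : ρ x₀ = 0 :=
    le_antisymm (D.mem_closure_iff.1 hx₀) (not_lt.1 fun h => hin (D.mem_iff.2 h))
  have hfd : fderiv ℝ ρ x₀ ≠ 0 := by
    intro h
    have h1 := D.gradient x₀ hx₀ (by rw [hρ0]; linarith [D.R_pos])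
    simp only [pd, h, zero_apply, ne_eq, OfNat.ofNat_ne_zero, not_false_eq_true,
      zero_pow, Finset.sum_const_zero] at h1
    linarith [D.c_pos]
  obtain ⟨e, he⟩ : ∃ e : Fin m → ℝ, ‖e‖ ≤ 1 ∧ 0 < fderiv ℝ ρ x₀ e := by
    obtain ⟨v, hv⟩ : ∃ v, fderiv ℝ ρ x₀ v ≠ 0 := by
      by_contra! hcon
      exact hfd (ContinuousLinearMap.ext hcon)
    have hv0 : 0 < ‖v‖ := norm_pos_iff.2 fun h => hv (by simp [h])
    rcases lt_or_gt_of_ne hv with h | h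
    · refine ⟨-(‖v‖⁻¹ • v), ?_, ?_⟩
      · rw [norm_neg, norm_smul, norm_inv, norm_norm, inv_mul_cancel₀ hv0.ne']
      · rw [map_neg, map_smul, smul_eq_mul, ← mul_neg]
        exact mul_pos (inv_pos.2 hv0) (neg_pos.2 h)
    · refine ⟨‖v‖⁻¹ • v, ?_, ?_⟩
      · rw [norm_smul, norm_inv, norm_norm, inv_mul_cancel₀ hv0.ne']
      · rw [map_smul, smul_eq_mul]
        exact mul_pos (inv_pos.2 hv0) h
  obtain ⟨he1, hepos⟩ := he
  set κ := fderiv ℝ ρ x₀ e / 2 with hκ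
  have hκ0 : 0 < κ := by positivity
  have hcont : Continuous fun z => fderiv ℝ ρ z e :=
    (D.smooth.continuous_fderiv (by simp)).clm_apply continuous_const
  obtain ⟨r₁, hr₁, hball⟩ := Metric.eventually_nhds_iff_ball.1
    (hcont.continuousAt.eventually (lt_mem_nhds (show κ < fderiv ℝ ρ x₀ e by linarith)))
  have hΛ := D.one_le
  set A₁ := Λ / κ with hA₁
  have hA₁0 : 0 < A₁ := by positivity
  refine ⟨3 + 2 * A₁, by linarith, min r₁ 1, lt_min hr₁ one_pos, ?_⟩
  intro r hr hrr F _ _ g ε hg x hx hxr y hy hyr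
  have hr1 : r ≤ 1 := hrr.trans (min_le_right _ _)
  rw [Metric.mem_ball, dist_eq_norm] at hxr hyr
  set q := r / (3 + 2 * A₁) with hq
  have hqr : (3 + 2 * A₁) * q = r := by rw [hq]; field_simp
  have hq0 : 0 < q := by positivity
  have hxy : ‖x - y‖ < 2 * q := by
    have : x - y = (x - x₀) - (y - x₀) := by abel
    rw [this]
    linarith [norm_sub_le (x - x₀) (y - x₀)]
  set h := A₁ * ‖x - y‖ with hh
  have hh0 : 0 ≤ h := by positivity
  have hκh : κ * h = Λ * ‖x - y‖ := by rw [hh, hA₁]; field_simp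
  have hhq : h ≤ A₁ * (2 * q) := mul_le_mul_of_nonneg_left hxy.le hA₁0.le
  have hmem : ∀ z : Fin m → ℝ, ‖z - x₀‖ < q → ∀ s ∈ Set.Icc 0 h, z - s • e ∈ Metric.ball x₀ r := by
    intro z hz s hs
    rw [Metric.mem_ball, dist_eq_norm]
    have h1 : ‖s • e‖ ≤ h := by
      rw [norm_smul, Real.norm_eq_abs, abs_of_nonneg hs.1]
      calc s * ‖e‖ ≤ h * 1 := mul_le_mul hs.2 he1 (norm_nonneg _) hh0
        _ = h := mul_one h
    have h2 : z - s • e - x₀ = (z - x₀) - s • e := by abel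
    rw [h2]
    have h3 := norm_sub_le (z - x₀) (s • e)
    nlinarith
  have hdec : ∀ z : Fin m → ℝ, ‖z - x₀‖ < q → ∀ s ∈ Set.Icc 0 h,
      ρ (z - s • e) ≤ ρ z - κ * s := by
    intro z hz s hs
    have hder : ∀ t, HasDerivAt (fun t : ℝ => ρ (z + t • (-e)))
        (fderiv ℝ ρ (z + t • (-e)) (-e)) t := fun t =>
      hasDerivAt_comp_line (D.smooth.contDiffAt.differentiableAt (by simp))
    have := (convex_Icc (0:ℝ) s).image_sub_le_mul_sub_of_deriv_le
      (f := fun t : ℝ => ρ (z + t • (-e))) (C := -κ)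
      (fun t _ => (hder t).continuousAt.continuousWithinAt)
      (fun t _ => (hder t).differentiableAt.differentiableWithinAt)
      (fun t ht => by
        rw [interior_Icc] at ht
        rw [(hder t).deriv, map_neg]
        have h1 := hmem z hz t ⟨ht.1.le, ht.2.le.trans hs.2⟩
        rw [sub_eq_add_neg, ← smul_neg] at h1
        have := hball _ (Metric.ball_subset_ball (hrr.trans (min_le_left _ _)) h1)
        linarith) 0 ⟨le_rfl, hs.1⟩ s ⟨hs.1, le_rfl⟩ hs.1
    simp only [zero_smul, smul_neg, ← sub_eq_add_neg, sub_zero] at this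
    linarith
  have hvert : ∀ z ∈ ω, ‖z - x₀‖ < q → ∀ p ∈ segment ℝ z (z - h • e),
      p ∈ ω ∧ p ∈ Metric.ball x₀ r := by
    intro z hz hzq p hp
    rw [segment_eq_image'] at hp
    obtain ⟨θ, hθ, rfl⟩ := hp
    have h1 : z + θ • (z - h • e - z) = z - (θ * h) • e := by
      rw [mul_smul]; module
    have h2 : θ * h ∈ Set.Icc 0 h := ⟨mul_nonneg hθ.1 hh0, mul_le_of_le_one_left hh0 hθ.2⟩
    simp only [h1]
    refine ⟨D.mem_iff.2 ?_, hmem z hzq _ h2⟩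
    have h3 := hdec z hzq _ h2
    have h4 := D.mem_iff.1 hz
    have h5 : 0 ≤ κ * (θ * h) := mul_nonneg hκ0.le h2.1
    linarith
  have hhor : ∀ p ∈ segment ℝ (x - h • e) (y - h • e), p ∈ ω ∧ p ∈ Metric.ball x₀ r := by
    intro p hp
    rw [segment_eq_image'] at hp
    obtain ⟨θ, hθ, rfl⟩ := hp
    have h1 : x - h • e + θ • (y - h • e - (x - h • e)) = (x + θ • (y - x)) - h • e := by module
    have h0 : ‖x + θ • (y - x) - x₀‖ < q := by
      have := (convex_ball x₀ q).segment_subset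
        (by rwa [Metric.mem_ball, dist_eq_norm] : x ∈ Metric.ball x₀ q)
        (by rwa [Metric.mem_ball, dist_eq_norm] : y ∈ Metric.ball x₀ q)
        (segment_eq_image' ℝ x y ▸ ⟨θ, hθ, rfl⟩ : x + θ • (y - x) ∈ segment ℝ x y)
      rwa [Metric.mem_ball, dist_eq_norm] at this
    have h2 : h ∈ Set.Icc 0 h := ⟨hh0, le_rfl⟩
    simp only [h1]
    refine ⟨D.mem_iff.2 ?_, hmem _ h0 _ h2⟩
    have h3 := hdec _ h0 _ h2
    have h4 := D.mem_iff.1 hx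
    have h5 : dist x (x + θ • (y - x)) ≤ ‖x - y‖ := by
      rw [dist_eq_norm, sub_add_cancel_left, norm_neg, norm_smul, Real.norm_eq_abs,
        abs_of_nonneg hθ.1, norm_sub_rev]
      exact mul_le_of_le_one_left (norm_nonneg _) hθ.2
    have h6 : 2 * q ≤ 1 := by nlinarith
    have h7 := (_root_.abs_le.1 (D.lipschitz x (subset_closure hx) _ (h5.trans (hxy.le.trans h6)))).1
    have h8 : Λ * dist x (x + θ • (y - x)) ≤ Λ * ‖x - y‖ :=
      mul_le_mul_of_nonneg_left h5 (by linarith)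
    linarith
  have s1 := norm_image_sub_le_of_segment (g := g) (ε := ε)
    (fun z hz => (hg z (hvert x hx hxr z hz).1 (hvert x hx hxr z hz).2).1)
    (fun z hz => (hg z (hvert x hx hxr z hz).1 (hvert x hx hxr z hz).2).2)
  have s2 := norm_image_sub_le_of_segment (g := g) (ε := ε)
    (fun z hz => (hg z (hhor z hz).1 (hhor z hz).2).1)
    (fun z hz => (hg z (hhor z hz).1 (hhor z hz).2).2)
  have s3 := norm_image_sub_le_of_segment (g := g) (ε := ε)
    (fun z hz => (hg z (hvert y hy hyr z hz).1 (hvert y hy hyr z hz).2).1)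
    (fun z hz => (hg z (hvert y hy hyr z hz).1 (hvert y hy hyr z hz).2).2)
  have hε0 : 0 ≤ ε := (norm_nonneg _).trans (hg x hx (by
    rw [Metric.mem_ball, dist_eq_norm]; nlinarith)).2
  have hhe : ‖h • e‖ ≤ h := by
    rw [norm_smul, Real.norm_eq_abs, abs_of_nonneg hh0]
    exact mul_le_of_le_one_right hh0 he1
  rw [sub_sub_cancel] at s1 s3
  rw [sub_sub_sub_cancel_right] at s2
  rw [norm_sub_rev] at s3
  have s4 : g x - g y = (g x - g (x - h • e)) + (g (x - h • e) - g (y - h • e))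
    + (g (y - h • e) - g y) := by abel
  rw [s4]
  refine norm_add₃_le.trans ?_
  have s5 : ε * ‖h • e‖ ≤ ε * h := mul_le_mul_of_nonneg_left hhe hε0
  have s6 : (3 + 2 * A₁) * ε * ‖x - y‖ = 3 * (ε * ‖x - y‖) + 2 * (ε * h) := by rw [hh]; ring
  have s7 : 0 ≤ ε * ‖x - y‖ := by positivity
  rw [s6]
  linarith

theorem hasFDerivWithinAt_closure (D : Collar ω ρ c C Λ R) {F : Type} [NormedAddCommGroup F]
    [NormedSpace ℝ F] {g : (Fin m → ℝ) → F} {x₀ : Fin m → ℝ} {L : (Fin m → ℝ) →L[ℝ] F}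
    (hx₀ : x₀ ∈ closure ω) (hg : ContinuousOn g (closure ω))
    (hd : ∀ x ∈ ω, DifferentiableAt ℝ g x) (hL : Tendsto (fderiv ℝ g) (𝓝[ω] x₀) (𝓝 L)) :
    HasFDerivWithinAt g L (closure ω) x₀ := by
  rw [hasFDerivWithinAt_iff_isLittleO, Asymptotics.isLittleO_iff]
  intro ε hε
  obtain ⟨A, hA, r₀, hr₀, hmvt⟩ := D.exists_mvt hx₀
  have hA0 : 0 < A := by linarith
  obtain ⟨r₁, hr₁, hr₁L⟩ := Metric.tendsto_nhdsWithin_nhds.1 hL (ε / A) (by positivity)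
  set r := min r₀ r₁ with hr
  have hr0 : 0 < r := lt_min hr₀ hr₁
  have key : ∀ x ∈ ω, x ∈ Metric.ball x₀ (r / A) → ∀ y ∈ ω, y ∈ Metric.ball x₀ (r / A) →
      ‖(g x - L x) - (g y - L y)‖ ≤ ε * ‖x - y‖ := by
    have := hmvt r hr0 (min_le_left _ _) F (fun z => g z - L z) (ε / A) (fun z hz hzr => by
      refine ⟨(hd z hz).sub L.differentiableAt, ?_⟩
      rw [fderiv_fun_sub (hd z hz) L.differentiableAt, ContinuousLinearMap.fderiv, ← dist_eq_norm]
      exact (hr₁L hz (Metric.mem_ball.1 (Metric.ball_subset_ball (min_le_right _ _) hzr))).le)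
    intro x hx hxr y hy hyr
    refine (this x hx hxr y hy hyr).trans (le_of_eq ?_)
    field_simp
  have hball : Metric.ball x₀ (r / A) ∈ 𝓝 x₀ := Metric.ball_mem_nhds _ (by positivity)
  have lim : ∀ y ∈ closure ω, Tendsto (fun z => g z - L z) (𝓝[ω] y) (𝓝 (g y - L y)) := fun y hy =>
    ((hg y hy).mono subset_closure).sub L.continuous.continuousWithinAt
  have key2 : ∀ x ∈ ω, x ∈ Metric.ball x₀ (r / A) →
      ‖(g x - L x) - (g x₀ - L x₀)‖ ≤ ε * ‖x - x₀‖ := by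
    intro x hx hxr
    have : (𝓝[ω] x₀).NeBot := mem_closure_iff_nhdsWithin_neBot.1 hx₀
    have t2 : Tendsto (fun y => ε * ‖x - y‖) (𝓝[ω] x₀) (𝓝 (ε * ‖x - x₀‖)) :=
      ((continuous_const.sub continuous_id).norm.const_mul ε).continuousAt.mono_left
        nhdsWithin_le_nhds
    refine le_of_tendsto_of_tendsto ((tendsto_const_nhds.sub (lim x₀ hx₀)).norm) t2 ?_
    filter_upwards [self_mem_nhdsWithin, mem_nhdsWithin_of_mem_nhds hball] with y hy hyr
      using key x hx hxr y hy hyr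
  filter_upwards [self_mem_nhdsWithin, mem_nhdsWithin_of_mem_nhds hball] with x hx hxr
  have : (𝓝[ω] x).NeBot := mem_closure_iff_nhdsWithin_neBot.1 hx
  have t2 : Tendsto (fun y => ε * ‖y - x₀‖) (𝓝[ω] x) (𝓝 (ε * ‖x - x₀‖)) :=
    ((continuous_id.sub continuous_const).norm.const_mul ε).continuousAt.mono_left
      nhdsWithin_le_nhds
  have := le_of_tendsto_of_tendsto (((lim x hx).sub tendsto_const_nhds).norm) t2 (by
    filter_upwards [self_mem_nhdsWithin, mem_nhdsWithin_of_mem_nhds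
      (Metric.isOpen_ball.mem_nhds hxr)] with y hy hyr using key2 y hy hyr)
  rwa [map_sub, sub_sub_sub_comm]

end Collar

end Geometry

section Closure

variable {m : ℕ} {ω : Set (Fin m → ℝ)}

namespace Collar

variable {ρ : (Fin m → ℝ) → ℝ} {c C Λ R : ℝ}

theorem contDiffOn_two_closure (D : Collar ω ρ c C Λ R) {φ : (Fin m → ℝ) → ℝ}
    (hc : ContinuousOn φ (closure ω)) (h2 : ContDiffOn ℝ 2 φ ω)
    (h1lim : ∀ x ∈ closure ω, ∃ L, Tendsto (fderiv ℝ φ) (𝓝[ω] x) (𝓝 L))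
    (h2lim : ∀ x ∈ closure ω, ∃ L, Tendsto (fderiv ℝ (fderiv ℝ φ)) (𝓝[ω] x) (𝓝 L)) :
    ContDiffOn ℝ 2 φ (closure ω) := by
  have hω := D.isOpen
  have hcd : ∀ x ∈ ω, ContDiffAt ℝ 2 φ x := fun x hx => h2.contDiffAt (hω.mem_nhds hx)
  have hfd : ∀ x ∈ ω, ContDiffAt ℝ 1 (fderiv ℝ φ) x := fun x hx =>
    (hcd x hx).fderiv_right (by norm_num)
  set J₁ := extendFrom ω (fderiv ℝ φ) with hJ₁
  set J₂ := extendFrom ω (fderiv ℝ (fderiv ℝ φ)) with hJ₂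
  have c1 : ContinuousOn J₁ (closure ω) := continuousOn_extendFrom subset_rfl h1lim
  have c2 : ContinuousOn J₂ (closure ω) := continuousOn_extendFrom subset_rfl h2lim
  have e1 : ∀ x ∈ ω, J₁ x = fderiv ℝ φ x :=
    extendFrom_extends fun x hx => (hfd x hx).continuousAt.continuousWithinAt
  have ee : ∀ x ∈ ω, J₁ =ᶠ[𝓝 x] fderiv ℝ φ := fun x hx => by
    filter_upwards [hω.mem_nhds hx] with y hy using e1 y hy
  have d1 : ∀ x ∈ closure ω, HasFDerivWithinAt φ (J₁ x) (closure ω) x := fun x hx =>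
    D.hasFDerivWithinAt_closure hx hc (fun y hy => (hcd y hy).differentiableAt (by norm_num))
      (tendsto_extendFrom (h1lim x hx))
  have d2 : ∀ x ∈ closure ω, HasFDerivWithinAt J₁ (J₂ x) (closure ω) x := fun x hx =>
    D.hasFDerivWithinAt_closure hx c1
      (fun y hy => ((ee y hy).differentiableAt_iff).2 ((hfd y hy).differentiableAt (by norm_num)))
      ((tendsto_extendFrom (h2lim x hx)).congr' (by
        filter_upwards [self_mem_nhdsWithin] with y hy using (ee y hy).fderiv_eq.symm))
  have g1 : ContDiffOn ℝ (0 + 1) J₁ (closure ω) :=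
    (contDiffOn_succ_iff_hasFDerivWithinAt (by simp)).2 fun x hx =>
      ⟨closure ω, by rw [Set.insert_eq_of_mem hx]; exact self_mem_nhdsWithin, by simp, J₂, d2,
        contDiffOn_zero.2 c2⟩
  have g2 : ContDiffOn ℝ (1 + 1) φ (closure ω) :=
    (contDiffOn_succ_iff_hasFDerivWithinAt (by simp)).2 fun x hx =>
      ⟨closure ω, by rw [Set.insert_eq_of_mem hx]; exact self_mem_nhdsWithin, by simp, J₁, d1,
        by simpa using g1⟩
  simpa [one_add_one_eq_two] using g2

/-- The domain is locally connected at points of its closure, in the form of a dichotomy. -/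
theorem eventually_mem_or_notMem (D : Collar ω ρ c C Λ R) {S : Set (Fin m → ℝ)}
    (hS : IsOpen (ω ∩ S)) (hS' : IsOpen (ω \ S)) {x₀ : Fin m → ℝ} (hx₀ : x₀ ∈ closure ω) :
    (∀ᶠ x in 𝓝[ω] x₀, x ∈ S) ∨ ∀ᶠ x in 𝓝[ω] x₀, x ∉ S := by
  obtain ⟨A, hA, r, hr, h⟩ := D.exists_mvt hx₀
  have key := h r hr le_rfl ℝ (S.indicator 1) 0 fun z hz _ => by
    by_cases hzS : z ∈ S
    · have e : S.indicator (1 : (Fin m → ℝ) → ℝ) =ᶠ[𝓝 z] fun _ => 1 := by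
        filter_upwards [hS.mem_nhds ⟨hz, hzS⟩] with y hy
        simp [hy.2]
      exact ⟨e.differentiableAt_iff.2 (differentiableAt_const _), by simp [e.fderiv_eq]⟩
    · have e : S.indicator (1 : (Fin m → ℝ) → ℝ) =ᶠ[𝓝 z] fun _ => 0 := by
        filter_upwards [hS'.mem_nhds ⟨hz, hzS⟩] with y hy
        simp [hy.2]
      exact ⟨e.differentiableAt_iff.2 (differentiableAt_const _), by simp [e.fderiv_eq]⟩
  have hball : Metric.ball x₀ (r / A) ∈ 𝓝 x₀ := Metric.ball_mem_nhds _ (by positivity)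
  obtain ⟨z, hzb, hz⟩ := mem_closure_iff_nhds.1 hx₀ _ hball
  have hev : ∀ᶠ x in 𝓝[ω] x₀, S.indicator (1 : (Fin m → ℝ) → ℝ) x = S.indicator 1 z := by
    filter_upwards [self_mem_nhdsWithin, mem_nhdsWithin_of_mem_nhds hball] with x hx hxb
    have := key x hx hxb z hz hzb
    rw [mul_zero, zero_mul] at this
    exact sub_eq_zero.1 (norm_le_zero_iff.1 this)
  by_cases hzS : z ∈ S
  · left
    filter_upwards [hev] with x hx
    by_contra hxS
    simp [hzS, hxS] at hx
  · right
    filter_upwards [hev] with x hx hxS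
    simp [hzS, hxS] at hx

end Collar

theorem exists_tendsto_fderiv (hω : IsOpen ω) {u : (Fin m → ℝ) → ℝ}
    (hu : ContDiffOn ℝ 2 u (closure ω)) {x₀ : Fin m → ℝ} (hx₀ : x₀ ∈ closure ω) :
    (∃ L, Tendsto (fderiv ℝ u) (𝓝[ω] x₀) (𝓝 L)) ∧
      ∃ L, Tendsto (fderiv ℝ (fderiv ℝ u)) (𝓝[ω] x₀) (𝓝 L) := by
  have step : ∀ (F : Type) [NormedAddCommGroup F] [NormedSpace ℝ F] (g : (Fin m → ℝ) → F)
      (n : ℕ∞) (_ : n ≠ ⊤), ContDiffWithinAt ℝ (n + 1) g (closure ω) x₀ →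
      ∃ g' : (Fin m → ℝ) → (Fin m → ℝ) →L[ℝ] F, ∃ O, IsOpen O ∧ x₀ ∈ O ∧
        (∀ x ∈ O ∩ ω, fderiv ℝ g x = g' x) ∧ ContDiffWithinAt ℝ n g' (closure ω) x₀ := by
    intro F _ _ g n hn hg
    obtain ⟨U, hU, -, -, g', hg', hc⟩ :=
      (contDiffWithinAt_succ_iff_hasFDerivWithinAt' (by exact_mod_cast hn)).1 hg
    rw [Set.insert_eq_of_mem hx₀] at hU
    obtain ⟨O, hO, hxO, hOU⟩ := mem_nhdsWithin.1 hU
    refine ⟨g', O, hO, hxO, fun x hx => ?_, hc⟩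
    exact ((hg' x (hOU ⟨hx.1, subset_closure hx.2⟩)).hasFDerivAt
      (mem_of_superset (hω.mem_nhds hx.2) subset_closure)).fderiv
  obtain ⟨g₁, O₁, hO₁, hxO₁, h₁, hg₁⟩ := step ℝ u 1 (by simp)
    (by simpa [one_add_one_eq_two] using hu x₀ hx₀)
  obtain ⟨g₂, O₂, hO₂, hxO₂, h₂, hg₂⟩ := step _ g₁ 0 (by simp) (by simpa using hg₁)
  constructor
  · refine ⟨g₁ x₀, (hg₁.continuousWithinAt.mono subset_closure).tendsto.congr' ?_⟩
    filter_upwards [self_mem_nhdsWithin, mem_nhdsWithin_of_mem_nhds (hO₁.mem_nhds hxO₁)]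
      with x hx hxO using (h₁ x ⟨hxO, hx⟩).symm
  · refine ⟨g₂ x₀, (hg₂.continuousWithinAt.mono subset_closure).tendsto.congr' ?_⟩
    filter_upwards [self_mem_nhdsWithin, mem_nhdsWithin_of_mem_nhds (hO₁.mem_nhds hxO₁),
      mem_nhdsWithin_of_mem_nhds (hO₂.mem_nhds hxO₂)] with x hx hxO hxO'
    rw [← h₂ x ⟨hxO', hx⟩]
    refine EventuallyEq.fderiv_eq ?_
    filter_upwards [(hO₁.inter hω).mem_nhds ⟨hxO, hx⟩] with y hy using (h₁ y hy).symm

theorem exists_norm_le_of_tendsto (hb : Bornology.IsBounded ω) {F : Type*}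
    [NormedAddCommGroup F] {g : (Fin m → ℝ) → F} (hg : ContinuousOn g ω)
    (hlim : ∀ x ∈ closure ω, ∃ L, Tendsto g (𝓝[ω] x) (𝓝 L)) :
    ∃ M, ∀ x ∈ ω, ‖g x‖ ≤ M := by
  obtain ⟨M, hM⟩ := hb.isCompact_closure.exists_bound_of_continuousOn
    (continuousOn_extendFrom subset_rfl hlim)
  refine ⟨M, fun x hx => ?_⟩
  rw [← extendFrom_extends hg x hx]
  exact hM x (subset_closure hx)

theorem abs_le_dist_of_fderiv_le {w : (Fin m → ℝ) → ℝ} (hω : IsOpen ω) (hc : Continuous w)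
    (h0 : ∀ x ∉ ω, w x = 0) {L : ℝ}
    (hd : ∀ x ∈ ω, DifferentiableAt ℝ w x ∧ ‖fderiv ℝ w x‖ ≤ L) {x y : Fin m → ℝ} (hL : 0 ≤ L)
    (hy : y ∉ ω) : |w x| ≤ L * dist x y := by
  have hcont : Continuous fun s : ℝ => x + s • (y - x) := by fun_prop
  obtain ⟨a, ha, hmin⟩ : ∃ a, IsLeast (Set.Icc (0:ℝ) 1 ∩ {s | x + s • (y - x) ∉ ω}) a := by
    refine (isCompact_Icc.inter_right ?_).exists_isLeast ⟨1, by simp, by simpa using hy⟩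
    exact (hω.isClosed_compl).preimage hcont
  have hin : ∀ s ∈ Set.Ico 0 a, x + s • (y - x) ∈ ω := by
    intro s hs
    by_contra hcon
    exact absurd (hmin ⟨⟨hs.1, hs.2.le.trans ha.1.2⟩, hcon⟩) (not_le.2 hs.2)
  have := norm_image_sub_le_of_norm_deriv_right_le_segment (f := fun s : ℝ => w (x + s • (y - x)))
    (f' := fun s => fderiv ℝ w (x + s • (y - x)) (y - x)) (a := 0) (b := a) (C := L * ‖y - x‖)
    (hc.comp hcont).continuousOn ?_ ?_ a ⟨ha.1.1, le_rfl⟩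
  · rw [h0 _ ha.2] at this
    simp only [zero_smul, add_zero, zero_sub, norm_neg, sub_zero, Real.norm_eq_abs] at this
    refine this.trans ?_
    rw [dist_comm, dist_eq_norm]
    exact mul_le_of_le_one_right (by positivity) ha.1.2
  · exact fun s hs => (hasDerivAt_comp_line (hd _ (hin s hs)).1).hasDerivWithinAt
  · exact fun s hs => ((fderiv ℝ w (x + s • (y - x))).le_opNorm _).trans
      (mul_le_mul_of_nonneg_right (hd _ (hin s hs)).2 (norm_nonneg _))

theorem lipschitzWith_of_fderiv_le {w : (Fin m → ℝ) → ℝ} (hω : IsOpen ω) (hc : Continuous w)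
    (h0 : ∀ x ∉ ω, w x = 0) {L : NNReal}
    (hd : ∀ x ∈ ω, DifferentiableAt ℝ w x ∧ ‖fderiv ℝ w x‖ ≤ L) : LipschitzWith L w := by
  refine LipschitzWith.of_dist_le_mul fun x y => ?_
  by_cases hseg : segment ℝ x y ⊆ ω
  · rw [dist_eq_norm, dist_eq_norm]
    exact norm_image_sub_le_of_segment (fun z hz => (hd z (hseg hz)).1)
      fun z hz => (hd z (hseg hz)).2
  · obtain ⟨z, hz, hzω⟩ := Set.not_subset.1 hseg
    have h1 := abs_le_dist_of_fderiv_le hω hc h0 hd L.2 (x := x) hzω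
    have h2 := abs_le_dist_of_fderiv_le hω hc h0 hd L.2 (x := y) hzω
    have h3 := dist_add_dist_of_mem_segment hz
    rw [Real.dist_eq]
    rw [← h3, mul_add, dist_comm z y]
    exact (abs_sub _ _).trans (add_le_add h1 h2)

end Closure

section Variational

variable {m : ℕ} {ω : Set (Fin m → ℝ)}

/-- Lipschitz functions vanishing outside `ω`. -/
def ZeroLip (ω : Set (Fin m → ℝ)) (v : (Fin m → ℝ) → ℝ) : Prop :=
  (∃ K, LipschitzWith K v) ∧ ∀ x ∉ ω, v x = 0

/-- The pointwise inner product of two gradients. -/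
noncomputable def gradDot (u v : (Fin m → ℝ) → ℝ) (x : Fin m → ℝ) : ℝ :=
  ∑ i, pd u i x * pd v i x

theorem gradDot_self_nonneg (u : (Fin m → ℝ) → ℝ) (x : Fin m → ℝ) : 0 ≤ gradDot u u x :=
  Finset.sum_nonneg fun _ _ => mul_self_nonneg _

theorem sum_pd_sq (u : (Fin m → ℝ) → ℝ) (x : Fin m → ℝ) :
    ∑ i, (pd u i x) ^ 2 = gradDot u u x :=
  Finset.sum_congr rfl fun _ _ => sq _

theorem measurable_pd (u : (Fin m → ℝ) → ℝ) (i : Fin m) : Measurable (pd u i) :=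
  measurable_fderiv_apply_const ℝ u _

theorem measurable_gradDot (u v : (Fin m → ℝ) → ℝ) : Measurable (gradDot u v) :=
  Finset.measurable_fun_sum _ fun i _ => (measurable_pd u i).mul (measurable_pd v i)

theorem abs_pd_le_of_lipschitz {u : (Fin m → ℝ) → ℝ} {K : NNReal} (hu : LipschitzWith K u)
    (i : Fin m) (x : Fin m → ℝ) : |pd u i x| ≤ K := by
  have h := (fderiv ℝ u x).le_opNorm (Pi.single i 1)
  rw [norm_single_one, mul_one] at h
  exact h.trans (norm_fderiv_le_of_lipschitz ℝ hu)

theorem abs_gradDot_le {u v : (Fin m → ℝ) → ℝ} {K L : NNReal} (hu : LipschitzWith K u)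
    (hv : LipschitzWith L v) (x : Fin m → ℝ) : |gradDot u v x| ≤ m * (K * L) := by
  refine (Finset.abs_sum_le_sum_abs _ _).trans ?_
  have : ∀ i ∈ Finset.univ, |pd u i x * pd v i x| ≤ (K : ℝ) * L := fun i _ => by
    rw [abs_mul]
    exact mul_le_mul (abs_pd_le_of_lipschitz hu i x) (abs_pd_le_of_lipschitz hv i x)
      (abs_nonneg _) K.2
  refine (Finset.sum_le_sum this).trans ?_
  simp

theorem integrableOn_of_abs_le {g : (Fin m → ℝ) → ℝ} (hb : Bornology.IsBounded ω)
    (hω : MeasurableSet ω) (hg : Measurable g) {M : ℝ} (hM : ∀ x ∈ ω, |g x| ≤ M) :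
    IntegrableOn g ω :=
  Measure.integrableOn_of_bounded hb.measure_lt_top.ne hg.aestronglyMeasurable
    ((ae_restrict_iff' hω).2 (ae_of_all _ hM))

theorem integrableOn_of_continuous {g : (Fin m → ℝ) → ℝ} (hb : Bornology.IsBounded ω)
    (hg : Continuous g) : IntegrableOn g ω :=
  (hg.continuousOn.integrableOn_compact hb.isCompact_closure).mono_set subset_closure

theorem hasDerivAt_primF {f : ℝ → ℝ} (hf : Continuous f) (t : ℝ) :
    HasDerivAt (primF f) (f t) t :=
  (hf.integral_hasStrictDerivAt 0 t).hasDerivAt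

theorem continuous_primF {f : ℝ → ℝ} (hf : Continuous f) : Continuous (primF f) :=
  continuous_iff_continuousAt.2 fun t => (hasDerivAt_primF hf t).continuousAt

theorem primF_zero (f : ℝ → ℝ) : primF f 0 = 0 := by simp [primF]

namespace ZeroLip

variable {u v : (Fin m → ℝ) → ℝ}

theorem continuous (hu : ZeroLip ω u) : Continuous u := hu.1.choose_spec.continuous

theorem ae_differentiableAt (hu : ZeroLip ω u) : ∀ᵐ x, DifferentiableAt ℝ u x :=
  hu.1.choose_spec.ae_differentiableAt

theorem add (hu : ZeroLip ω u) (hv : ZeroLip ω v) : ZeroLip ω fun x => u x + v x :=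
  ⟨⟨_, hu.1.choose_spec.add hv.1.choose_spec⟩, fun x hx => by simp [hu.2 x hx, hv.2 x hx]⟩

theorem sub (hu : ZeroLip ω u) (hv : ZeroLip ω v) : ZeroLip ω fun x => u x - v x :=
  ⟨⟨_, hu.1.choose_spec.sub hv.1.choose_spec⟩, fun x hx => by simp [hu.2 x hx, hv.2 x hx]⟩

theorem const_mul (hu : ZeroLip ω u) (c : ℝ) : ZeroLip ω fun x => c * u x := by
  obtain ⟨K, hK⟩ := hu.1
  refine ⟨⟨‖c‖₊ * K, LipschitzWith.of_dist_le_mul fun x y => ?_⟩, fun x hx => by simp [hu.2 x hx]⟩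
  have := hK.dist_le_mul x y
  rw [Real.dist_eq] at this ⊢
  rw [← mul_sub, abs_mul]
  push_cast
  rw [mul_assoc]
  exact mul_le_mul_of_nonneg_left this (abs_nonneg c)

theorem min (hu : ZeroLip ω u) (hv : ZeroLip ω v) : ZeroLip ω fun x => min (u x) (v x) :=
  ⟨⟨_, hu.1.choose_spec.min hv.1.choose_spec⟩, fun x hx => by simp [hu.2 x hx, hv.2 x hx]⟩

theorem max (hu : ZeroLip ω u) (hv : ZeroLip ω v) : ZeroLip ω fun x => max (u x) (v x) :=
  ⟨⟨_, hu.1.choose_spec.max hv.1.choose_spec⟩, fun x hx => by simp [hu.2 x hx, hv.2 x hx]⟩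

theorem exists_abs_le (hb : Bornology.IsBounded ω) (hu : ZeroLip ω u) :
    ∃ M ≥ (0:ℝ), ∀ x, |u x| ≤ M := by
  obtain ⟨M, hM⟩ := hb.isCompact_closure.exists_bound_of_continuousOn hu.continuous.continuousOn
  refine ⟨|M|, abs_nonneg _, fun x => ?_⟩
  by_cases hx : x ∈ ω
  · exact (hM x (subset_closure hx)).trans (le_abs_self M)
  · simp [hu.2 x hx]

theorem integrableOn_gradDot (hb : Bornology.IsBounded ω) (hω : IsOpen ω) (hu : ZeroLip ω u)
    (hv : ZeroLip ω v) : IntegrableOn (gradDot u v) ω :=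
  integrableOn_of_abs_le hb hω.measurableSet (measurable_gradDot u v) fun x _ =>
    abs_gradDot_le hu.1.choose_spec hv.1.choose_spec x

end ZeroLip

theorem action_eq {f : ℝ → ℝ} (hf : Continuous f) (hb : Bornology.IsBounded ω) (hω : IsOpen ω)
    {u : (Fin m → ℝ) → ℝ} (hu : ZeroLip ω u) :
    action f ω u = (1 / 2) * (∫ x in ω, gradDot u u x) - ∫ x in ω, primF f (u x) := by
  simp only [action, sum_pd_sq]
  have hF : IntegrableOn (fun x => primF f (u x)) ω :=
    integrableOn_of_continuous hb ((continuous_primF hf).comp hu.continuous)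
  rw [integral_sub ((hu.integrableOn_gradDot hb hω hu).const_mul _) hF, integral_const_mul]

theorem gradDot_add_smul {u η : (Fin m → ℝ) → ℝ} {x : Fin m → ℝ} (hu : DifferentiableAt ℝ u x)
    (hη : DifferentiableAt ℝ η x) (t : ℝ) :
    gradDot (fun y => u y + t * η y) (fun y => u y + t * η y) x =
      gradDot u u x + (2 * t * gradDot u η x + t ^ 2 * gradDot η η x) := by
  simp only [gradDot, pd_add hu (hη.const_mul t), pd_const_mul hη, Finset.mul_sum,
    ← Finset.sum_add_distrib]
  exact Finset.sum_congr rfl fun i _ => by ring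

theorem euler_lagrange {f : ℝ → ℝ} (hf : Continuous f) (hb : Bornology.IsBounded ω)
    (hω : IsOpen ω) (hpos : ∀ v, ZeroLip ω v → 0 ≤ action f ω v) {u η : (Fin m → ℝ) → ℝ}
    (hu : ZeroLip ω u) (hu0 : action f ω u = 0) (hη : ZeroLip ω η) :
    ∫ x in ω, gradDot u η x = ∫ x in ω, f (u x) * η x := by
  obtain ⟨M, hM0, hM⟩ := hu.exists_abs_le hb
  obtain ⟨M', hM'0, hM'⟩ := hη.exists_abs_le hb
  have hut : ∀ t : ℝ, ZeroLip ω fun x => u x + t * η x := fun t => hu.add (hη.const_mul t)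
  obtain ⟨B, hB⟩ := (isCompact_Icc (a := -(M + M')) (b := M + M')).exists_bound_of_continuousOn
    hf.continuousOn
  have hder := (hasDerivAt_integral_of_dominated_loc_of_deriv_le (μ := volume.restrict ω)
    (F := fun t x => primF f (u x + t * η x)) (F' := fun t x => f (u x + t * η x) * η x)
    (x₀ := (0:ℝ)) (bound := fun _ => B * M') (Metric.ball_mem_nhds 0 one_pos)
    (Eventually.of_forall fun t =>
      ((continuous_primF hf).comp (hut t).continuous).aestronglyMeasurable)
    (integrableOn_of_continuous hb ((continuous_primF hf).comp (hut 0).continuous))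
    ((hf.comp (hut 0).continuous).mul hη.continuous).aestronglyMeasurable
    (ae_of_all _ fun x t ht => by
      rw [norm_mul]
      rw [Metric.mem_ball, dist_zero_right, Real.norm_eq_abs] at ht
      have h1 : |t * η x| ≤ M' := by
        rw [abs_mul]
        exact (mul_le_of_le_one_left (abs_nonneg _) ht.le).trans (hM' x)
      have h2 := hB (u x + t * η x) (by
        have := abs_le.1 h1
        have := abs_le.1 (hM x)
        constructor <;> linarith)
      exact mul_le_mul h2 (hM' x) (norm_nonneg _) ((norm_nonneg _).trans h2))
    (integrableOn_of_continuous hb continuous_const)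
    (ae_of_all _ fun x t _ => by
      have h1 : HasDerivAt (fun t : ℝ => u x + t * η x) (η x) t := by
        simpa using ((hasDerivAt_id t).mul_const (η x)).const_add (u x)
      exact (hasDerivAt_primF hf _).comp t h1)).2
  have hexp : ∀ t : ℝ, action f ω (fun x => u x + t * η x) =
      (1 / 2) * ((∫ x in ω, gradDot u u x) + (2 * t * (∫ x in ω, gradDot u η x)
        + t ^ 2 * ∫ x in ω, gradDot η η x)) - ∫ x in ω, primF f (u x + t * η x) := by
    intro t
    rw [action_eq hf hb hω (hut t)]
    congr 2
    have iuu := hu.integrableOn_gradDot hb hω hu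
    have iuη := (hu.integrableOn_gradDot hb hω hη).const_mul (2 * t)
    have iηη := (hη.integrableOn_gradDot hb hω hη).const_mul (t ^ 2)
    have isum : Integrable (fun x => 2 * t * gradDot u η x + t ^ 2 * gradDot η η x)
      (volume.restrict ω) := iuη.add iηη
    rw [← integral_const_mul, ← integral_const_mul, ← integral_add iuη iηη,
      ← integral_add iuu isum]
    refine integral_congr_ae (ae_restrict_of_ae ?_)
    filter_upwards [hu.ae_differentiableAt, hη.ae_differentiableAt] with x h1 h2
      using gradDot_add_smul h1 h2 t
  set a := ∫ x in ω, gradDot u u x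
  set b := ∫ x in ω, gradDot u η x
  set d := ∫ x in ω, gradDot η η x
  have hmin : IsLocalMin (fun t : ℝ => action f ω (fun x => u x + t * η x)) 0 :=
    Eventually.of_forall fun t => by
      simp only [zero_mul, add_zero]
      exact hu0.le.trans (hpos _ (hut t))
  have hdA : HasDerivAt (fun t : ℝ => action f ω (fun x => u x + t * η x))
      (b - ∫ x in ω, f (u x + 0 * η x) * η x) 0 := by
    simp only [hexp]
    refine HasDerivAt.sub ?_ hder
    have h1 : HasDerivAt (fun t : ℝ => 2 * t * b + t ^ 2 * d) (2 * b) 0 := by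
      have h2 : HasDerivAt (fun t : ℝ => 2 * t * b) (2 * b) 0 := by
        simpa using ((hasDerivAt_id (0:ℝ)).const_mul 2).mul_const b
      have h3 : HasDerivAt (fun t : ℝ => t ^ 2 * d) 0 0 := by
        simpa using (hasDerivAt_pow 2 (0:ℝ)).mul_const d
      simpa using h2.fun_add h3
    have h2 := (h1.const_add a).const_mul (1 / 2 : ℝ)
    rwa [show (1 / 2 : ℝ) * (2 * b) = b by ring] at h2
  have := hmin.hasDerivAt_eq_zero hdA
  simp only [zero_mul, add_zero] at this
  linarith

end Variational

section MaximumPrinciple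

variable {m : ℕ} {ω : Set (Fin m → ℝ)}

theorem pd_eq_zero_of_isMin {u : (Fin m → ℝ) → ℝ} {x : Fin m → ℝ} (h : ∀ y, u x ≤ u y)
    (i : Fin m) : pd u i x = 0 := by
  have : IsLocalMin u x := Eventually.of_forall h
  simp [pd, this.fderiv_eq_zero]

theorem pd_max_zero {w : (Fin m → ℝ) → ℝ} {x : Fin m → ℝ} (hw : ContinuousAt w x) (i : Fin m) :
    pd (fun y => max (w y) 0) i x = if 0 < w x then pd w i x else 0 := by
  split_ifs with h
  · refine pd_congr ?_ i
    filter_upwards [hw.eventually (lt_mem_nhds h)] with y hy using max_eq_left hy.le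
  · exact pd_eq_zero_of_isMin (fun y => by rw [max_eq_right (not_lt.1 h)]; exact le_max_right _ _) i

theorem setIntegral_gradDot_smooth (hb : Bornology.IsBounded ω) (hω : IsOpen ω)
    {Q η : (Fin m → ℝ) → ℝ} (hQ : ContDiff ℝ (⊤ : ℕ∞) Q) (hQc : HasCompactSupport Q)
    (hη : ZeroLip ω η) (hη0 : ∀ x ∉ ω, ∀ i, pd η i x = 0) :
    ∫ x in ω, gradDot Q η x = - ∫ x in ω, lap Q x * η x := by
  have hpdc : ∀ i, HasCompactSupport (pd Q i) := fun i =>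
    (hQc.fderiv ℝ).comp_left (g := fun T : (Fin m → ℝ) →L[ℝ] ℝ => T (Pi.single i 1)) rfl
  have hlip : ∀ i, ∃ K, LipschitzWith K (pd Q i) := fun i =>
    ⟨_, ((hQ.pd_smooth i).lipschitzWith_of_hasCompactSupport (hpdc i) (by simp)).choose_spec⟩
  have hint : ∀ i, IntegrableOn (fun x => pd Q i x * pd η i x) ω := fun i => by
    obtain ⟨B, hB⟩ := hb.isCompact_closure.exists_bound_of_continuousOn
      (hQ.pd_smooth i).continuous.continuousOn
    refine integrableOn_of_abs_le hb hω.measurableSet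
      ((measurable_pd _ i).mul (measurable_pd _ i)) (M := B * hη.1.choose) fun x hx => ?_
    rw [abs_mul]
    have := hB x (subset_closure hx)
    exact mul_le_mul this (abs_pd_le_of_lipschitz hη.1.choose_spec i x) (abs_nonneg _)
      ((norm_nonneg _).trans this)
  have hint2 : ∀ i, IntegrableOn (fun x => pd (pd Q i) i x * η x) ω := fun i =>
    integrableOn_of_continuous hb (((hQ.pd_smooth i).pd_smooth i).continuous.mul hη.continuous)
  have hi : ∀ i, ∫ x in ω, pd Q i x * pd η i x = - ∫ x in ω, pd (pd Q i) i x * η x := by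
    intro i
    rw [setIntegral_eq_integral_of_forall_compl_eq_zero (fun x hx => by rw [hη0 x hx, mul_zero]),
      setIntegral_eq_integral_of_forall_compl_eq_zero (fun x hx => by rw [hη.2 x hx, mul_zero]),
      ← integral_neg]
    have h1 := (hη.1.choose_spec).integral_lineDeriv_mul_eq (μ := volume) (hlip i).choose_spec
      (hpdc i) (Pi.single i 1)
    refine Eq.trans (integral_congr_ae ?_) (h1.trans (integral_congr_ae (ae_of_all _ fun x => ?_)))
    · filter_upwards [hη.ae_differentiableAt] with x hx
      rw [hx.lineDeriv_eq_fderiv, mul_comm]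
      rfl
    · simp only
      rw [((hQ.pd_smooth i).contDiffAt.differentiableAt (by simp)).lineDeriv_eq_fderiv, map_neg,
        neg_mul]
      rfl
  simp only [gradDot, lap_eq_sum_pd, Finset.sum_mul]
  rw [integral_finsetSum _ fun i _ => hint i, integral_finsetSum _ fun i _ => hint2 i,
    ← Finset.sum_neg_distrib]
  exact Finset.sum_congr rfl fun i _ => hi i

theorem pd_distSq (z x : Fin m → ℝ) (i : Fin m) : pd (distSq z) i x = 2 * (x i - z i) := by
  have h := hasDerivAt_along (u := distSq z) (x := x) (i := i) (t := 0)
    ((contDiff_distSq z (n := 1)).contDiffAt.differentiableAt (by simp))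
  have h2 : HasDerivAt (fun s : ℝ => distSq z (x + s • Pi.single i 1)) (2 * (x i - z i)) 0 := by
    have h3 : ∀ j ∈ Finset.univ, HasDerivAt (fun s : ℝ =>
        ((x + s • (Pi.single i 1 : Fin m → ℝ)) j - z j) ^ 2)
        (2 * (x j - z j) * (Pi.single i 1 : Fin m → ℝ) j) 0 := fun j _ => by
      have := ((((hasDerivAt_id (0:ℝ)).mul_const ((Pi.single i 1 : Fin m → ℝ) j)).const_add
        (x j)).sub_const (z j)).fun_pow 2
      simpa using this
    have h4 := HasDerivAt.fun_sum h3
    have h5 : ∑ j, 2 * (x j - z j) * (Pi.single i 1 : Fin m → ℝ) j = 2 * (x i - z i) := by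
      simp [Pi.single_apply]
    rw [h5] at h4
    exact h4
  simpa using h.unique h2

theorem lap_exp_distSq (α : ℝ) (z x : Fin m → ℝ) :
    lap (fun y => Real.exp (-α * distSq z y)) x =
      (4 * α ^ 2 * distSq z x - 2 * α * m) * Real.exp (-α * distSq z x) := by
  set E : (Fin m → ℝ) → ℝ := fun y => Real.exp (-α * distSq z y) with hE
  have hq : ContDiff ℝ 2 (distSq z) := contDiff_distSq z
  have hEs : ContDiff ℝ 2 E := Real.contDiff_exp.comp (contDiff_const.mul hq)
  have h1 : ∀ i, pd E i = fun y => -α * (E y * pd (distSq z) i y) := by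
    intro i
    ext y
    have hd : HasDerivAt (fun s : ℝ => Real.exp (-α * s)) (Real.exp (-α * distSq z y) * -α)
        (distSq z y) := by
      have := ((hasDerivAt_id (distSq z y)).const_mul (-α)).exp
      simpa using this
    have := pd_comp (f := fun s : ℝ => Real.exp (-α * s)) (u := distSq z) (x := y)
      hd.differentiableAt (hq.contDiffAt.differentiableAt (by simp)) i
    rw [hd.deriv] at this
    rw [hE]
    simp only at this ⊢
    rw [this]
    ring
  have h2 : ∀ i, pd (pd E i) i x =
      -α * (-α * (E x * pd (distSq z) i x ^ 2) + E x * pd (pd (distSq z) i) i x) := by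
    intro i
    have dE : DifferentiableAt ℝ E x := hEs.contDiffAt.differentiableAt (by simp)
    have dq := hq.contDiffAt.differentiableAt_pd (x := x) i
    conv_lhs => rw [h1 i]
    rw [pd_const_mul (u := fun y => E y * pd (distSq z) i y) (dE.mul dq), pd_mul dE dq,
      congrFun (h1 i) x]
    ring
  rw [lap_eq_sum_pd]
  simp only [h2]
  have h3 : ∑ i, pd (distSq z) i x ^ 2 = 4 * distSq z x := by
    simp only [pd_distSq, distSq, Finset.mul_sum]
    exact Finset.sum_congr rfl fun i _ => by ring
  have h4 := lap_distSq z x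
  rw [lap_eq_sum_pd] at h4
  rw [← Finset.mul_sum, Finset.sum_add_distrib, ← Finset.mul_sum, ← Finset.mul_sum,
    ← Finset.mul_sum, h3, h4]
  simp only [hE]
  ring

theorem mem_closedBall_of_distSq_le {z x : Fin m → ℝ} {b : ℝ} (hb : 0 ≤ b)
    (h : distSq z x ≤ b ^ 2) : x ∈ Metric.closedBall z b := by
  rw [Metric.mem_closedBall, dist_pi_le_iff hb]
  intro i
  rw [Real.dist_eq]
  refine abs_le_of_sq_le_sq ?_ hb
  exact (Finset.single_le_sum (f := fun j => (x j - z j) ^ 2) (fun j _ => sq_nonneg _)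
    (Finset.mem_univ i)).trans h

theorem eq_zero_of_setIntegral_nonpos (hω : IsOpen ω) {k : (Fin m → ℝ) → ℝ}
    (hb : Bornology.IsBounded ω) (hk : Continuous k) (hk0 : ∀ x, 0 ≤ k x)
    (h : ∫ x in ω, k x ≤ 0) : ∀ x ∈ ω, k x = 0 := by
  have h0 : ∫ x in ω, k x = 0 := le_antisymm h (integral_nonneg hk0)
  have h1 := (integral_eq_zero_iff_of_nonneg hk0 (integrableOn_of_continuous hb hk)).1 h0
  exact Measure.eqOn_open_of_ae_eq h1 hω hk.continuousOn continuousOn_const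

/-- Positivity of weak supersolutions propagates from a ball to larger balls. -/
theorem pos_of_pos_on_ball (hb : Bornology.IsBounded ω) (hω : IsOpen ω)
    {V h : (Fin m → ℝ) → ℝ} {C : ℝ} (hV : ZeroLip ω V) (hV0 : ∀ x, 0 ≤ V x) (hh : Continuous h)
    (hC : 0 ≤ C) (hhC : ∀ x ∈ ω, -(C * V x) ≤ h x)
    (hweak : ∀ η, ZeroLip ω η → ∫ x in ω, gradDot V η x = ∫ x in ω, h x * η x)
    {z : Fin m → ℝ} {a b : ℝ} (ha : 0 < a) (hab : a < b) (hsub : ∀ x, distSq z x ≤ b ^ 2 → x ∈ ω)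
    (hpos : ∀ x, distSq z x ≤ a ^ 2 → 0 < V x) : ∀ x, distSq z x < b ^ 2 → 0 < V x := by
  have hb0 : 0 < b := ha.trans hab
  obtain ⟨α, hα1, hα⟩ : ∃ α : ℝ, 1 ≤ α ∧ 2 * m + C + 1 ≤ 4 * α * a ^ 2 := by
    refine ⟨max 1 ((2 * m + C + 1) / (4 * a ^ 2)), le_max_left _ _, ?_⟩
    have := le_max_right 1 ((2 * m + C + 1) / (4 * a ^ 2))
    rw [div_le_iff₀ (by positivity)] at this
    linarith
  have hα0 : 0 < α := by linarith
  set E : (Fin m → ℝ) → ℝ := fun y => Real.exp (-α * distSq z y) with hE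
  have hEs : ContDiff ℝ (⊤ : ℕ∞) E :=
    Real.contDiff_exp.comp (contDiff_const.mul (contDiff_distSq z))
  have hE0 : ∀ x, 0 < E x := fun x => Real.exp_pos _
  set e₀ := Real.exp (-α * b ^ 2) with he₀
  have he₀0 : 0 < e₀ := Real.exp_pos _
  let χ : ContDiffBump z := ⟨b, b + 1, hb0, by linarith⟩
  set Q : (Fin m → ℝ) → ℝ := fun x => χ x * (E x - e₀) with hQ
  have hQs : ContDiff ℝ (⊤ : ℕ∞) Q := χ.contDiff.mul (hEs.sub contDiff_const)
  have hQc : HasCompactSupport Q := χ.hasCompactSupport.mul_right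
  have hqc : Continuous (distSq z) := (contDiff_distSq z (n := 0)).continuous
  have hQP : ∀ x, distSq z x ≤ b ^ 2 → Q x = E x - e₀ := fun x hx => by
    rw [hQ]
    simp only
    rw [χ.one_of_mem_closedBall (mem_closedBall_of_distSq_le hb0.le hx), one_mul]
  have hQneg : ∀ x, b ^ 2 ≤ distSq z x → Q x ≤ 0 := fun x hx => by
    refine mul_nonpos_of_nonneg_of_nonpos χ.nonneg (sub_nonpos.2 (Real.exp_le_exp.2 ?_))
    nlinarith
  obtain ⟨δ, hδ, hδV⟩ : ∃ δ > 0, ∀ x, distSq z x ≤ a ^ 2 → δ ≤ V x := by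
    have hcomp : IsCompact {x | distSq z x ≤ a ^ 2} :=
      Metric.isCompact_of_isClosed_isBounded (isClosed_le hqc continuous_const)
        (Metric.isBounded_closedBall.subset fun x hx => mem_closedBall_of_distSq_le ha.le hx)
    obtain ⟨x₁, hx₁, hmin⟩ := hcomp.exists_isMinOn ⟨z, by simp [distSq]; positivity⟩
      hV.continuous.continuousOn
    exact ⟨V x₁, hpos x₁ hx₁, fun x hx => hmin hx⟩
  set w : (Fin m → ℝ) → ℝ := fun x => δ * Q x - V x with hw
  set η : (Fin m → ℝ) → ℝ := fun x => max (w x) 0 with hη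
  have hη0 : ∀ x, 0 ≤ η x := fun x => le_max_right _ _
  have hwpos : ∀ x, 0 < w x → a ^ 2 < distSq z x ∧ distSq z x < b ^ 2 := by
    intro x hx
    have h1 : distSq z x < b ^ 2 := by
      by_contra! hcon
      have := hQneg x hcon
      have := hV0 x
      simp only [hw] at hx
      nlinarith
    refine ⟨?_, h1⟩
    by_contra! hcon
    have h2 := hδV x hcon
    have h3 := hQP x h1.le
    have h4 : E x ≤ 1 := Real.exp_le_one_iff.2 (by nlinarith [distSq_nonneg z x])
    simp only [hw] at hx
    nlinarith
  have hηL : ZeroLip ω η := by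
    obtain ⟨K, hK⟩ := hQs.lipschitzWith_of_hasCompactSupport hQc (by simp)
    obtain ⟨K', hK'⟩ := hV.1
    refine ⟨⟨_, (((LipschitzWith.of_dist_le_mul fun x y => ?_ :
      LipschitzWith (‖δ‖₊ * K) fun x => δ * Q x)).sub hK').max_const 0⟩, fun x hx => ?_⟩
    · have := hK.dist_le_mul x y
      rw [Real.dist_eq] at this ⊢
      rw [← mul_sub, abs_mul]
      push_cast
      rw [mul_assoc]
      exact mul_le_mul_of_nonneg_left this (abs_nonneg δ)
    · refine max_eq_right (not_lt.1 fun hcon => hx (hsub x (hwpos x hcon).2.le))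
  have hwc : Continuous w := (continuous_const.mul hQs.continuous).sub hV.continuous
  have hpdη : ∀ x i, pd η i x = if 0 < w x then pd w i x else 0 := fun x i =>
    pd_max_zero hwc.continuousAt i
  have hpdη0 : ∀ x ∉ ω, ∀ i, pd η i x = 0 := fun x hx i => by
    rw [hpdη, if_neg]
    exact fun hcon => hx (hsub x (hwpos x hcon).2.le)
  have hgrad : ∀ᵐ x, gradDot η η x = δ * gradDot Q η x - gradDot V η x := by
    filter_upwards [hV.ae_differentiableAt] with x hx
    simp only [gradDot, Finset.mul_sum, ← Finset.sum_sub_distrib]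
    refine Finset.sum_congr rfl fun i _ => ?_
    by_cases hwx : 0 < w x
    · have dQ : DifferentiableAt ℝ Q x := hQs.contDiffAt.differentiableAt (by simp)
      have : pd η i x = δ * pd Q i x - pd V i x := by
        rw [hpdη, if_pos hwx, hw, pd_sub (u := fun y => δ * Q y) (dQ.const_mul δ) hx,
          pd_const_mul dQ]
      rw [this]
      ring
    · have : pd η i x = 0 := by rw [hpdη, if_neg hwx]
      rw [this]
      ring
  have iQη : IntegrableOn (gradDot Q η) ω := by
    obtain ⟨K, hK⟩ := hQs.lipschitzWith_of_hasCompactSupport hQc (by simp)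
    exact integrableOn_of_abs_le hb hω.measurableSet (measurable_gradDot _ _) fun x _ =>
      abs_gradDot_le hK hηL.1.choose_spec x
  have hI : ∫ x in ω, gradDot η η x =
      δ * (- ∫ x in ω, lap Q x * η x) - ∫ x in ω, h x * η x := by
    rw [← setIntegral_gradDot_smooth hb hω hQs hQc hηL hpdη0, ← hweak η hηL, ← integral_const_mul,
      ← integral_sub (iQη.const_mul δ) (hV.integrableOn_gradDot hb hω hηL)]
    exact integral_congr_ae (ae_restrict_of_ae hgrad)
  have hlapη : Continuous fun x => lap Q x * η x := hQs.continuous_lap.mul hηL.continuous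
  have hhη : Continuous fun x => h x * η x := hh.mul hηL.continuous
  have hkc : Continuous fun x => δ * E x * η x :=
    (continuous_const.mul hEs.continuous).mul hηL.continuous
  have hpt : ∀ x ∈ ω, δ * E x * η x ≤ δ * (lap Q x * η x) + h x * η x := by
    intro x hx
    by_cases hwx : 0 < w x
    · obtain ⟨ha', hb'⟩ := hwpos x hwx
      have hlap : lap Q x = (4 * α ^ 2 * distSq z x - 2 * α * m) * E x := by
        have hev : Q =ᶠ[𝓝 x] fun y => E y - e₀ := by
          filter_upwards [hqc.continuousAt.eventually (gt_mem_nhds hb')] with y hy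
            using hQP y (le_of_lt hy)
        have hE2 : ContDiffAt ℝ 2 E x := hEs.contDiffAt.of_le (WithTop.coe_le_coe.2 le_top)
        rw [lap_congr hev, lap_sub hE2 contDiffAt_const, lap_exp_distSq, lap_const, sub_zero]
      have h1 : C + 1 ≤ 4 * α ^ 2 * distSq z x - 2 * α * m := by
        have : 4 * α ^ 2 * a ^ 2 ≤ 4 * α ^ 2 * distSq z x :=
          mul_le_mul_of_nonneg_left ha'.le (by positivity)
        nlinarith
      have h2 : (C + 1) * E x ≤ lap Q x := by
        rw [hlap]
        exact mul_le_mul_of_nonneg_right h1 (hE0 x).le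
      have h3 : V x ≤ δ * E x := by
        have h4 := hQP x hb'.le
        simp only [hw] at hwx
        nlinarith
      have h5 : C * V x ≤ C * (δ * E x) := mul_le_mul_of_nonneg_left h3 hC
      have h6 := hhC x hx
      have h7 : δ * ((C + 1) * E x) ≤ δ * lap Q x := mul_le_mul_of_nonneg_left h2 hδ.le
      have h8 : δ * E x ≤ δ * lap Q x + h x := by nlinarith
      calc δ * E x * η x ≤ (δ * lap Q x + h x) * η x :=
            mul_le_mul_of_nonneg_right h8 (hη0 x)
        _ = _ := by ring
    · have : η x = 0 := max_eq_right (not_lt.1 hwx)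
      simp [this]
  have hk : ∫ x in ω, δ * E x * η x ≤ 0 := by
    have h1 := setIntegral_mono_on (integrableOn_of_continuous hb hkc)
      (((integrableOn_of_continuous hb hlapη).const_mul δ).add (integrableOn_of_continuous hb hhη))
      hω.measurableSet hpt
    have h2 : ∫ x in ω, (δ * (lap Q x * η x) + h x * η x) =
        δ * (∫ x in ω, lap Q x * η x) + ∫ x in ω, h x * η x := by
      rw [integral_add ((integrableOn_of_continuous hb hlapη).const_mul δ)
        (integrableOn_of_continuous hb hhη), integral_const_mul]
    have h3 : 0 ≤ ∫ x in ω, gradDot η η x := integral_nonneg fun x => gradDot_self_nonneg η x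
    have h4 := h1.trans_eq h2
    linarith
  intro x hx
  have hzero := eq_zero_of_setIntegral_nonpos hω hb hkc
    (fun x => mul_nonneg (mul_nonneg hδ.le (hE0 x).le) (hη0 x)) hk x (hsub x hx.le)
  have hη00 : η x = 0 := by
    rcases mul_eq_zero.1 hzero with h1 | h1
    · exact absurd h1 (mul_pos hδ (hE0 x)).ne'
    · exact h1
  have h1 : δ * Q x - V x ≤ 0 := by rw [← hη00]; exact le_max_left _ _
  have h2 : 0 < Q x := by
    rw [hQP x hx.le]
    refine sub_pos.2 (Real.exp_lt_exp.2 ?_)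
    nlinarith
  nlinarith [mul_pos hδ h2]

end MaximumPrinciple

section Lattice

variable {m : ℕ} {ω : Set (Fin m → ℝ)}

theorem distSq_comm (x y : Fin m → ℝ) : distSq x y = distSq y x :=
  Finset.sum_congr rfl fun _ _ => by ring

theorem isOpen_zero_set (hb : Bornology.IsBounded ω) (hω : IsOpen ω)
    {V h : (Fin m → ℝ) → ℝ} {C : ℝ} (hV : ZeroLip ω V) (hV0 : ∀ x, 0 ≤ V x) (hh : Continuous h)
    (hC : 0 ≤ C) (hhC : ∀ x ∈ ω, -(C * V x) ≤ h x)
    (hweak : ∀ η, ZeroLip ω η → ∫ x in ω, gradDot V η x = ∫ x in ω, h x * η x) :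
    IsOpen (ω ∩ {x | V x = 0}) := by
  rw [isOpen_iff_mem_nhds]
  rintro x₀ ⟨hx₀, hVx₀⟩
  obtain ⟨r, hr, hball⟩ := Metric.isOpen_iff.1 hω x₀ hx₀
  set b := r / 3 with hbr
  have hb0 : 0 < b := by positivity
  have hqc : Continuous (distSq x₀) := (contDiff_distSq x₀ (n := 0)).continuous
  have hev : ∀ᶠ z in 𝓝 x₀, distSq x₀ z < b ^ 2 :=
    hqc.continuousAt.eventually (gt_mem_nhds (by simp [distSq]; positivity))
  filter_upwards [hev, hω.mem_nhds hx₀] with z hz hzω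
  refine ⟨hzω, ?_⟩
  by_contra hVz
  have hVz' : 0 < V z := lt_of_le_of_ne (hV0 z) (Ne.symm hVz)
  obtain ⟨s, hs, hspos⟩ := Metric.eventually_nhds_iff_ball.1
    (hV.continuous.continuousAt.eventually (lt_mem_nhds hVz'))
  have hzx : dist z x₀ ≤ b := mem_closedBall_of_distSq_le hb0.le hz.le
  have := pos_of_pos_on_ball hb hω hV hV0 hh hC hhC hweak (z := z) (a := min s b / 2) (b := b)
    (by positivity) (by linarith [min_le_right s b]) (fun x hx => hball ?_)
    (fun x hx => hspos x ?_) x₀ (by rwa [distSq_comm])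
  · exact this.ne' hVx₀
  · have h1 : dist x z ≤ b := mem_closedBall_of_distSq_le hb0.le hx
    rw [Metric.mem_ball]
    linarith [dist_triangle x z x₀]
  · have h1 : dist x z ≤ min s b / 2 := mem_closedBall_of_distSq_le (by positivity) hx
    rw [Metric.mem_ball]
    linarith [min_le_left s b]

theorem exists_lipschitz_bound {f : ℝ → ℝ} (hf : ContDiff ℝ 1 f) (M : ℝ) :
    ∃ C ≥ (0:ℝ), ∀ s t, |s| ≤ M → |t| ≤ M → |f s - f t| ≤ C * |s - t| := by
  obtain ⟨C, hC⟩ := (isCompact_Icc (a := -M) (b := M)).exists_bound_of_continuousOn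
    (hf.continuous_deriv (by simp)).continuousOn
  refine ⟨|C|, abs_nonneg _, fun s t hs ht => ?_⟩
  exact (convex_Icc (-M) M).norm_image_sub_le_of_norm_deriv_le
    (fun x _ => hf.contDiffAt.differentiableAt (by simp))
    (fun x hx => (hC x hx).trans (le_abs_self C)) (abs_le.1 ht) (abs_le.1 hs)

theorem gradDot_sub {u v η : (Fin m → ℝ) → ℝ} {x : Fin m → ℝ} (hu : DifferentiableAt ℝ u x)
    (hv : DifferentiableAt ℝ v x) :
    gradDot (fun y => u y - v y) η x = gradDot u η x - gradDot v η x := by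
  simp only [gradDot, pd_sub hu hv, sub_mul, Finset.sum_sub_distrib]

theorem action_min_add_action_max {f : ℝ → ℝ} (hf : Continuous f) (hb : Bornology.IsBounded ω)
    (hω : IsOpen ω) {u v : (Fin m → ℝ) → ℝ} (hu : ZeroLip ω u) (hv : ZeroLip ω v) :
    action f ω (fun x => min (u x) (v x)) + action f ω (fun x => max (u x) (v x)) =
      action f ω u + action f ω v := by
  have hmin := hu.min hv
  have hmax := hu.max hv
  have iF : ∀ {w : (Fin m → ℝ) → ℝ}, ZeroLip ω w → IntegrableOn (fun x => primF f (w x)) ω :=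
    fun hw => integrableOn_of_continuous hb ((continuous_primF hf).comp hw.continuous)
  have iG : ∀ {w : (Fin m → ℝ) → ℝ}, ZeroLip ω w → IntegrableOn (gradDot w w) ω :=
    fun hw => hw.integrableOn_gradDot hb hω hw
  have h1 : (∫ x in ω, primF f (min (u x) (v x))) + ∫ x in ω, primF f (max (u x) (v x)) =
      (∫ x in ω, primF f (u x)) + ∫ x in ω, primF f (v x) := by
    rw [← integral_add (iF hmin) (iF hmax), ← integral_add (iF hu) (iF hv)]
    refine integral_congr_ae (ae_of_all _ fun x => ?_)
    rcases le_total (u x) (v x) with h | h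
    · simp [h]
    · simp [h, add_comm]
  have h2 : (∫ x in ω, gradDot (fun x => min (u x) (v x)) (fun x => min (u x) (v x)) x) +
      ∫ x in ω, gradDot (fun x => max (u x) (v x)) (fun x => max (u x) (v x)) x =
      (∫ x in ω, gradDot u u x) + ∫ x in ω, gradDot v v x := by
    rw [← integral_add (iG hmin) (iG hmax), ← integral_add (iG hu) (iG hv)]
    refine integral_congr_ae (ae_restrict_of_ae ?_)
    set e : (Fin m → ℝ) → ℝ := fun x => max (u x - v x) 0 with he
    have hmine : (fun x => min (u x) (v x)) = fun x => u x - e x := by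
      ext x
      rcases le_total (u x) (v x) with h | h
      · simp [he, h]
      · simp [he, h]
    have hmaxe : (fun x => max (u x) (v x)) = fun x => v x + e x := by
      ext x
      rcases le_total (u x) (v x) with h | h
      · simp [he, h]
      · simp [he, h]
    have hed : ∀ᵐ x, DifferentiableAt ℝ e x :=
      ((hu.1.choose_spec.sub hv.1.choose_spec).max_const 0).ae_differentiableAt
    filter_upwards [hu.ae_differentiableAt, hv.ae_differentiableAt, hed] with x du dv de
    rw [hmine, hmaxe]
    simp only [gradDot, ← Finset.sum_add_distrib]
    refine Finset.sum_congr rfl fun i _ => ?_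
    rw [pd_sub du de, pd_add dv de, he, pd_max_zero (w := fun y => u y - v y) (du.fun_sub dv).continuousAt]
    split_ifs
    · rw [pd_sub du dv]
      ring
    · ring
  rw [action_eq hf hb hω hmin, action_eq hf hb hω hmax, action_eq hf hb hω hu,
    action_eq hf hb hω hv]
  linarith

/-- Positive classical solutions with zero action, extended by zero. -/
structure Sol (f : ℝ → ℝ) (ω : Set (Fin m → ℝ)) (u : (Fin m → ℝ) → ℝ) : Prop where
  zeroLip : ZeroLip ω u
  pos : ∀ x ∈ ω, 0 < u x
  smooth : ContDiffOn ℝ 2 u (closure ω)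
  eqn : ∀ x ∈ ω, -lap u x = f (u x)
  action_eq_zero : action f ω u = 0

theorem eventually_nhdsWithin_closure {u v : (Fin m → ℝ) → ℝ} (hu : Continuous u)
    (hv : Continuous v) {x₀ : Fin m → ℝ} (h : ∀ᶠ x in 𝓝[ω] x₀, u x ≤ v x) :
    ∀ᶠ x in 𝓝[closure ω] x₀, u x ≤ v x := by
  obtain ⟨O, hO, hxO, hOs⟩ := mem_nhdsWithin.1 h
  refine mem_nhdsWithin.2 ⟨O, hO, hxO, ?_⟩
  exact hO.inter_closure.trans (closure_minimal hOs (isClosed_le hu hv))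

variable {ρ : (Fin m → ℝ) → ℝ} {c C Λ R : ℝ}

/-- The difference of a zero-action function and a smaller zero-action function has a relatively open
zero set. -/
theorem isOpen_eq_set {f : ℝ → ℝ} (hf : ContDiff ℝ 1 f) (hb : Bornology.IsBounded ω)
    (hω : IsOpen ω) (hpos : ∀ v, ZeroLip ω v → 0 ≤ action f ω v) {v w : (Fin m → ℝ) → ℝ}
    (hv : ZeroLip ω v) (hw : ZeroLip ω w) (hwv : ∀ x, w x ≤ v x) (hv0 : action f ω v = 0)
    (hw0 : action f ω w = 0) : IsOpen (ω ∩ {x | v x = w x}) := by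
  obtain ⟨M, -, hM⟩ := hv.exists_abs_le hb
  obtain ⟨M', -, hM'⟩ := hw.exists_abs_le hb
  obtain ⟨C, hC0, hC⟩ := exists_lipschitz_bound hf (max M M')
  have key := isOpen_zero_set hb hω (V := fun x => v x - w x)
    (h := fun x => f (v x) - f (w x)) (C := C) (hv.sub hw) (fun x => sub_nonneg.2 (hwv x))
    ((hf.continuous.comp hv.continuous).sub (hf.continuous.comp hw.continuous)) hC0
    (fun x _ => by
      have h1 := hC (v x) (w x) ((hM x).trans (le_max_left _ _)) ((hM' x).trans (le_max_right _ _))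
      rw [abs_of_nonneg (sub_nonneg.2 (hwv x))] at h1
      linarith [(abs_le.1 h1).1])
    (fun η hη => by
      have h1 := euler_lagrange hf.continuous hb hω hpos hv hv0 hη
      have h2 := euler_lagrange hf.continuous hb hω hpos hw hw0 hη
      have i1 : IntegrableOn (fun x => f (v x) * η x) ω :=
        integrableOn_of_continuous hb ((hf.continuous.comp hv.continuous).mul hη.continuous)
      have i2 : IntegrableOn (fun x => f (w x) * η x) ω :=
        integrableOn_of_continuous hb ((hf.continuous.comp hw.continuous).mul hη.continuous)
      simp only [sub_mul]
      rw [integral_sub i1 i2, ← h1, ← h2, ← integral_sub (hv.integrableOn_gradDot hb hω hη)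
        (hw.integrableOn_gradDot hb hω hη)]
      refine integral_congr_ae (ae_restrict_of_ae ?_)
      filter_upwards [hv.ae_differentiableAt, hw.ae_differentiableAt] with x d1 d2
        using gradDot_sub d1 d2)
  simpa only [sub_eq_zero] using key

theorem Sol.inf {f : ℝ → ℝ} (hf : ContDiff ℝ 1 f) (hb : Bornology.IsBounded ω)
    (D : Collar ω ρ c C Λ R) (hpos : ∀ v, ZeroLip ω v → 0 ≤ action f ω v)
    {u v : (Fin m → ℝ) → ℝ} (hu : Sol f ω u) (hv : Sol f ω v) :
    Sol f ω fun x => min (u x) (v x) := by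
  have hω := D.isOpen
  have hmin := hu.zeroLip.min hv.zeroLip
  have hact : action f ω (fun x => min (u x) (v x)) = 0 := by
    have h1 := action_min_add_action_max hf.continuous hb hω hu.zeroLip hv.zeroLip
    have h2 := hpos _ hmin
    have h3 := hpos _ (hu.zeroLip.max hv.zeroLip)
    rw [hu.action_eq_zero, hv.action_eq_zero] at h1
    linarith
  have hcu := hu.zeroLip.continuous
  have hcv := hv.zeroLip.continuous
  have o1 : IsOpen (ω ∩ {x | u x ≤ v x}) := by
    have := isOpen_eq_set hf hb hω hpos hu.zeroLip hmin (fun x => min_le_left _ _)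
      hu.action_eq_zero hact
    simpa only [eq_comm (a := u _), min_eq_left_iff] using this
  have o2 : IsOpen (ω \ {x | u x ≤ v x}) := by
    have : ω \ {x | u x ≤ v x} = ω ∩ {x | v x < u x} := by
      ext x; simp
    rw [this]
    exact hω.inter (isOpen_lt hcv hcu)
  refine ⟨hmin, fun x hx => lt_min (hu.pos x hx) (hv.pos x hx), fun x hx => ?_, fun x hx => ?_,
    hact⟩
  · rcases D.eventually_mem_or_notMem o1 o2 hx with h | h
    · refine (hu.smooth x hx).congr_of_eventuallyEq ?_ ?_
      · filter_upwards [eventually_nhdsWithin_closure hcu hcv h] with y hy using min_eq_left hy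
      · exact min_eq_left ((eventually_nhdsWithin_closure hcu hcv h).self_of_nhdsWithin hx)
    · have h' : ∀ᶠ y in 𝓝[ω] x, v y ≤ u y := h.mono fun y hy => (not_le.1 hy).le
      refine (hv.smooth x hx).congr_of_eventuallyEq ?_ ?_
      · filter_upwards [eventually_nhdsWithin_closure hcv hcu h'] with y hy using min_eq_right hy
      · exact min_eq_right ((eventually_nhdsWithin_closure hcv hcu h').self_of_nhdsWithin hx)
  · by_cases hxS : u x ≤ v x
    · have : (fun y => Min.min (u y) (v y)) =ᶠ[𝓝 x] u := by
        filter_upwards [o1.mem_nhds ⟨hx, hxS⟩] with y hy using min_eq_left hy.2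
      rw [lap_congr this, hu.eqn x hx, min_eq_left hxS]
    · have : (fun y => Min.min (u y) (v y)) =ᶠ[𝓝 x] v := by
        filter_upwards [o2.mem_nhds ⟨hx, hxS⟩] with y hy using min_eq_right (not_le.1 hy.2).le
      rw [lap_congr this, hv.eqn x hx, min_eq_right (not_le.1 hxS).le]

theorem ZeroLip.indicator {u : (Fin m → ℝ) → ℝ} (hu : ZeroLip ω u) {S : Set (Fin m → ℝ)}
    (hS : IsOpen (ω ∩ S)) (hS' : IsOpen (ω \ S)) : ZeroLip ω (S.indicator u) := by
  obtain ⟨K, hK⟩ := hu.1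
  have key : ∀ x y, x ∈ S → y ∉ S → |u x| ≤ K * dist x y := by
    intro x y hx hy
    by_cases hseg : segment ℝ x y ⊆ ω
    · exfalso
      have hdis : Disjoint (ω ∩ S) (ω \ S) :=
        Set.disjoint_left.2 fun z hz hz' => hz'.2 hz.2
      have hsub : segment ℝ x y ⊆ (ω ∩ S) ∪ (ω \ S) := by rwa [Set.inter_union_sdiff]
      rcases (convex_segment x y).isPreconnected.subset_or_subset hS hS' hdis hsub with h | h
      · exact hy (h (right_mem_segment ℝ x y)).2
      · exact (h (left_mem_segment ℝ x y)).2 hx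
    · obtain ⟨z, hz, hzω⟩ := Set.not_subset.1 hseg
      have h1 := hK.dist_le_mul x z
      rw [hu.2 z hzω, Real.dist_eq, sub_zero] at h1
      refine h1.trans (mul_le_mul_of_nonneg_left ?_ K.2)
      linarith [dist_add_dist_of_mem_segment hz, dist_nonneg (x := z) (y := y)]
  refine ⟨⟨K, LipschitzWith.of_dist_le_mul fun x y => ?_⟩, fun x hx => ?_⟩
  · by_cases hx : x ∈ S <;> by_cases hy : y ∈ S
    · simpa [hx, hy] using hK.dist_le_mul x y
    · simpa [hx, hy] using key x y hx hy
    · simpa [hx, hy, dist_comm] using key y x hy hx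
    · simp only [hx, hy, not_false_eq_true, Set.indicator_of_notMem, dist_self]
      positivity
  · by_cases hxS : x ∈ S
    · simp [hxS, hu.2 x hx]
    · simp [hxS]

theorem pd_indicator {u : (Fin m → ℝ) → ℝ} {S : Set (Fin m → ℝ)}
    (hS : IsOpen (ω ∩ S)) (hS' : IsOpen (ω \ S)) {x : Fin m → ℝ} (hx : x ∈ ω) (i : Fin m) :
    pd (S.indicator u) i x = S.indicator (pd u i) x := by
  by_cases hxS : x ∈ S
  · rw [Set.indicator_of_mem hxS]
    refine pd_congr ?_ i
    filter_upwards [hS.mem_nhds ⟨hx, hxS⟩] with y hy using Set.indicator_of_mem hy.2 _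
  · rw [Set.indicator_of_notMem hxS]
    have : S.indicator u =ᶠ[𝓝 x] fun _ => 0 := by
      filter_upwards [hS'.mem_nhds ⟨hx, hxS⟩] with y hy using Set.indicator_of_notMem hy.2 _
    rw [pd_congr this i]
    simp [pd]

theorem action_indicator_add_compl {f : ℝ → ℝ} (hf : Continuous f) (hb : Bornology.IsBounded ω)
    (hω : IsOpen ω) {u : (Fin m → ℝ) → ℝ} (hu : ZeroLip ω u) {S : Set (Fin m → ℝ)}
    (hS : IsOpen (ω ∩ S)) (hS' : IsOpen (ω \ S)) :
    action f ω (S.indicator u) + action f ω (Sᶜ.indicator u) = action f ω u := by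
  have hS₁ : IsOpen (ω ∩ Sᶜ) := by rwa [← Set.sdiff_eq]
  have hS₂ : IsOpen (ω \ Sᶜ) := by rwa [Set.sdiff_compl]
  have int : ∀ {w : (Fin m → ℝ) → ℝ}, ZeroLip ω w →
      IntegrableOn (fun x => (1 / 2) * (∑ i, (pd w i x) ^ 2) - primF f (w x)) ω := fun hw => by
    simp only [sum_pd_sq]
    exact ((hw.integrableOn_gradDot hb hω hw).const_mul _).sub
      (integrableOn_of_continuous hb ((continuous_primF hf).comp hw.continuous))
  simp only [action]
  rw [← integral_add (int (hu.indicator hS hS')) (int (hu.indicator hS₁ hS₂))]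
  refine setIntegral_congr_fun hω.measurableSet fun x hx => ?_
  simp only [pd_indicator hS hS' hx, pd_indicator hS₁ hS₂ hx]
  by_cases hxS : x ∈ S <;> simp [hxS, primF_zero]

end Lattice

section Compactness

variable {m : ℕ} {ω : Set (Fin m → ℝ)}

theorem exists_uniform_limit {F : Type*} [NormedAddCommGroup F] [CompleteSpace F]
    {g : ℕ → (Fin m → ℝ) → F} (hg : UniformCauchySeqOn g atTop ω)
    (hlim : ∀ n, ∀ x ∈ closure ω, ∃ L, Tendsto (g n) (𝓝[ω] x) (𝓝 L)) :
    ∃ G, TendstoUniformlyOn g G atTop ω ∧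
      ∀ x ∈ closure ω, ∃ L, Tendsto G (𝓝[ω] x) (𝓝 L) := by
  have hu : TendstoUniformlyOn g (fun x => limUnder atTop fun n => g n x) atTop ω :=
    hg.tendstoUniformlyOn_of_tendsto fun x hx => (hg.cauchySeq hx).tendsto_limUnder
  refine ⟨_, hu, fun x hx => ?_⟩
  have hne : (𝓝[ω] x).NeBot := mem_closure_iff_nhdsWithin_neBot.1 hx
  refine cauchy_map_iff_exists_tendsto.1 (Metric.cauchy_iff.2 ⟨hne.map _, fun ε hε => ?_⟩)
  obtain ⟨n, hn⟩ := (Metric.tendstoUniformlyOn_iff.1 hu (ε / 4) (by positivity)).exists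
  obtain ⟨L, hL⟩ := hlim n x hx
  refine ⟨Metric.ball L (ε / 2), ?_, fun y hy z hz => ?_⟩
  · rw [mem_map]
    filter_upwards [Metric.tendsto_nhds.1 hL (ε / 4) (by positivity), self_mem_nhdsWithin]
      with y hy hyω
    rw [Set.mem_preimage, Metric.mem_ball]
    linarith [dist_triangle (limUnder atTop fun n => g n y) (g n y) L, hn y hyω]
  · rw [Metric.mem_ball] at hy hz
    linarith [dist_triangle_right y z L]

theorem fderiv_fderiv_single {u : (Fin m → ℝ) → ℝ} {x : Fin m → ℝ} (hu : ContDiffAt ℝ 2 u x)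
    (i j : Fin m) :
    fderiv ℝ (fderiv ℝ u) x (Pi.single j 1) (Pi.single i 1) = pd (pd u i) j x := by
  have hd : DifferentiableAt ℝ (fderiv ℝ u) x :=
    (hu.fderiv_right (m := 1) (by norm_num)).differentiableAt (by simp)
  have : HasFDerivAt (pd u i) _ x := hd.hasFDerivAt.clm_apply (hasFDerivAt_const _ x)
  rw [pd, this.fderiv]
  simp

theorem dist_fderiv_le_sum {u v : (Fin m → ℝ) → ℝ} {x : Fin m → ℝ} {ε : ℝ}
    (h : ∀ i, |pd u i x - pd v i x| ≤ ε) : dist (fderiv ℝ u x) (fderiv ℝ v x) ≤ m * ε := by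
  refine (dist_eq_norm _ _).le.trans ?_
  refine (norm_fderiv_le_sum _).trans ((Finset.sum_le_sum (g := fun _ => ε) fun i _ => ?_).trans
    (by simp))
  exact h i

theorem dist_fderiv_fderiv_le_sum {u v : (Fin m → ℝ) → ℝ} {x : Fin m → ℝ} {ε : ℝ}
    (hu : ContDiffAt ℝ 2 u x) (hv : ContDiffAt ℝ 2 v x)
    (h : ∀ i j, |pd (pd u i) j x - pd (pd v i) j x| ≤ ε) :
    dist (fderiv ℝ (fderiv ℝ u) x) (fderiv ℝ (fderiv ℝ v) x) ≤ m * (m * ε) := by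
  rw [dist_eq_norm (fderiv ℝ (fderiv ℝ u) x)]
  refine (norm_fderiv_le_sum _).trans ((Finset.sum_le_sum (g := fun _ => m * ε)
    fun j _ => ?_).trans (by simp))
  refine (norm_fderiv_le_sum _).trans ((Finset.sum_le_sum (g := fun _ => ε) fun i _ => ?_).trans
    (by simp))
  rw [sub_apply, sub_apply, fderiv_fderiv_single hu, fderiv_fderiv_single hv]
  exact h i j

theorem uniformCauchySeqOn_of_eventually_le {F : Type*} [PseudoMetricSpace F]
    {g : ℕ → (Fin m → ℝ) → F} {C : ℝ}
    (h : ∀ ε > 0, ∀ᶠ p : ℕ × ℕ in atTop ×ˢ atTop, ∀ x ∈ ω, dist (g p.1 x) (g p.2 x) ≤ C * ε) :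
    UniformCauchySeqOn g atTop ω := by
  intro V hV
  obtain ⟨ε, hε, hεV⟩ := Metric.mem_uniformity_dist.1 hV
  filter_upwards [h (ε / (2 * (|C| + 1))) (by positivity)] with p hp x hx
  refine hεV ((hp x hx).trans_lt ?_)
  rw [mul_div_assoc', div_lt_iff₀ (by positivity)]
  nlinarith [le_abs_self C, abs_nonneg C]

theorem lipschitzWith_of_forall_pd_le {u : (Fin m → ℝ) → ℝ} (hω : IsOpen ω) (hc : Continuous u)
    (h0 : ∀ x ∉ ω, u x = 0) (hd : ∀ x ∈ ω, DifferentiableAt ℝ u x) {G : ℝ} (hG : 0 ≤ G)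
    (h : ∀ x ∈ ω, ∀ i, |pd u i x| ≤ G) : LipschitzWith (Real.toNNReal (m * G)) u := by
  refine lipschitzWith_of_fderiv_le hω hc h0 fun x hx => ⟨hd x hx, ?_⟩
  rw [Real.coe_toNNReal _ (by positivity)]
  exact (norm_fderiv_le_sum _).trans ((Finset.sum_le_sum (g := fun _ => G)
    fun i _ => h x hx i).trans (by simp))

variable {ρ : (Fin m → ℝ) → ℝ} {c C Λ R : ℝ} {f : ℝ → ℝ}

theorem sol_indicator (hb : Bornology.IsBounded ω) (hω : IsOpen ω) {ψ : (Fin m → ℝ) → ℝ}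
    (hψ : ContDiffOn ℝ 2 ψ (closure ω)) (hpos : ∀ x ∈ ω, 0 < ψ x)
    (hfr : ∀ x ∈ frontier ω, ψ x = 0) (heq : ∀ x ∈ ω, -lap ψ x = f (ψ x))
    (hact : action f ω ψ = 0) : Sol f ω (ω.indicator ψ) := by
  have hcl : Set.EqOn (ω.indicator ψ) ψ (closure ω) := fun x hx => by
    by_cases hxω : x ∈ ω
    · exact Set.indicator_of_mem hxω _
    · rw [Set.indicator_of_notMem hxω, hfr x ⟨hx, by rwa [hω.interior_eq]⟩]
  have hev : ∀ x ∈ ω, ω.indicator ψ =ᶠ[𝓝 x] ψ := fun x hx => by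
    filter_upwards [hω.mem_nhds hx] with y hy using Set.indicator_of_mem hy _
  have hcont : Continuous (ω.indicator ψ) := continuous_indicator hfr hψ.continuousOn
  have hs : ContDiffOn ℝ 2 (ω.indicator ψ) (closure ω) := hψ.congr hcl
  have hsω : ∀ x ∈ ω, ContDiffAt ℝ 2 (ω.indicator ψ) x := fun x hx =>
    (hs.mono subset_closure).contDiffAt (hω.mem_nhds hx)
  obtain ⟨M, hM⟩ := exists_norm_le_of_tendsto hb
    ((hs.mono subset_closure).continuousOn_fderiv_of_isOpen hω (by norm_num))
    fun x hx => (exists_tendsto_fderiv hω hs hx).1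
  refine ⟨⟨⟨M.toNNReal, lipschitzWith_of_fderiv_le hω hcont
    (fun x hx => Set.indicator_of_notMem hx _) fun x hx =>
      ⟨(hsω x hx).differentiableAt (by simp), (hM x hx).trans (Real.le_coe_toNNReal M)⟩⟩,
    fun x hx => Set.indicator_of_notMem hx _⟩, fun x hx => ?_, hs, fun x hx => ?_, ?_⟩
  · rw [Set.indicator_of_mem hx]
    exact hpos x hx
  · rw [lap_congr (hev x hx), Set.indicator_of_mem hx]
    exact heq x hx
  · rw [← hact]
    refine setIntegral_congr_fun hω.measurableSet fun x hx => ?_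
    simp only [pd_congr (hev x hx), Set.indicator_of_mem hx]

end Compactness

section Estimates

variable {m : ℕ} {ω : Set (Fin m → ℝ)} {ρ : (Fin m → ℝ) → ℝ} {c C Λ R : ℝ} {f : ℝ → ℝ}
  {u v : (Fin m → ℝ) → ℝ}

namespace Sol

theorem contDiffAt (hu : Sol f ω u) (hω : IsOpen ω) {x : Fin m → ℝ} (hx : x ∈ ω) :
    ContDiffAt ℝ 2 u x :=
  (hu.smooth.mono subset_closure).contDiffAt (hω.mem_nhds hx)

theorem nonneg (hu : Sol f ω u) (x : Fin m → ℝ) : 0 ≤ u x := by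
  by_cases hx : x ∈ ω
  · exact (hu.pos x hx).le
  · exact (hu.zeroLip.2 x hx).ge

theorem abs_le (hu : Sol f ω u) {M : ℝ} (hM : ∀ x, u x ≤ M) (x : Fin m → ℝ) : |u x| ≤ M := by
  rw [abs_of_nonneg (hu.nonneg x)]
  exact hM x

theorem frontier_eq_zero (hu : Sol f ω u) (hω : IsOpen ω) {x : Fin m → ℝ}
    (hx : x ∈ frontier ω) : u x = 0 :=
  hu.zeroLip.2 x fun h => hx.2 (by rwa [hω.interior_eq])

theorem lap_eq (hu : Sol f ω u) {x : Fin m → ℝ} (hx : x ∈ ω) : lap u x = -f (u x) := by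
  rw [← hu.eqn x hx, neg_neg]

theorem lap_eventuallyEq (hu : Sol f ω u) (hω : IsOpen ω) {x : Fin m → ℝ} (hx : x ∈ ω) :
    lap u =ᶠ[𝓝 x] fun y => -f (u y) := by
  filter_upwards [hω.mem_nhds hx] with y hy using hu.lap_eq hy

theorem differentiableAt_comp (hu : Sol f ω u) (hω : IsOpen ω) (hf : ContDiff ℝ 1 f)
    {x : Fin m → ℝ} (hx : x ∈ ω) : DifferentiableAt ℝ (fun y => f (u y)) x :=
  (hf.contDiffAt.differentiableAt (by simp)).comp x
    ((hu.contDiffAt hω hx).differentiableAt (by simp))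

theorem differentiableAt_lap (hu : Sol f ω u) (hω : IsOpen ω) (hf : ContDiff ℝ 1 f)
    {x : Fin m → ℝ} (hx : x ∈ ω) : DifferentiableAt ℝ (lap u) x :=
  (hu.differentiableAt_comp hω hf hx).neg.congr_of_eventuallyEq (hu.lap_eventuallyEq hω hx)

theorem pd_lap (hu : Sol f ω u) (hω : IsOpen ω) (hf : ContDiff ℝ 1 f)
    {x : Fin m → ℝ} (hx : x ∈ ω) (j : Fin m) :
    pd (lap u) j x = -(deriv f (u x) * pd u j x) := by
  rw [pd_congr (hu.lap_eventuallyEq hω hx) j, pd_neg, pd_comp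
    (hf.contDiffAt.differentiableAt (by simp)) ((hu.contDiffAt hω hx).differentiableAt (by simp))]

theorem exists_hessian_le (hu : Sol f ω u) (hb : Bornology.IsBounded ω) (hω : IsOpen ω) :
    ∃ M, ∀ x ∈ ω, ∀ i j, |pd (pd u i) j x| ≤ M := by
  have h1 : ContDiffOn ℝ 1 (fderiv ℝ u) ω :=
    (hu.smooth.mono subset_closure).fderiv_of_isOpen hω (by norm_num)
  obtain ⟨M, hM⟩ := exists_norm_le_of_tendsto hb
    (h1.continuousOn_fderiv_of_isOpen hω (by norm_num))
    fun x hx => (exists_tendsto_fderiv hω hu.smooth hx).2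
  refine ⟨M, fun x hx i j => ?_⟩
  rw [← fderiv_fderiv_single (hu.contDiffAt hω hx)]
  have h2 := ((fderiv ℝ (fderiv ℝ u) x) (Pi.single j 1)).le_opNorm (Pi.single i 1)
  have h3 := (fderiv ℝ (fderiv ℝ u) x).le_opNorm (Pi.single j 1)
  rw [norm_single_one, mul_one] at h2 h3
  exact (h2.trans h3).trans (hM x hx)

end Sol

namespace Collar

theorem exists_abs_pd_le (D : Collar ω ρ c C Λ R) (hf : Continuous f) (M : ℝ) :
    ∃ G ≥ (0:ℝ), ∀ u, Sol f ω u → (∀ x, u x ≤ M) → ∀ x ∈ ω, ∀ i, |pd u i x| ≤ G := by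
  obtain ⟨S, hS⟩ := (isCompact_Icc (a := -M) (b := M)).exists_bound_of_continuousOn
    hf.continuousOn
  obtain ⟨A, hA, h⟩ := D.exists_gradient_bound
  refine ⟨A * (|M| + (|S| + 1)), by positivity, fun u hu hM x hx i => ?_⟩
  refine (h u _ _ (by positivity) hu.smooth.continuousOn
    (fun x hx => hu.frontier_eq_zero D.isOpen hx) (hu.smooth.mono subset_closure)
    (fun x _ => (hu.abs_le hM x).trans (le_abs_self M)) (fun x hx => ?_) x hx).2 i
  rw [hu.lap_eq hx, abs_neg]
  have := hS (u x) (_root_.abs_le.1 (hu.abs_le hM x))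
  rw [Real.norm_eq_abs] at this
  linarith [le_abs_self S]

theorem exists_abs_pd_sub_le (D : Collar ω ρ c C Λ R) (hf : ContDiff ℝ 1 f) (M : ℝ) :
    ∃ A > (0:ℝ), ∀ u v, Sol f ω u → Sol f ω v → (∀ x, u x ≤ M) → (∀ x, v x ≤ M) → ∀ ε > 0,
      (∀ x ∈ ω, |u x - v x| ≤ ε) → ∀ x ∈ ω,
      |lap u x - lap v x| ≤ A * ε ∧ ∀ i, |pd u i x - pd v i x| ≤ A * ε := by
  have hω := D.isOpen
  obtain ⟨S, hS0, hS⟩ := exists_lipschitz_bound hf M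
  obtain ⟨A, hA, h⟩ := D.exists_gradient_bound
  refine ⟨S + A * (1 + (S + 1)), by positivity, fun u v hu hv huM hvM ε hε huv x hx => ?_⟩
  have hlap : ∀ x ∈ ω, |lap u x - lap v x| ≤ S * ε := fun x hx => by
    rw [hu.lap_eq hx, hv.lap_eq hx, neg_sub_neg, abs_sub_comm]
    exact (hS _ _ (hu.abs_le huM x) (hv.abs_le hvM x)).trans
      (mul_le_mul_of_nonneg_left (huv x hx) hS0)
  refine ⟨(hlap x hx).trans (mul_le_mul_of_nonneg_right (by
    have : 0 ≤ A * (1 + (S + 1)) := by positivity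
    linarith) hε.le), fun i => ?_⟩
  have hg := (h (fun y => u y - v y) ε ((S + 1) * ε) (by positivity)
    (hu.smooth.continuousOn.sub hv.smooth.continuousOn)
    (fun x hx => by rw [hu.frontier_eq_zero hω hx, hv.frontier_eq_zero hω hx, sub_zero])
    ((hu.smooth.sub hv.smooth).mono subset_closure) huv
    (fun x hx => by
      rw [lap_sub (hu.contDiffAt hω hx) (hv.contDiffAt hω hx)]
      linarith [hlap x hx]) x hx).2 i
  rw [pd_sub ((hu.contDiffAt hω hx).differentiableAt (by simp))
    ((hv.contDiffAt hω hx).differentiableAt (by simp))] at hg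
  have : 0 ≤ S * ε := by positivity
  linarith

theorem exists_abs_pd_pd_sub_le (D : Collar ω ρ c C Λ R) (hf : ContDiff ℝ 1 f) (M : ℝ) :
    ∃ B > (0:ℝ), ∀ ε > 0, ∃ δ > 0, ∀ u v, Sol f ω u → Sol f ω v → (∀ x, u x ≤ M) →
      (∀ x, v x ≤ M) → (∀ x ∈ ω, |u x - v x| ≤ δ) → ∀ x ∈ ω, ∀ i j,
      |pd (pd u i) j x - pd (pd v i) j x| ≤ B * ε := by
  have hω := D.isOpen
  have hf' : ContinuousOn (deriv f) (Set.Icc (-M) M) :=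
    (hf.continuous_deriv (by simp)).continuousOn
  obtain ⟨S, hS⟩ := (isCompact_Icc (a := -M) (b := M)).exists_bound_of_continuousOn hf'
  obtain ⟨G, hG0, hG⟩ := D.exists_abs_pd_le hf.continuous M
  obtain ⟨A, hA, hAd⟩ := D.exists_abs_pd_sub_le hf M
  obtain ⟨B, hB, h⟩ := D.exists_hessian_bound
  refine ⟨B * (A + A + (G + |S| * A + 1)), by positivity, fun ε hε => ?_⟩
  obtain ⟨δ, hδ, hδf⟩ := Metric.uniformContinuousOn_iff_le.1
    ((isCompact_Icc (a := -M) (b := M)).uniformContinuousOn_of_continuous hf') ε hε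
  refine ⟨min δ ε, by positivity, fun u v hu hv huM hvM huv x hx i j => ?_⟩
  have hd := hAd u v hu hv huM hvM ε hε fun x hx => (huv x hx).trans (min_le_right _ _)
  have duv : ∀ x ∈ ω, DifferentiableAt ℝ u x ∧ DifferentiableAt ℝ v x := fun x hx =>
    ⟨(hu.contDiffAt hω hx).differentiableAt (by simp),
      (hv.contDiffAt hω hx).differentiableAt (by simp)⟩
  have hlap : ∀ x ∈ ω, lap (fun y => u y - v y) =ᶠ[𝓝 x] fun y => lap u y - lap v y :=
    fun x hx => by
      filter_upwards [hω.mem_nhds hx] with y hy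
        using lap_sub (hu.contDiffAt hω hy) (hv.contDiffAt hω hy)
  obtain ⟨M₁, hM₁⟩ := hu.exists_hessian_le D.bounded hω
  obtain ⟨M₂, hM₂⟩ := hv.exists_hessian_le D.bounded hω
  have key := h (fun y => u y - v y) (A * ε) (A * ε) ((G + |S| * A + 1) * ε) (M₁ + M₂)
    (by positivity) (hu.smooth.continuousOn.sub hv.smooth.continuousOn)
    (fun x hx => by rw [hu.frontier_eq_zero hω hx, hv.frontier_eq_zero hω hx, sub_zero])
    ((hu.smooth.sub hv.smooth).mono subset_closure)
    (fun x hx i => by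
      rw [pd_sub (duv x hx).1 (duv x hx).2]
      exact (hd x hx).2 i)
    (fun x hx => by
      rw [(hlap x hx).eq_of_nhds]
      exact (hd x hx).1)
    (fun x hx => ((hu.differentiableAt_lap hω hf hx).fun_sub
      (hv.differentiableAt_lap hω hf hx)).congr_of_eventuallyEq (hlap x hx))
    (fun x hx j => by
      rw [pd_congr (hlap x hx), pd_sub (hu.differentiableAt_lap hω hf hx)
        (hv.differentiableAt_lap hω hf hx), hu.pd_lap hω hf hx, hv.pd_lap hω hf hx]
      have e1 := hδf (u x) (_root_.abs_le.1 (hu.abs_le huM x)) (v x) (_root_.abs_le.1 (hv.abs_le hvM x))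
        ((huv x hx).trans (min_le_left _ _))
      rw [Real.dist_eq] at e1
      have e2 := hG u hu huM x hx j
      have e3 := (hS (v x) (_root_.abs_le.1 (hv.abs_le hvM x))).trans (le_abs_self S)
      rw [Real.norm_eq_abs] at e3
      have e4 := (hd x hx).2 j
      have e5 : -(deriv f (u x) * pd u j x) - -(deriv f (v x) * pd v j x) =
          -((deriv f (u x) - deriv f (v x)) * pd u j x +
            deriv f (v x) * (pd u j x - pd v j x)) := by ring
      rw [e5, abs_neg]
      refine (abs_add_le _ _).trans ?_
      rw [abs_mul, abs_mul]
      have e6 := mul_le_mul e1 e2 (abs_nonneg _) hε.le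
      have e7 := mul_le_mul e3 e4 (abs_nonneg _) (abs_nonneg S)
      linarith)
    (fun x hx i j => by
      rw [pd_pd_sub (hu.contDiffAt hω hx) (hv.contDiffAt hω hx)]
      exact (abs_sub _ _).trans (add_le_add (hM₁ x hx i j) (hM₂ x hx i j)))
    x hx i j
  rw [pd_pd_sub (hu.contDiffAt hω hx) (hv.contDiffAt hω hx)] at key
  linarith

end Collar

end Estimates

section Limit

variable {m : ℕ} {ω : Set (Fin m → ℝ)} {ρ : (Fin m → ℝ) → ℝ} {c C Λ R : ℝ} {f : ℝ → ℝ}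

theorem tendsto_apply_of_tendsto {E F ι : Type*} [NormedAddCommGroup E] [NormedSpace ℝ E]
    [NormedAddCommGroup F] [NormedSpace ℝ F] {T : ι → E →L[ℝ] F} {S : E →L[ℝ] F} {l : Filter ι}
    (h : Tendsto T l (𝓝 S)) (v : E) : Tendsto (fun n => T n v) l (𝓝 (S v)) :=
  ((ContinuousLinearMap.apply ℝ F v).continuous.tendsto S).comp h

theorem Collar.exists_limit (D : Collar ω ρ c C Λ R) (hf : ContDiff ℝ 1 f)
    {u : ℕ → (Fin m → ℝ) → ℝ} (hu : ∀ n, Sol f ω (u n)) (hanti : Antitone u) :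
    ∃ φ, ZeroLip ω φ ∧ ContDiffOn ℝ 2 φ (closure ω) ∧ (∀ x ∈ ω, -lap φ x = f (φ x)) ∧
      (∀ x n, φ x ≤ u n x) ∧ (∀ x, Tendsto (fun n => u n x) atTop (𝓝 (φ x))) ∧
      (∀ x ∈ ω, ∀ i, Tendsto (fun n => pd (u n) i x) atTop (𝓝 (pd φ i x))) ∧
      ∃ K, ∀ n, LipschitzWith K (u n) := by
  have hω := D.isOpen
  obtain ⟨M, -, hM0⟩ := (hu 0).zeroLip.exists_abs_le D.bounded
  have hM : ∀ n x, u n x ≤ M := fun n x =>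
    (hanti (Nat.zero_le n) x).trans ((le_abs_self _).trans (hM0 x))
  obtain ⟨G, hG0, hG⟩ := D.exists_abs_pd_le hf.continuous M
  have hd : ∀ n, ∀ x ∈ ω, DifferentiableAt ℝ (u n) x := fun n x hx =>
    ((hu n).contDiffAt hω hx).differentiableAt (by simp)
  have hlip : ∀ n, LipschitzWith (Real.toNNReal (m * G)) (u n) := fun n =>
    lipschitzWith_of_forall_pd_le hω (hu n).zeroLip.continuous (hu n).zeroLip.2 (hd n) hG0
      (hG _ (hu n) (hM n))
  have hbdd : ∀ x, BddBelow (Set.range fun n => u n x) := fun x =>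
    ⟨0, by rintro _ ⟨n, rfl⟩; exact (hu n).nonneg x⟩
  set φ : (Fin m → ℝ) → ℝ := fun x => ⨅ n, u n x with hφ
  have hlim : ∀ x, Tendsto (fun n => u n x) atTop (𝓝 (φ x)) := fun x =>
    tendsto_atTop_ciInf (fun a b h => hanti h x) (hbdd x)
  have hφlip : LipschitzWith (Real.toNNReal (m * G)) φ := LipschitzWith.of_dist_le_mul fun x y =>
    le_of_tendsto ((hlim x).dist (hlim y)) (Eventually.of_forall fun n => (hlip n).dist_le_mul x y)
  have hφ0 : ∀ x ∉ ω, φ x = 0 := fun x hx => by simp [hφ, (hu _).zeroLip.2 x hx]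
  have hφc := hφlip.continuous
  have hdini : TendstoUniformlyOn u φ atTop ω :=
    (Antitone.tendstoUniformlyOn_of_forall_tendsto D.bounded.isCompact_closure
      (fun n => (hu n).zeroLip.continuous.continuousOn) (fun x _ a b h => hanti h x)
      hφc.continuousOn fun x _ => hlim x).mono subset_closure
  have hcauchy : ∀ δ > 0, ∀ᶠ p : ℕ × ℕ in atTop ×ˢ atTop, ∀ x ∈ ω, |u p.1 x - u p.2 x| ≤ δ :=
    fun δ hδ => by
      filter_upwards [hdini.uniformCauchySeqOn _ (Metric.dist_mem_uniformity hδ)] with p hp x hx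
        using (hp x hx).le
  obtain ⟨A, hA, hAd⟩ := D.exists_abs_pd_sub_le hf M
  obtain ⟨B, hB, hBd⟩ := D.exists_abs_pd_pd_sub_le hf M
  have hc1 : UniformCauchySeqOn (fun n => fderiv ℝ (u n)) atTop ω :=
    uniformCauchySeqOn_of_eventually_le (C := m * A) fun ε hε => by
      filter_upwards [hcauchy ε hε] with p hp x hx
      rw [mul_assoc]
      exact dist_fderiv_le_sum (hAd _ _ (hu _) (hu _) (hM _) (hM _) ε hε hp x hx).2
  have hc2 : UniformCauchySeqOn (fun n => fderiv ℝ (fderiv ℝ (u n))) atTop ω :=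
    uniformCauchySeqOn_of_eventually_le (g := fun n => fderiv ℝ (fderiv ℝ (u n)))
      (C := m * (m * B)) fun ε hε => by
      obtain ⟨δ, hδ, hδB⟩ := hBd ε hε
      filter_upwards [hcauchy δ hδ] with p hp x hx
      rw [mul_assoc, mul_assoc]
      exact dist_fderiv_fderiv_le_sum ((hu _).contDiffAt hω hx) ((hu _).contDiffAt hω hx)
        (hδB _ _ (hu _) (hu _) (hM _) (hM _) hp x hx)
  obtain ⟨g, hg, hgl⟩ := exists_uniform_limit hc1 fun n x hx =>
    (exists_tendsto_fderiv hω (hu n).smooth hx).1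
  obtain ⟨H, hH, hHl⟩ := exists_uniform_limit
    (g := fun n => fderiv ℝ (fderiv ℝ (u n))) hc2 fun n x hx =>
    (exists_tendsto_fderiv hω (hu n).smooth hx).2
  have hsm : ∀ n, ContDiffOn ℝ 1 (fderiv ℝ (u n)) ω := fun n =>
    ((hu n).smooth.mono subset_closure).fderiv_of_isOpen hω (by norm_num)
  have hφd : ∀ x ∈ ω, HasFDerivAt φ (g x) x := fun x hx =>
    hasFDerivAt_of_tendstoUniformlyOn hω hg (fun n y hy => (hd n y hy).hasFDerivAt)
      (fun y _ => hlim y) hx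
  have hgd : ∀ x ∈ ω, HasFDerivAt g (H x) x := fun x hx =>
    hasFDerivAt_of_tendstoUniformlyOn hω hH
      (fun n y hy => (((hsm n).contDiffAt (hω.mem_nhds hy)).differentiableAt
        (by simp)).hasFDerivAt) (fun y hy => hg.tendsto_at hy) hx
  have hfg : Set.EqOn (fderiv ℝ φ) g ω := fun x hx => (hφd x hx).fderiv
  have hfg' : ∀ x ∈ ω, fderiv ℝ φ =ᶠ[𝓝 x] g := fun x hx => by
    filter_upwards [hω.mem_nhds hx] with y hy using hfg hy
  have hfH : Set.EqOn (fderiv ℝ (fderiv ℝ φ)) H ω := fun x hx => by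
    rw [(hfg' x hx).fderiv_eq, (hgd x hx).fderiv]
  have hHc : ContinuousOn H ω := hH.continuousOn (Eventually.frequently (Eventually.of_forall
    fun n => (hsm n).continuousOn_fderiv_of_isOpen hω (by norm_num)))
  have h2 : ContDiffOn ℝ 2 φ ω := by
    refine (contDiffOn_succ_iff_fderiv_of_isOpen (n := 1) hω).2
      ⟨fun x hx => (hφd x hx).differentiableAt.differentiableWithinAt, by simp, ?_⟩
    refine (contDiffOn_succ_iff_fderiv_of_isOpen (n := 0) hω).2
      ⟨fun x hx => ((hgd x hx).congr_of_eventuallyEq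
        (hfg' x hx)).differentiableAt.differentiableWithinAt, by simp, ?_⟩
    exact contDiffOn_zero.2 (hHc.congr hfH)
  have hcl := D.contDiffOn_two_closure hφc.continuousOn h2
    (fun x hx => (hgl x hx).imp fun L hL => hL.congr' (by
      filter_upwards [self_mem_nhdsWithin] with y hy using (hfg hy).symm))
    (fun x hx => (hHl x hx).imp fun L hL => hL.congr' (by
      filter_upwards [self_mem_nhdsWithin] with y hy using (hfH hy).symm))
  refine ⟨φ, ⟨⟨_, hφlip⟩, hφ0⟩, hcl, fun x hx => ?_, fun x n => ciInf_le (hbdd x) n, hlim,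
    fun x hx i => ?_, _, hlip⟩
  · have e1 : Tendsto (fun n => -lap (u n) x) atTop (𝓝 (-lap φ x)) := by
      simp only [lap_eq_sum_pd]
      refine (tendsto_finsetSum _ fun i _ => ?_).neg
      rw [← fderiv_fderiv_single (h2.contDiffAt (hω.mem_nhds hx)), hfH hx]
      simp only [← fderiv_fderiv_single ((hu _).contDiffAt hω hx)]
      exact tendsto_apply_of_tendsto (tendsto_apply_of_tendsto (hH.tendsto_at hx) _) _
    refine tendsto_nhds_unique e1 ?_
    simp only [(hu _).eqn x hx]
    exact (hf.continuous.tendsto _).comp (hlim x)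
  · rw [pd, hfg hx]
    exact tendsto_apply_of_tendsto (hg.tendsto_at hx) _

end Limit

section Minimal

variable {m : ℕ} {ω : Set (Fin m → ℝ)} {ρ : (Fin m → ℝ) → ℝ} {c C Λ R : ℝ} {f : ℝ → ℝ}

theorem tendsto_setIntegral_sum_pd_sq (hb : Bornology.IsBounded ω) (hω : IsOpen ω)
    {u : ℕ → (Fin m → ℝ) → ℝ} {φ : (Fin m → ℝ) → ℝ} {G M a : ℝ} {Φ : ℝ → ℝ} (hΦ : Continuous Φ)
    (hu : ∀ n, Continuous (u n)) (hG : ∀ n, ∀ x ∈ ω, ∀ i, |pd (u n) i x| ≤ G)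
    (hM : ∀ n, ∀ x ∈ ω, |u n x| ≤ M) (hlim : ∀ x ∈ ω, Tendsto (fun n => u n x) atTop (𝓝 (φ x)))
    (hpd : ∀ x ∈ ω, ∀ i, Tendsto (fun n => pd (u n) i x) atTop (𝓝 (pd φ i x))) :
    Tendsto (fun n => ∫ x in ω, (a * (∑ i, (pd (u n) i x) ^ 2) + Φ (u n x))) atTop
      (𝓝 (∫ x in ω, (a * (∑ i, (pd φ i x) ^ 2) + Φ (φ x)))) := by
  obtain ⟨S, hS⟩ := (isCompact_Icc (a := -M) (b := M)).exists_bound_of_continuousOn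
    hΦ.continuousOn
  have hfin : IsFiniteMeasure (volume.restrict ω) := ⟨by simpa using hb.measure_lt_top⟩
  refine tendsto_integral_of_dominated_convergence (fun _ => |a| * (m * G ^ 2) + S)
    (fun n => ?_) (integrable_const _) (fun n => ?_) ?_
  · have h1 := fun i => measurable_pd (u n) i
    have h2 : Measurable fun x => Φ (u n x) := (hΦ.comp (hu n)).measurable
    exact Measurable.aestronglyMeasurable (by fun_prop)
  · refine (ae_restrict_iff' hω.measurableSet).2 (ae_of_all _ fun x hx => ?_)
    refine (norm_add_le _ _).trans (add_le_add ?_ (hS _ (abs_le.1 (hM n x hx))))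
    rw [norm_mul, Real.norm_eq_abs, Real.norm_eq_abs,
      abs_of_nonneg (a := ∑ i, _) (Finset.sum_nonneg fun i _ => sq_nonneg _)]
    refine mul_le_mul_of_nonneg_left ?_ (abs_nonneg a)
    refine (Finset.sum_le_sum (g := fun _ => G ^ 2) fun i _ => ?_).trans (by simp)
    exact sq_le_sq' (abs_le.1 (hG n x hx i)).1 (abs_le.1 (hG n x hx i)).2
  · refine (ae_restrict_iff' hω.measurableSet).2 (ae_of_all _ fun x hx => ?_)
    exact ((tendsto_finsetSum _ fun i _ => (hpd x hx i).pow 2).const_mul a).add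
      ((hΦ.tendsto _).comp (hlim x hx))

theorem zeroLip_zero : ZeroLip ω fun _ => 0 :=
  ⟨⟨0, LipschitzWith.const 0⟩, fun _ _ => rfl⟩

theorem pd_zero (i : Fin m) (x : Fin m → ℝ) : pd (fun _ => 0) i x = 0 := by simp [pd]

theorem action_zero : action f ω (fun _ => 0) = 0 := by
  simp [action, pd_zero, primF_zero]

/-- A decreasing sequence of positive solutions with zero action converges to a positive solution
with zero action. -/
theorem Collar.exists_sol_limit (D : Collar ω ρ c C Λ R) (hf : ContDiff ℝ 1 f) (hH : H1' f ω)
    {u : ℕ → (Fin m → ℝ) → ℝ} (hu : ∀ n, Sol f ω (u n)) (hanti : Antitone u) :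
    ∃ φ, Sol f ω φ ∧ ∀ x n, φ x ≤ u n x := by
  have hω := D.isOpen
  have hb := D.bounded
  obtain ⟨-, hpos', ε, hε, hiso⟩ := hH
  have hpos : ∀ v, ZeroLip ω v → 0 ≤ action f ω v := fun v hv => hpos' v hv.1 hv.2
  obtain ⟨φ, hφ, hsm, heq, hle, hlim, hpd, K, hK⟩ := D.exists_limit hf hu hanti
  obtain ⟨M, -, hM0⟩ := (hu 0).zeroLip.exists_abs_le hb
  have hM : ∀ n x, |u n x| ≤ M := fun n =>
    (hu n).abs_le fun x => (hanti (Nat.zero_le n) x).trans ((le_abs_self _).trans (hM0 x))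
  have hφ0 : ∀ x, 0 ≤ φ x := fun x =>
    ge_of_tendsto (hlim x) (Eventually.of_forall fun n => (hu n).nonneg x)
  have hact : action f ω φ = 0 := by
    have h := tendsto_setIntegral_sum_pd_sq (a := 1 / 2) (Φ := fun t => -primF f t) hb hω
      (continuous_primF hf.continuous).neg (fun n => (hu n).zeroLip.continuous)
      (fun n x _ i => abs_pd_le_of_lipschitz (hK n) i x) (fun n x _ => hM n x)
      (fun x _ => hlim x) hpd
    simp only [← sub_eq_add_neg] at h
    refine tendsto_nhds_unique h ?_
    have : ∀ n, ∫ x in ω, (1 / 2 * (∑ i, (pd (u n) i x) ^ 2) - primF f (u n x)) = 0 :=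
      fun n => (hu n).action_eq_zero
    simp only [this, tendsto_const_nhds]
  refine ⟨φ, ⟨hφ, fun x hx => ?_, hsm, heq, hact⟩, hle⟩
  by_contra hx0
  set S : Set (Fin m → ℝ) := {x | φ x = 0} with hSdef
  have hxS : x ∈ S := le_antisymm (not_lt.1 hx0) (hφ0 x)
  have hS : IsOpen (ω ∩ S) :=
    isOpen_eq_set hf hb hω hpos hφ zeroLip_zero hφ0 hact action_zero
  have hS' : IsOpen (ω \ S) := hω.sdiff (isClosed_eq hφ.continuous continuous_const)
  have hSc : IsOpen (ω ∩ Sᶜ) := by rwa [← Set.sdiff_eq]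
  have hSc' : IsOpen (ω \ Sᶜ) := by rwa [Set.sdiff_compl]
  have hw : ∀ n, ZeroLip ω (S.indicator (u n)) := fun n => (hu n).zeroLip.indicator hS hS'
  have hw0 : ∀ n, action f ω (S.indicator (u n)) = 0 := fun n => by
    have h1 := action_indicator_add_compl hf.continuous hb hω (hu n).zeroLip hS hS'
    have h2 := hpos _ (hw n)
    have h3 := hpos _ ((hu n).zeroLip.indicator hSc hSc')
    rw [(hu n).action_eq_zero] at h1
    linarith
  have hwpos : ∀ n, 0 < ∫ x in ω, ((∑ i, (pd (S.indicator (u n)) i x) ^ 2) +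
      (S.indicator (u n) x) ^ 2) := fun n => by
    by_contra! hneg
    have hc : Continuous fun x => (S.indicator (u n) x) ^ 2 := (hw n).continuous.pow 2
    have hi : IntegrableOn (fun x => ∑ i, (pd (S.indicator (u n)) i x) ^ 2) ω := by
      simp only [sum_pd_sq]
      exact (hw n).integrableOn_gradDot hb hω (hw n)
    rw [integral_add hi (integrableOn_of_continuous hb hc)] at hneg
    have h1 : 0 ≤ ∫ x in ω, ∑ i, (pd (S.indicator (u n)) i x) ^ 2 :=
      integral_nonneg fun x => Finset.sum_nonneg fun i _ => sq_nonneg _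
    have h2 := eq_zero_of_setIntegral_nonpos hω hb hc (fun x => sq_nonneg _)
      (by linarith) x hx
    rw [Set.indicator_of_mem hxS] at h2
    exact ((hu n).pos x hx).ne' (pow_eq_zero_iff two_ne_zero |>.1 h2)
  have hwlim := tendsto_setIntegral_sum_pd_sq (a := 1) (Φ := fun t => t ^ 2) (φ := fun _ => 0)
    (u := fun n => S.indicator (u n)) (G := K) (M := M) hb hω (continuous_pow 2)
    (fun n => (hw n).continuous)
    (fun n y hy i => by
      rw [pd_indicator hS hS' hy]
      by_cases hyS : y ∈ S
      · rw [Set.indicator_of_mem hyS]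
        exact abs_pd_le_of_lipschitz (hK n) i y
      · simp [hyS])
    (fun n y _ => by
      by_cases hyS : y ∈ S
      · rw [Set.indicator_of_mem hyS]
        exact hM n y
      · rw [Set.indicator_of_notMem hyS, abs_zero]
        exact (abs_nonneg _).trans (hM n y))
    (fun y _ => by
      by_cases hyS : y ∈ S
      · simp only [Set.indicator_of_mem hyS]
        exact hyS ▸ hlim y
      · simp [hyS])
    (fun y hy i => by
      simp only [pd_indicator hS hS' hy]
      by_cases hyS : y ∈ S
      · simp only [Set.indicator_of_mem hyS]
        have h0 : φ =ᶠ[𝓝 y] fun _ => 0 := by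
          filter_upwards [hS.mem_nhds ⟨hy, hyS⟩] with z hz using hz.2
        rw [← pd_congr h0]
        exact hpd y hy i
      · simp [hyS, pd_zero])
  have hlt : ∀ᶠ n in atTop, ∫ x in ω, (1 * (∑ i, (pd (S.indicator (u n)) i x) ^ 2) +
      (S.indicator (u n) x) ^ 2) < ε := hwlim.eventually (gt_mem_nhds (by simpa [pd_zero]))
  obtain ⟨n, hn⟩ := hlt.exists
  simp only [one_mul] at hn
  exact (hiso _ (hw n).1 (hw n).2 (hwpos n) hn.le).ne' (hw0 n)

theorem Collar.exists_minimal_sol (D : Collar ω ρ c C Λ R) (hf : ContDiff ℝ 1 f) (hH : H1' f ω)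
    (hne : ∃ u, Sol f ω u) : ∃ φ, Sol f ω φ ∧ ∀ v, Sol f ω v → ∀ x ∈ ω, φ x ≤ v x := by
  have hω := D.isOpen
  have hb := D.bounded
  have hpos : ∀ v, ZeroLip ω v → 0 ≤ action f ω v := fun v hv => hH.2.1 v hv.1 hv.2
  have int : ∀ {u}, Sol f ω u → IntegrableOn u ω := fun hu =>
    integrableOn_of_continuous hb hu.zeroLip.continuous
  set T : Set ℝ := {t | ∃ u, Sol f ω u ∧ ∫ x in ω, u x = t} with hT
  have hTb : BddBelow T :=
    ⟨0, by rintro _ ⟨u, hu, rfl⟩; exact integral_nonneg hu.nonneg⟩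
  obtain ⟨t, -, ht, htT⟩ := exists_seq_tendsto_sInf
    (show T.Nonempty from hne.imp' (fun u => ∫ x in ω, u x) fun u hu => ⟨u, hu, rfl⟩) hTb
  choose s hs hst using htT
  let u : ℕ → (Fin m → ℝ) → ℝ := fun n =>
    Nat.rec (s 0) (fun k w x => min (w x) (s (k + 1) x)) n
  have hu : ∀ n, Sol f ω (u n) := fun n => by
    induction n with
    | zero => exact hs 0
    | succ k ih => exact Sol.inf hf hb D hpos ih (hs (k + 1))
  have hus : ∀ n x, u n x ≤ s n x := fun n x => by
    cases n with
    | zero => exact le_rfl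
    | succ k => exact min_le_right _ _
  have hanti : Antitone u := antitone_nat_of_succ_le fun n x => min_le_left _ _
  obtain ⟨φ, hφ, hle⟩ := D.exists_sol_limit hf hH hu hanti
  have hφI : ∫ x in ω, φ x ≤ sInf T := ge_of_tendsto' ht fun n => by
    rw [← hst n]
    exact integral_mono (int hφ) (int (hs n)) fun x => (hle x n).trans (hus n x)
  refine ⟨φ, hφ, fun v hv x hx => ?_⟩
  have hmin := Sol.inf hf hb D hpos hφ hv
  have hI := csInf_le hTb ⟨_, hmin, rfl⟩
  have h0 : ∫ x in ω, (φ x - min (φ x) (v x)) ≤ 0 := by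
    rw [integral_sub (int hφ) (int hmin)]
    linarith
  have := eq_zero_of_setIntegral_nonpos hω hb
    (hφ.zeroLip.continuous.sub hmin.zeroLip.continuous)
    (fun x => sub_nonneg.2 (min_le_left _ _)) h0 x hx
  exact min_eq_left_iff.1 (sub_eq_zero.1 this).symm

end Minimal

/-- under (H1') and (H2') there exists a minimal positive `C²` solution `φ` of
`-Δφ = f(φ)` in `ω`, vanishing on `∂ω`, with zero action: every other positive zero-action
solution dominates it pointwise in `ω`. -/
theorem minimal_solution_exists (N : ℕ) (hN : 2 ≤ N)
    (ω : Set (Fin (N - 1) → ℝ)) (hωo : IsOpen ω) (hωb : Bornology.IsBounded ω)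
    (hωs : HasSmoothBoundary ω)
    (f : ℝ → ℝ) (hf : ContDiff ℝ 1 f)
    (hH1 : H1' f ω) (hH2 : H2' f ω) :
    ∃ φ : (Fin (N - 1) → ℝ) → ℝ,
      ContDiffOn ℝ 2 φ (closure ω) ∧
      (∀ x ∈ ω, 0 < φ x) ∧
      (∀ x ∈ frontier ω, φ x = 0) ∧
      (∀ x ∈ ω, -lap φ x = f (φ x)) ∧
      action f ω φ = 0 ∧
      (∀ ψ : (Fin (N - 1) → ℝ) → ℝ, ContDiffOn ℝ 2 ψ (closure ω) →
        (∀ x ∈ ω, 0 < ψ x) → (∀ x ∈ frontier ω, ψ x = 0) →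
        (∀ x ∈ ω, -lap ψ x = f (ψ x)) → action f ω ψ = 0 → ∀ x ∈ ω, φ x ≤ ψ x) := by
  obtain ⟨ρ, c, C, Λ, R, D⟩ := exists_collar hωb hωs
  obtain ⟨ψ₀, h1, h2, h3, h4, h5⟩ := hH2
  obtain ⟨φ, hφ, hmin⟩ := D.exists_minimal_sol hf hH1 ⟨_, sol_indicator hωb hωo h1 h2 h3 h4 h5⟩
  refine ⟨φ, hφ.smooth, hφ.pos, fun x hx => hφ.frontier_eq_zero hωo hx, hφ.eqn,
    hφ.action_eq_zero, fun ψ g1 g2 g3 g4 g5 x hx => ?_⟩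
  have := hmin _ (sol_indicator hωb hωo g1 g2 g3 g4 g5) x hx
  rwa [Set.indicator_of_mem hx] at this
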